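/- Assume the dilations are isotropic, a_j = α_j I with α_j real nonzero and |α_j| → ∞. Suppose ψ ∈ L¹(ℝ^d) satisfies sup_{|y| ≤ 1} ‖ψ − ψ(·−y)‖_{H¹} < ∞ (in particular ψ − ψ(·−y) ∈ H¹ for |y| ≤ 1). Then the synthesis operator S : ℓ¹(h¹) → H¹(ℝ^d) is bounded: if c ∈ ℓ¹(h¹) then Sc = Σ_{j>0} Σ_{k∈ℤ^d} c_{j,k} ψ_{j,k} converges in the sense that for each j the sum over k converges absolutely in L¹ to a function belonging to H¹, the sum over j converges absolutely in H¹, and ‖Sc‖_{H¹} ≤ C ‖c‖_{ℓ¹(h¹)} for a constant C = C(ψ, b). -/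

import Mathlib

open MeasureTheory Filter Matrix Set
open scoped ENNReal NNReal Topology

noncomputable section

namespace AffinePaper

/-- Embed an integer lattice point `k ∈ ℤ^d` into `ℝ^d`. -/
def intVec {d : ℕ} (k : Fin d → ℤ) : Fin d → ℝ := fun i => (k i : ℝ)

/-- Euclidean norm `|x|` on `ℝ^d`. -/
def eucNorm {d : ℕ} (x : Fin d → ℝ) : ℝ := Real.sqrt (∑ i, x i ^ 2)

/-- The constant `C_d = Γ((d+1)/2) π^{-(d+1)/2}` of the Riesz kernel. -/
def rieszConst (d : ℕ) : ℝ :=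
  Real.Gamma (((d : ℝ) + 1) / 2) / Real.pi ^ (((d : ℝ) + 1) / 2)

/-- The (vector-valued) Riesz kernel `Z(x) = C_d x / |x|^{d+1}`, with `Z(0) = 0`. -/
def rieszKernel (d : ℕ) (x : Fin d → ℝ) : Fin d → ℝ :=
  if x = 0 then 0 else fun i => rieszConst d * x i / eucNorm x ^ (d + 1)

/-- The truncated singular integral `∫_{|y| > ε} f(x-y) Z(y) dy` (vector-valued). -/
def truncRiesz {d : ℕ} (f : (Fin d → ℝ) → ℂ) (x : Fin d → ℝ) (ε : ℝ) : Fin d → ℂ :=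
  ∫ y in {y : Fin d → ℝ | ε < eucNorm y}, (fun i => f (x - y) * ((rieszKernel d y i : ℝ) : ℂ))

/-- `g` is the Riesz transform `Rf = f * Z` of `f`, in the principal value sense:
for a.e. `x` the truncated integrals converge to `g(x)` as `ε → 0+`. -/
def HasRiesz {d : ℕ} (f : (Fin d → ℝ) → ℂ) (g : (Fin d → ℝ) → Fin d → ℂ) : Prop :=
  ∀ᵐ x : Fin d → ℝ, Tendsto (fun ε : ℝ => truncRiesz f x ε) (𝓝[>] 0) (𝓝 (g x))

/-- Membership in the Hardy space `H¹(ℝ^d) = { f ∈ L¹ : Rf ∈ L¹ }`. -/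
def MemH1 {d : ℕ} (f : (Fin d → ℝ) → ℂ) : Prop :=
  Integrable f volume ∧ ∃ g : (Fin d → ℝ) → Fin d → ℂ, Integrable g volume ∧ HasRiesz f g

/-- The Hardy norm `‖f‖_{H¹} = ‖f‖₁ + ‖Rf‖₁`, as a value in `[0,∞]` (equal to `∞` when
`f` admits no integrable Riesz transform; the Riesz transform is a.e. unique, so the
infimum below is over a set of at most one value). -/
def hardyNorm {d : ℕ} (f : (Fin d → ℝ) → ℂ) : ℝ≥0∞ :=
  ENNReal.ofReal (∫ x : Fin d → ℝ, ‖f x‖) +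
    sInf {r : ℝ≥0∞ | ∃ g : (Fin d → ℝ) → Fin d → ℂ,
      Integrable g volume ∧ HasRiesz f g ∧ r = ENNReal.ofReal (∫ x : Fin d → ℝ, ‖g x‖)}

/-- The centered open unit cube `C₀ = (-1/2, 1/2)^d`. -/
def centeredCube (d : ℕ) : Set (Fin d → ℝ) :=
  Set.univ.pi fun _ => Set.Ioo (-(1/2) : ℝ) (1/2)

/-- `ν` is a smooth cut-off function: supported in the centered unit cube `C₀` and
identically `1` near the origin. -/
structure IsCutoff (d : ℕ) (ν : (Fin d → ℝ) → ℝ) : Prop where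
  smooth : ContDiff ℝ (⊤ : ℕ∞) ν
  supp : tsupport ν ⊆ centeredCube d
  one_near_zero : ∀ᶠ ξ in 𝓝 0, ν ξ = 1

/-- The periodic function `ζ(ξ) = -i (ξ b⁻¹ / |ξ b⁻¹|) ν(ξ)` (vector-valued), whose Fourier
coefficients define the discrete Riesz kernel. -/
def zetaFn {d : ℕ} (b : Matrix (Fin d) (Fin d) ℝ) (ν : (Fin d → ℝ) → ℝ)
    (ξ : Fin d → ℝ) : Fin d → ℂ :=
  fun i => -Complex.I * ((((ξ ᵥ* b⁻¹) i / eucNorm (ξ ᵥ* b⁻¹) : ℝ)) : ℂ) * ((ν ξ : ℝ) : ℂ)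

/-- The discrete Riesz kernel `z = {z_k}`, defined through its Fourier series
`Σ_k z_k e^{-2πi ξ k} = ζ(ξ)`, `ξ ∈ C₀`; that is, `z_k = ∫_{C₀} ζ(ξ) e^{2πi ξ k} dξ`. -/
def zKernel {d : ℕ} (b : Matrix (Fin d) (Fin d) ℝ) (ν : (Fin d → ℝ) → ℝ)
    (k : Fin d → ℤ) : Fin d → ℂ :=
  ∫ ξ in centeredCube d,
    Complex.exp (((2 * Real.pi * ∑ i, ξ i * (k i : ℝ) : ℝ)) * Complex.I) • zetaFn b ν ξ

/-- Discrete convolution `(s * z)_k = Σ_l s_{k-l} z_l` of a scalar sequence with the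
(vector-valued) kernel `z`, in the `k`-index. -/
def dConv {d : ℕ} (s : (Fin d → ℤ) → ℂ) (z : (Fin d → ℤ) → Fin d → ℂ)
    (k : Fin d → ℤ) : Fin d → ℂ :=
  ∑' l : Fin d → ℤ, s (k - l) • z l

/-- The discrete Hardy norm `‖s‖_{h¹} = ‖s‖_{ℓ¹} + ‖s * z‖_{ℓ¹}` (value in `[0,∞]`). -/
def h1Norm {d : ℕ} (b : Matrix (Fin d) (Fin d) ℝ) (ν : (Fin d → ℝ) → ℝ)
    (s : (Fin d → ℤ) → ℂ) : ℝ≥0∞ :=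
  (∑' k : Fin d → ℤ, (‖s k‖₊ : ℝ≥0∞)) +
    ∑' k : Fin d → ℤ, (‖dConv s (zKernel b ν) k‖₊ : ℝ≥0∞)

/-- The mixed norm `‖c‖_{ℓ¹(h¹)} = Σ_j ‖c_j‖_{h¹}` (value in `[0,∞]`). -/
def l1h1Norm {d : ℕ} (b : Matrix (Fin d) (Fin d) ℝ) (ν : (Fin d → ℝ) → ℝ)
    (c : ℕ → (Fin d → ℤ) → ℂ) : ℝ≥0∞ :=
  ∑' j : ℕ, h1Norm b ν (c j)

/-- `ψ_{j,k}(x) = |det a_j| ψ(a_j x - bk)` for isotropic dilations `a_j = α_j I`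
(Hardy-space normalization, `p = 1`). -/
def rescH {d : ℕ} (α : ℕ → ℝ) (b : Matrix (Fin d) (Fin d) ℝ) (ψ : (Fin d → ℝ) → ℂ)
    (j : ℕ) (k : Fin d → ℤ) (x : Fin d → ℝ) : ℂ :=
  ((|α j| ^ d : ℝ) : ℂ) * ψ (α j • x - b *ᵥ intVec k)

/-- The synthesis series `Sc = Σ_j Σ_k c_{j,k} ψ_{j,k}` converges to `f` in `H¹`:
for each `j` the sum over `k` converges absolutely in `L¹` to a function belonging to
`H¹`, and the sum over `j` converges absolutely in `H¹`, with limit `f`. -/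
def H1SynthesisTo {d : ℕ} (α : ℕ → ℝ) (b : Matrix (Fin d) (Fin d) ℝ)
    (ψ : (Fin d → ℝ) → ℂ) (c : ℕ → (Fin d → ℤ) → ℂ) (f : (Fin d → ℝ) → ℂ) : Prop :=
  (∀ j : ℕ, Summable fun k : Fin d → ℤ => ∫ x : Fin d → ℝ, ‖c j k * rescH α b ψ j k x‖) ∧
  (∀ j : ℕ, MemH1 (fun x => ∑' k : Fin d → ℤ, c j k * rescH α b ψ j k x)) ∧
  Summable (fun j : ℕ =>
    (hardyNorm (fun x => ∑' k : Fin d → ℤ, c j k * rescH α b ψ j k x)).toReal) ∧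
  Tendsto (fun J : ℕ => hardyNorm
      (fun x => f x - ∑ j ∈ Finset.range J, ∑' k : Fin d → ℤ, c j k * rescH α b ψ j k x))
    atTop (𝓝 0)

/-- Analysis operator at scale `j` in the Hardy-space setting (`p = 1`, `q = ∞`):
`(T_j f)_k = |det b| ⟨f, φ_{j,k}⟩` with `φ_{j,k}(x) = φ(α_j x - bk)`. -/
def TjH {d : ℕ} (α : ℕ → ℝ) (b : Matrix (Fin d) (Fin d) ℝ) (φ : (Fin d → ℝ) → ℂ)
    (f : (Fin d → ℝ) → ℂ) (j : ℕ) (k : Fin d → ℤ) : ℂ :=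
  ((|b.det| : ℝ) : ℂ) *
    ∫ x : Fin d → ℝ, f x * (starRingEnd ℂ) (φ (α j • x - b *ᵥ intVec k))

/-- Dot product of row vector `ξ` and column vector `x`. -/
def dotP {d : ℕ} (ξ x : Fin d → ℝ) : ℝ := ∑ i, ξ i * x i

/-- Fourier transform `f̂(ξ) = ∫ f(x) e^{-2πi ξ x} dx`. -/
def ft {d : ℕ} (f : (Fin d → ℝ) → ℂ) (ξ : Fin d → ℝ) : ℂ :=
  ∫ x : Fin d → ℝ, Complex.exp ((-(2 * Real.pi * dotP ξ x) : ℝ) * Complex.I) * f x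

/-- Inverse Fourier transform `ǧ(x) = ∫ g(ξ) e^{2πi ξ x} dξ`. -/
def ftInv {d : ℕ} (g : (Fin d → ℝ) → ℂ) (x : Fin d → ℝ) : ℂ :=
  ∫ ξ : Fin d → ℝ, Complex.exp (((2 * Real.pi * dotP ξ x) : ℝ) * Complex.I) * g ξ

/-- `f` is a Schwartz function. -/
def IsSchwartz {d : ℕ} (f : (Fin d → ℝ) → ℂ) : Prop :=
  ∃ Φ : SchwartzMap (Fin d → ℝ) ℂ, ∀ x, f x = Φ x

/-- Convolution `(f * g)(x) = ∫ f(y) g(x - y) dy`. -/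
def conv {d : ℕ} (f g : (Fin d → ℝ) → ℂ) (x : Fin d → ℝ) : ℂ :=
  ∫ y : Fin d → ℝ, f y * g (x - y)

/-- The periodization `Pg(x) = |det b| Σ_{k ∈ ℤ^d} g(x - bk)` of a real-valued function. -/
def periodization {d : ℕ} (b : Matrix (Fin d) (Fin d) ℝ) (g : (Fin d → ℝ) → ℝ)
    (x : Fin d → ℝ) : ℝ :=
  |b.det| * ∑' k : Fin d → ℤ, g (x - b *ᵥ intVec k)

/-- The square of the Euclidean norm. -/
def sqNorm {d : ℕ} (x : Fin d → ℝ) : ℝ := ∑ i, x i ^ 2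

/-- The Euclidean norm `√(ε² + |x|²)` of the point `(ε, x)` of the upper half-space. -/
def depth {d : ℕ} (ε : ℝ) (x : Fin d → ℝ) : ℝ := √(ε ^ 2 + sqNorm x)

/-- The (unnormalized) Poisson kernel. -/
def poissonK {d : ℕ} (ε : ℝ) (x : Fin d → ℝ) : ℝ := ε / depth ε x ^ (d + 1)

/-- The (unnormalized) `i`-th conjugate Poisson kernel. -/
def conjK {d : ℕ} (i : Fin d) (ε : ℝ) (x : Fin d → ℝ) : ℝ := x i / depth ε x ^ (d + 1)

/-- The total mass of the unnormalized Poisson kernel. -/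
def poissonMass (d : ℕ) : ℝ := ∫ y : Fin d → ℝ, poissonK 1 y

section Kernels

variable {d : ℕ}

lemma sqNorm_nonneg (x : Fin d → ℝ) : 0 ≤ sqNorm x := Finset.sum_nonneg fun _ _ => sq_nonneg _

lemma sqNorm_neg (x : Fin d → ℝ) : sqNorm (-x) = sqNorm x := by simp [sqNorm]

lemma sqNorm_smul (r : ℝ) (x : Fin d → ℝ) : sqNorm (r • x) = r ^ 2 * sqNorm x := by
  simp [sqNorm, mul_pow, Finset.mul_sum]

lemma continuous_sqNorm : Continuous (sqNorm : (Fin d → ℝ) → ℝ) := by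
  unfold sqNorm; fun_prop

lemma abs_apply_le_norm (x : Fin d → ℝ) (i : Fin d) : |x i| ≤ ‖x‖ := norm_le_pi_norm x i

lemma norm_sq_le_sqNorm (x : Fin d → ℝ) : ‖x‖ ^ 2 ≤ sqNorm x := by
  rcases isEmpty_or_nonempty (Fin d) with h | h
  · simp [sqNorm, Subsingleton.elim x 0]
  · obtain ⟨i, hi⟩ := Finite.exists_max (fun i => ‖x i‖)
    have : ‖x‖ ≤ ‖x i‖ := (pi_norm_le_iff_of_nonneg (norm_nonneg _)).2 hi
    calc ‖x‖ ^ 2 ≤ ‖x i‖ ^ 2 := by gcongr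
      _ = x i ^ 2 := by simp
      _ ≤ sqNorm x := Finset.single_le_sum (f := fun i => x i ^ 2) (fun _ _ => sq_nonneg _)
          (Finset.mem_univ i)

lemma sqNorm_le (x : Fin d → ℝ) : sqNorm x ≤ d * ‖x‖ ^ 2 := by
  calc sqNorm x ≤ ∑ _i : Fin d, ‖x‖ ^ 2 := Finset.sum_le_sum fun i _ => by
        rw [← sq_abs]; gcongr; exact abs_apply_le_norm x i
    _ = d * ‖x‖ ^ 2 := by simp

lemma depth_sq (ε : ℝ) (x : Fin d → ℝ) : depth ε x ^ 2 = ε ^ 2 + sqNorm x :=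
  Real.sq_sqrt (by have := sqNorm_nonneg x; positivity)

lemma le_depth (ε : ℝ) (x : Fin d → ℝ) : ε ≤ depth ε x :=
  Real.le_sqrt_of_sq_le (by have := sqNorm_nonneg x; linarith)

lemma norm_le_depth (ε : ℝ) (x : Fin d → ℝ) : ‖x‖ ≤ depth ε x :=
  Real.le_sqrt_of_sq_le (by have := norm_sq_le_sqNorm x; nlinarith [sq_nonneg ε])

lemma depth_pos {ε : ℝ} (hε : 0 < ε) (x : Fin d → ℝ) : 0 < depth ε x := hε.trans_le (le_depth ε x)

lemma depth_neg (ε : ℝ) (x : Fin d → ℝ) : depth ε (-x) = depth ε x := by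
  simp [depth, sqNorm_neg]

lemma depth_smul {r : ℝ} (ε : ℝ) (x : Fin d → ℝ) :
    depth (|r| * ε) (r • x) = |r| * depth ε x := by
  rw [depth, depth, sqNorm_smul, mul_pow, sq_abs, ← mul_add, Real.sqrt_mul (sq_nonneg r),
    Real.sqrt_sq_eq_abs]

@[fun_prop]
lemma continuous_depth (ε : ℝ) : Continuous (depth ε : (Fin d → ℝ) → ℝ) := by
  unfold depth; have := continuous_sqNorm (d := d); fun_prop

@[fun_prop]
lemma continuous_poissonK {ε : ℝ} (hε : 0 < ε) : Continuous (poissonK ε : (Fin d → ℝ) → ℝ) :=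
  continuous_const.div (by fun_prop) fun x => (pow_pos (depth_pos hε x) _).ne'

@[fun_prop]
lemma continuous_conjK (i : Fin d) {ε : ℝ} (hε : 0 < ε) : Continuous (conjK i ε) :=
  (continuous_apply i).div (by fun_prop) fun x => (pow_pos (depth_pos hε x) _).ne'

lemma poissonK_pos {ε : ℝ} (hε : 0 < ε) (x : Fin d → ℝ) : 0 < poissonK ε x :=
  div_pos hε (pow_pos (depth_pos hε x) _)

lemma poissonK_nonneg {ε : ℝ} (hε : 0 < ε) (x : Fin d → ℝ) : 0 ≤ poissonK ε x :=
  (poissonK_pos hε x).le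

lemma poissonK_neg (ε : ℝ) (x : Fin d → ℝ) : poissonK ε (-x) = poissonK ε x := by
  simp [poissonK, depth_neg]

lemma conjK_neg (i : Fin d) (ε : ℝ) (x : Fin d → ℝ) : conjK i ε (-x) = -conjK i ε x := by
  simp [conjK, depth_neg, neg_div]

lemma poissonK_smul {r ε : ℝ} (hr : r ≠ 0) (x : Fin d → ℝ) :
    poissonK (|r| * ε) (r • x) = (|r| ^ d)⁻¹ * poissonK ε x := by
  have : |r| ≠ 0 := abs_ne_zero.2 hr
  rw [poissonK, poissonK, depth_smul, mul_pow, pow_succ |r| d]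
  field_simp

lemma conjK_smul {r ε : ℝ} (hr : r ≠ 0) (i : Fin d) (x : Fin d → ℝ) :
    conjK i (|r| * ε) (r • x) = r / |r| * (|r| ^ d)⁻¹ * conjK i ε x := by
  have : |r| ≠ 0 := abs_ne_zero.2 hr
  rw [conjK, conjK, depth_smul, mul_pow, pow_succ |r| d, Pi.smul_apply, smul_eq_mul]
  field_simp

lemma poissonK_le {ε : ℝ} (hε : 0 < ε) (x : Fin d → ℝ) : poissonK ε x ≤ (ε ^ d)⁻¹ := by
  rw [poissonK, div_le_iff₀ (pow_pos (depth_pos hε x) _)]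
  have := pow_le_pow_left₀ hε.le (le_depth ε x) (d + 1)
  calc ε = (ε ^ d)⁻¹ * ε ^ (d + 1) := by rw [pow_succ]; field_simp
    _ ≤ _ := by gcongr

lemma abs_conjK_le {ε : ℝ} (hε : 0 < ε) (i : Fin d) (x : Fin d → ℝ) :
    |conjK i ε x| ≤ (ε ^ d)⁻¹ := by
  have hD := depth_pos hε x
  have h1 : |x i| ≤ depth ε x := (abs_apply_le_norm x i).trans (norm_le_depth ε x)
  rw [conjK, abs_div, abs_of_pos (pow_pos hD _), div_le_iff₀ (pow_pos hD _), pow_succ]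
  calc |x i| ≤ depth ε x := h1
    _ = (ε ^ d)⁻¹ * (ε ^ d * depth ε x) := by field_simp
    _ ≤ _ := by gcongr; exact le_depth ε x

lemma integrable_poissonK_one : Integrable (poissonK 1 : (Fin d → ℝ) → ℝ) := by
  have h := (integrable_one_add_norm (E := Fin d → ℝ) (μ := volume) (r := (d + 1 : ℕ))
    (by simp)).const_mul (2 ^ (d + 1))
  refine h.mono' (continuous_poissonK one_pos).aestronglyMeasurable (ae_of_all _ fun x => ?_)
  rw [Real.norm_of_nonneg (poissonK_nonneg one_pos x), poissonK, Real.rpow_neg (by positivity),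
    Real.rpow_natCast, ← div_eq_mul_inv,
    div_le_div_iff₀ (pow_pos (depth_pos one_pos x) _) (by positivity), one_mul, ← mul_pow]
  gcongr
  linarith [le_depth 1 x, norm_le_depth 1 x]

lemma poissonK_eq {ε : ℝ} (hε : 0 < ε) (x : Fin d → ℝ) :
    poissonK ε x = (ε ^ d)⁻¹ * poissonK 1 (ε⁻¹ • x) := by
  have := poissonK_smul (ε := 1) hε.ne' (ε⁻¹ • x)
  rwa [smul_smul, mul_inv_cancel₀ hε.ne', one_smul, abs_of_pos hε, mul_one] at this

lemma integrable_poissonK {ε : ℝ} (hε : 0 < ε) :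
    Integrable (poissonK ε : (Fin d → ℝ) → ℝ) := by
  rw [funext (poissonK_eq hε)]
  exact ((integrable_comp_smul_iff volume _ (inv_ne_zero hε.ne')).2
    integrable_poissonK_one).const_mul _

lemma integral_poissonK {ε : ℝ} (hε : 0 < ε) :
    ∫ x : Fin d → ℝ, poissonK ε x = poissonMass d := by
  rw [funext (poissonK_eq hε), integral_const_mul, Measure.integral_comp_smul]
  have : ε ^ d ≠ 0 := (pow_pos hε d).ne'
  simp [abs_of_pos (pow_pos hε d), poissonMass, this]

lemma poissonMass_pos : 0 < poissonMass d := by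
  rw [poissonMass, integral_pos_iff_support_of_nonneg (fun x => poissonK_nonneg one_pos x)
    integrable_poissonK_one]
  have : Function.support (poissonK 1 : (Fin d → ℝ) → ℝ) = univ :=
    eq_univ_of_forall fun x => (poissonK_pos one_pos x).ne'
  simp [this, NeZero.ne]

lemma abs_inv_pow_sub_inv_pow_le {a b : ℝ} (ha : 0 < a) (hb : 0 < b) (n : ℕ) :
    |(a ^ n)⁻¹ - (b ^ n)⁻¹| ≤ n * |a - b| * (min a b ^ (n + 1))⁻¹ := by
  wlog hab : a ≤ b generalizing a b
  · have := this hb ha (le_of_not_ge hab)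
    rwa [abs_sub_comm, abs_sub_comm a b, min_comm]
  rw [min_eq_left hab]
  have h1 : |(a ^ n)⁻¹ - (b ^ n)⁻¹| = (b ^ n - a ^ n) * (a ^ n)⁻¹ * (b ^ n)⁻¹ := by
    rw [abs_of_nonneg (sub_nonneg.2 (inv_anti₀ (by positivity) (by gcongr)))]
    field_simp
  have h2 : b ^ n - a ^ n ≤ n * (b - a) * b ^ n * a⁻¹ := by
    rcases n with _ | n
    · simp
    have h3 : b ^ (n + 1) - a ^ (n + 1) ≤ (n + 1 : ℕ) * (b - a) * b ^ n := by
      have := abs_pow_sub_pow_le b a (n + 1)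
      rw [abs_of_pos hb, abs_of_pos ha, max_eq_left hab, abs_of_nonneg (sub_nonneg.2 hab)] at this
      calc _ ≤ _ := (le_abs_self _).trans this
        _ = _ := by rw [Nat.add_sub_cancel]; ring
    refine h3.trans ?_
    rw [pow_succ b n, mul_assoc _ (b ^ n * b), mul_assoc (b ^ n)]
    have : 1 ≤ b * a⁻¹ := by rw [← div_eq_mul_inv, one_le_div ha]; exact hab
    have h4 : (0:ℝ) ≤ (n + 1 : ℕ) * (b - a) := mul_nonneg (by positivity) (by linarith)
    gcongr
    exact le_mul_of_one_le_right (by positivity) this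
  rw [h1, abs_sub_comm, abs_of_nonneg (sub_nonneg.2 hab)]
  calc (b ^ n - a ^ n) * (a ^ n)⁻¹ * (b ^ n)⁻¹
      ≤ (n * (b - a) * b ^ n * a⁻¹) * (a ^ n)⁻¹ * (b ^ n)⁻¹ := by gcongr
    _ = _ := by rw [pow_succ]; field_simp

lemma depth_zero_eq (x : Fin d → ℝ) : depth 0 x = eucNorm x := by
  simp [depth, eucNorm, sqNorm]

lemma abs_truncated_sub_conjK_le {ε : ℝ} (hε : 0 < ε) (i : Fin d) (y : Fin d → ℝ) :
    |{y : Fin d → ℝ | ε < eucNorm y}.indicator (fun y => y i / eucNorm y ^ (d + 1)) y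
      - conjK i ε y| ≤ (d + 1) * 2 ^ (d + 1) * poissonK ε y := by
  have hD := depth_pos hε y
  have hone : (1 : ℝ) ≤ (d + 1) * 2 ^ (d + 1) :=
    one_le_mul_of_one_le_of_one_le (by simp) (one_le_pow₀ (by norm_num))
  have hr2 : eucNorm y ^ 2 = sqNorm y := Real.sq_sqrt (sqNorm_nonneg y)
  have hr0 : 0 ≤ eucNorm y := Real.sqrt_nonneg _
  have hyi : |y i| ≤ eucNorm y := by
    rw [← depth_zero_eq]; exact (abs_apply_le_norm y i).trans (norm_le_depth 0 y)
  have hD2 := depth_sq ε y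
  by_cases h : ε < eucNorm y
  · have hr : 0 < eucNorm y := hε.trans h
    rw [indicator_of_mem (by exact h), conjK, div_eq_mul_inv, div_eq_mul_inv, ← mul_sub, abs_mul]
    have hle : eucNorm y ≤ depth ε y := Real.sqrt_le_sqrt (by
      have := sq_nonneg ε; simp only [sqNorm]; linarith)
    have hle2 : depth ε y ≤ 2 * eucNorm y :=
      abs_le_of_sq_le_sq' (by nlinarith) (by positivity) |>.2
    have hsub : |eucNorm y - depth ε y| ≤ ε := by
      rw [abs_sub_comm, abs_of_nonneg (by linarith)]
      nlinarith
    have h1 := abs_inv_pow_sub_inv_pow_le hr hD (d + 1)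
    rw [min_eq_left hle] at h1
    calc |y i| * |(eucNorm y ^ (d + 1))⁻¹ - (depth ε y ^ (d + 1))⁻¹|
        ≤ eucNorm y * ((d + 1 : ℕ) * ε * (eucNorm y ^ (d + 1 + 1))⁻¹) := by
          refine mul_le_mul hyi (h1.trans ?_) (abs_nonneg _) hr0
          gcongr
      _ = (d + 1) * ε * (eucNorm y ^ (d + 1))⁻¹ := by
          rw [pow_succ _ (d + 1)]; push_cast; field_simp
      _ ≤ (d + 1) * ε * ((depth ε y / 2) ^ (d + 1))⁻¹ := by
          gcongr; linarith
      _ = _ := by rw [poissonK, div_pow]; field_simp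
  · rw [indicator_of_notMem (by exact h), zero_sub, abs_neg, conjK, abs_div,
      abs_of_pos (pow_pos hD _)]
    calc |y i| / depth ε y ^ (d + 1) ≤ ε / depth ε y ^ (d + 1) := by
          gcongr; exact hyi.trans (not_lt.1 h)
      _ ≤ _ := le_mul_of_one_le_left (poissonK_nonneg hε y) hone

lemma abs_depth_sub_le {ε : ℝ} (hε : 0 < ε) (u v : Fin d → ℝ) :
    |depth ε u - depth ε v| ≤ d * ‖u - v‖ := by
  have hu := depth_pos hε u
  have hv := depth_pos hε v
  have h1 : |sqNorm u - sqNorm v| ≤ d * (‖u - v‖ * (depth ε u + depth ε v)) := by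
    rw [sqNorm, sqNorm, ← Finset.sum_sub_distrib]
    calc _ ≤ ∑ i, |u i ^ 2 - v i ^ 2| := Finset.abs_sum_le_sum_abs _ _
      _ ≤ ∑ _i : Fin d, ‖u - v‖ * (depth ε u + depth ε v) := by
        refine Finset.sum_le_sum fun i _ => ?_
        rw [sq_sub_sq, abs_mul, mul_comm]
        refine mul_le_mul (abs_apply_le_norm (u - v) i) ((abs_add_le _ _).trans ?_)
          (abs_nonneg _) (norm_nonneg _)
        exact add_le_add ((abs_apply_le_norm u i).trans (norm_le_depth ε u))
          ((abs_apply_le_norm v i).trans (norm_le_depth ε v))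
      _ = _ := by simp
  have h2 : sqNorm u - sqNorm v = (depth ε u - depth ε v) * (depth ε u + depth ε v) := by
    have := depth_sq ε u
    have := depth_sq ε v
    nlinarith
  rw [h2, abs_mul, abs_of_pos (add_pos hu hv), ← mul_assoc] at h1
  exact le_of_mul_le_mul_right h1 (add_pos hu hv)

lemma exists_abs_conjK_sub_le (d : ℕ) : ∃ C : ℝ, 0 < C ∧ ∀ (i : Fin d) (ε δ : ℝ)
    (u v : Fin d → ℝ), 0 < ε → 0 < δ → δ ≤ ‖u‖ → ‖u - v‖ ≤ δ / 2 →
    |conjK i ε u - conjK i ε v| ≤ C * poissonK δ u := by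
  set K : ℝ := 4 * d + 1 with hK
  refine ⟨(1 / 2 + (d + 1) * d * K ^ (d + 2)) * 2 ^ (d + 1), by positivity, ?_⟩
  intro i ε δ u v hε hδ hu huv
  have hDu := depth_pos hε u
  have hDv := depth_pos hε v
  have hu2 := depth_sq ε u
  have hv2 := depth_sq ε v
  have hK1 : 1 ≤ K := by simp [hK]
  have hvu : ‖u‖ / 2 ≤ ‖v‖ := by
    have := norm_sub_norm_le u v
    linarith
  have hvu' : ‖v‖ ≤ 2 * ‖u‖ := by
    have := norm_sub_norm_le v u
    rw [norm_sub_rev] at this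
    linarith
  have hDK : depth ε u ≤ K * depth ε v := by
    refine abs_le_of_sq_le_sq' ?_ (by positivity) |>.2
    have h1 := sqNorm_le u
    have h2 := norm_sq_le_sqNorm v
    have h3 : ‖u‖ ^ 2 ≤ 4 * ‖v‖ ^ 2 := by nlinarith [norm_nonneg u]
    have h4 : (d : ℝ) * ‖u‖ ^ 2 ≤ d * (4 * ‖v‖ ^ 2) := by gcongr
    have h5 : K ^ 2 ≥ K := by nlinarith
    rw [mul_pow, hu2]
    have h6 : (d : ℝ) * (4 * ‖v‖ ^ 2) ≤ 4 * d * sqNorm v := by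
      nlinarith [(Nat.cast_nonneg d : (0 : ℝ) ≤ d)]
    calc ε ^ 2 + sqNorm u ≤ K * (ε ^ 2 + sqNorm v) := by
          rw [hK]; nlinarith [sq_nonneg ε, sqNorm_nonneg v, (Nat.cast_nonneg d : (0 : ℝ) ≤ d),
            mul_nonneg (Nat.cast_nonneg d : (0 : ℝ) ≤ d) (sq_nonneg ε)]
      _ ≤ K ^ 2 * depth ε v ^ 2 := by rw [hv2]; have := sqNorm_nonneg v; gcongr
  have hmin : depth ε u / K ≤ min (depth ε u) (depth ε v) :=
    le_min (div_le_self hDu.le hK1) (by rwa [div_le_iff₀' (by positivity)])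
  have hsplit : conjK i ε u - conjK i ε v = (u i - v i) * (depth ε u ^ (d + 1))⁻¹
      + v i * ((depth ε u ^ (d + 1))⁻¹ - (depth ε v ^ (d + 1))⁻¹) := by
    rw [conjK, conjK, div_eq_mul_inv, div_eq_mul_inv]; ring
  have h1 : |(u i - v i) * (depth ε u ^ (d + 1))⁻¹| ≤ δ / 2 * (depth ε u ^ (d + 1))⁻¹ := by
    rw [abs_mul, abs_of_pos (a := (depth ε u ^ (d + 1))⁻¹) (by positivity)]
    gcongr
    exact (abs_apply_le_norm (u - v) i).trans huv
  have h2 : |v i * ((depth ε u ^ (d + 1))⁻¹ - (depth ε v ^ (d + 1))⁻¹)|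
      ≤ (d + 1) * d * K ^ (d + 2) * δ * (depth ε u ^ (d + 1))⁻¹ := by
    rw [abs_mul]
    calc _ ≤ (2 * depth ε u) * (((d + 1 : ℕ) : ℝ) * (d * (δ / 2)) *
          ((depth ε u / K) ^ (d + 1 + 1))⁻¹) := by
          refine mul_le_mul ?_ ((abs_inv_pow_sub_inv_pow_le hDu hDv (d + 1)).trans ?_)
            (abs_nonneg _) (by positivity)
          · have := norm_le_depth ε u
            linarith [abs_apply_le_norm v i]
          · gcongr
            exact (abs_depth_sub_le hε u v).trans (by gcongr)
      _ = _ := by rw [div_pow, pow_succ (depth ε u) (d + 1)]; push_cast; field_simp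
  have h3 : (depth ε u ^ (d + 1))⁻¹ ≤ 2 ^ (d + 1) * (depth δ u ^ (d + 1))⁻¹ := by
    have h4 : depth δ u ≤ 2 * depth ε u := by
      refine abs_le_of_sq_le_sq' ?_ (by positivity) |>.2
      have := norm_sq_le_sqNorm u
      rw [mul_pow, depth_sq, depth_sq]
      nlinarith [sq_nonneg ε]
    have h5 : depth δ u / 2 ≤ depth ε u := by linarith
    have h6 := depth_pos hδ u
    calc (depth ε u ^ (d + 1))⁻¹ ≤ ((depth δ u / 2) ^ (d + 1))⁻¹ := by gcongr
      _ = _ := by rw [div_pow]; field_simp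
  rw [hsplit]
  calc _ ≤ δ / 2 * (depth ε u ^ (d + 1))⁻¹
        + (d + 1) * d * K ^ (d + 2) * δ * (depth ε u ^ (d + 1))⁻¹ :=
        (abs_add_le _ _).trans (add_le_add h1 h2)
    _ = ((1 / 2 + (d + 1) * d * K ^ (d + 2)) * δ) * (depth ε u ^ (d + 1))⁻¹ := by ring
    _ ≤ ((1 / 2 + (d + 1) * d * K ^ (d + 2)) * δ) *
        (2 ^ (d + 1) * (depth δ u ^ (d + 1))⁻¹) := by gcongr
    _ = _ := by rw [poissonK]; ring

end Kernels

/-- Normalized mean oscillation of `f` about the value `f x` on the cube of radius `r`. -/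
def meanOsc {d : ℕ} (f : (Fin d → ℝ) → ℂ) (x : Fin d → ℝ) (r : ℝ) : ℝ≥0∞ :=
  (ENNReal.ofReal (r ^ d))⁻¹ * ∫⁻ y in Metric.closedBall 0 r, ‖f (x - y) - f x‖ₑ

/-- Points at which the mean oscillation of `f` vanishes in the limit. -/
def IsLebesguePoint {d : ℕ} (f : (Fin d → ℝ) → ℂ) (x : Fin d → ℝ) : Prop :=
  Tendsto (meanOsc f x) (𝓝[>] 0) (𝓝 0)

section LebesguePoints

variable {d : ℕ}

lemma setLIntegral_closedBall_sub (g : (Fin d → ℝ) → ℝ≥0∞) (x : Fin d → ℝ) (r : ℝ) :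
    ∫⁻ y in Metric.closedBall 0 r, g (x - y) = ∫⁻ y in Metric.closedBall x r, g y := by
  rw [← lintegral_indicator Metric.isClosed_closedBall.measurableSet,
    ← lintegral_indicator Metric.isClosed_closedBall.measurableSet,
    ← lintegral_sub_left_eq_self ((Metric.closedBall x r).indicator g) x]
  congr 1 with y
  by_cases h : ‖y‖ ≤ r
  · rw [indicator_of_mem (by simpa using h), indicator_of_mem (by simpa using h)]
  · rw [indicator_of_notMem (by simpa using h), indicator_of_notMem (by simpa using h)]

lemma volume_closedBall_eq (x : Fin d → ℝ) {r : ℝ} (hr : 0 ≤ r) :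
    volume (Metric.closedBall x r) = ENNReal.ofReal ((2 * r) ^ d) := by
  simpa using Real.volume_pi_closedBall x hr

lemma ae_isLebesguePoint {f : (Fin d → ℝ) → ℂ} (hf : Integrable f) :
    ∀ᵐ x, IsLebesguePoint f x := by
  filter_upwards [IsUnifLocDoublingMeasure.ae_tendsto_average_norm_sub volume
    hf.locallyIntegrable 1] with x hx
  have h := hx (l := 𝓝[>] (0 : ℝ)) (fun _ => x) id tendsto_id
    (by filter_upwards [self_mem_nhdsWithin] with r (hr : 0 < r); simp [hr.le])
  have h2 := ENNReal.Tendsto.const_mul (a := 2 ^ d) (ENNReal.tendsto_ofReal h) (by simp)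
  simp only [id, ENNReal.ofReal_zero, mul_zero] at h2
  refine h2.congr' ?_
  filter_upwards [self_mem_nhdsWithin] with r (hr : 0 < r)
  have hfint : IntegrableOn (fun y => f y - f x) (Metric.closedBall x r) :=
    hf.integrableOn.sub (by simp [integrableOn_const_iff, volume_closedBall_eq x hr.le])
  rw [meanOsc, setLIntegral_closedBall_sub (fun y => ‖f y - f x‖ₑ), setAverage_eq,
    measureReal_def, volume_closedBall_eq x hr.le, ENNReal.toReal_ofReal (by positivity),
    smul_eq_mul, ENNReal.ofReal_mul (by positivity),
    ofReal_integral_norm_eq_lintegral_enorm hfint, ← mul_assoc, mul_pow, mul_inv,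
    ENNReal.ofReal_mul (by positivity), ← mul_assoc, ENNReal.ofReal_inv_of_pos (by positivity),
    ENNReal.ofReal_pow (by norm_num), ENNReal.ofReal_ofNat, ENNReal.mul_inv_cancel (by simp)
    (by simp), one_mul, ENNReal.ofReal_inv_of_pos (by positivity)]

lemma exists_meanOsc_le {f : (Fin d → ℝ) → ℂ} (hf : Integrable f) {x : Fin d → ℝ}
    (hx : IsLebesguePoint f x) : ∃ K : ℝ≥0∞, K ≠ ⊤ ∧ ∀ r, 0 < r → meanOsc f x r ≤ K := by
  have h1 : ∀ᶠ r in 𝓝[>] (0 : ℝ), meanOsc f x r < 1 := hx.eventually (gt_mem_nhds one_pos)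
  obtain ⟨δ, hδ, hδ'⟩ := mem_nhdsGT_iff_exists_Ioo_subset.1 h1
  have hδ : 0 < δ := hδ
  have hfin : ∫⁻ y, ‖f (x - y)‖ₑ ≠ ⊤ := by
    rw [lintegral_sub_left_eq_self (fun y => ‖f y‖ₑ)]; exact hf.2.ne
  refine ⟨1 + ((ENNReal.ofReal (δ ^ d))⁻¹ * (∫⁻ y, ‖f (x - y)‖ₑ) + 2 ^ d * ‖f x‖ₑ), ?_, ?_⟩
  · have : (ENNReal.ofReal (δ ^ d))⁻¹ ≠ ⊤ := by simp [pow_pos hδ d]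
    finiteness
  intro r hr
  rcases lt_or_ge r δ with h | h
  · exact (hδ' ⟨hr, h⟩).le.trans le_self_add
  refine le_trans ?_ le_add_self
  rw [meanOsc]
  calc _ ≤ (ENNReal.ofReal (r ^ d))⁻¹ * ∫⁻ y in Metric.closedBall 0 r, (‖f (x - y)‖ₑ + ‖f x‖ₑ) := by
        gcongr; exact enorm_sub_le
    _ = (ENNReal.ofReal (r ^ d))⁻¹ * (∫⁻ y in Metric.closedBall 0 r, ‖f (x - y)‖ₑ)
        + (ENNReal.ofReal (r ^ d))⁻¹ * (‖f x‖ₑ * ENNReal.ofReal ((2 * r) ^ d)) := by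
        rw [lintegral_add_right _ (by fun_prop), setLIntegral_const, volume_closedBall_eq _ hr.le,
          mul_add]
    _ ≤ _ := by
        refine add_le_add ?_ ?_
        · gcongr
          exact Measure.restrict_le_self
        · rw [mul_pow, ENNReal.ofReal_mul (by positivity), mul_left_comm,
            mul_left_comm (ENNReal.ofReal _)⁻¹, ENNReal.inv_mul_cancel (by simp [pow_pos hr d])
            (by simp), mul_one, mul_comm, ENNReal.ofReal_pow (by norm_num), ENNReal.ofReal_ofNat]

lemma ofReal_poissonK_le {ε : ℝ} (hε : 0 < ε) (y : Fin d → ℝ) :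
    ENNReal.ofReal (poissonK ε y) ≤ ∑' n : ℕ, 2 ^ (d + 1) * 2⁻¹ ^ n *
      (ENNReal.ofReal ((2 ^ n * ε) ^ d))⁻¹ *
      (Metric.closedBall (0 : Fin d → ℝ) (2 ^ n * ε)).indicator 1 y := by
  classical
  have hex : ∃ n : ℕ, ‖y‖ ≤ 2 ^ n * ε := by
    obtain ⟨n, hn⟩ := pow_unbounded_of_one_lt (‖y‖ / ε) (one_lt_two (α := ℝ))
    exact ⟨n, by rw [div_lt_iff₀ hε] at hn; exact hn.le⟩
  set n := Nat.find hex with hn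
  have hle : ‖y‖ ≤ 2 ^ n * ε := Nat.find_spec hex
  refine le_trans ?_ (ENNReal.le_tsum n)
  rw [indicator_of_mem (by simpa using hle), Pi.one_apply, mul_one]
  have key : poissonK ε y ≤ 2 ^ (d + 1) * 2⁻¹ ^ n * ((2 ^ n * ε) ^ d)⁻¹ := by
    rcases Nat.eq_zero_or_pos n with h0 | hpos
    · rw [h0]
      simp only [pow_zero, one_mul, mul_one]
      exact (poissonK_le hε y).trans (le_mul_of_one_le_left (by positivity)
        (one_le_pow₀ (by norm_num)))
    · obtain ⟨m, hm⟩ := Nat.exists_eq_succ_of_ne_zero hpos.ne'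
      have hlt : 2 ^ m * ε < ‖y‖ := not_le.1 (Nat.find_min hex (m := m) (by omega))
      rw [poissonK, hm]
      calc ε / depth ε y ^ (d + 1) ≤ ε / (2 ^ m * ε) ^ (d + 1) := by
            gcongr; exact hlt.le.trans (norm_le_depth ε y)
        _ = _ := by
            simp only [Nat.succ_eq_add_one, mul_pow, pow_succ, inv_pow, ← pow_mul]
            field_simp
  calc ENNReal.ofReal (poissonK ε y) ≤ _ := ENNReal.ofReal_le_ofReal key
    _ = _ := by
      rw [ENNReal.ofReal_mul (by positivity), ENNReal.ofReal_mul (by positivity),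
        ENNReal.ofReal_inv_of_pos (by positivity), ENNReal.ofReal_pow (by norm_num),
        ENNReal.ofReal_pow (by norm_num), ENNReal.ofReal_inv_of_pos (by norm_num)]
      simp

lemma lintegral_osc_mul_poissonK_le {f : (Fin d → ℝ) → ℂ} (hf : Integrable f) (x : Fin d → ℝ)
    {ε : ℝ} (hε : 0 < ε) :
    ∫⁻ y, ‖f (x - y) - f x‖ₑ * ENNReal.ofReal (poissonK ε y) ≤
      ∑' n : ℕ, 2 ^ (d + 1) * 2⁻¹ ^ n * meanOsc f x (2 ^ n * ε) := by
  have hm : AEMeasurable fun y => ‖f (x - y) - f x‖ₑ :=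
    ((hf.comp_sub_left x).aestronglyMeasurable.sub aestronglyMeasurable_const).enorm
  calc _ ≤ ∫⁻ y, ∑' n : ℕ, (2 ^ (d + 1) * 2⁻¹ ^ n * (ENNReal.ofReal ((2 ^ n * ε) ^ d))⁻¹) *
        (Metric.closedBall (0 : Fin d → ℝ) (2 ^ n * ε)).indicator
          (fun y => ‖f (x - y) - f x‖ₑ) y := by
        refine lintegral_mono fun y => ?_
        refine (mul_le_mul_right (ofReal_poissonK_le hε y) _).trans_eq ?_
        rw [← ENNReal.tsum_mul_left]
        congr 1 with n
        by_cases h : y ∈ Metric.closedBall (0 : Fin d → ℝ) (2 ^ n * ε)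
        · simp only [indicator_of_mem h, Pi.one_apply, mul_one]; rw [mul_comm]
        · simp only [indicator_of_notMem h, mul_zero]
    _ = _ := by
        rw [lintegral_tsum fun n =>
          (hm.indicator Metric.isClosed_closedBall.measurableSet).const_mul _]
        congr 1 with n
        rw [lintegral_const_mul'' _ (hm.indicator Metric.isClosed_closedBall.measurableSet),
          lintegral_indicator Metric.isClosed_closedBall.measurableSet, meanOsc, mul_assoc]

lemma IsLebesguePoint.tendsto_lintegral_poissonK {f : (Fin d → ℝ) → ℂ} (hf : Integrable f)
    {x : Fin d → ℝ} (hx : IsLebesguePoint f x) :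
    Tendsto (fun ε => ∫⁻ y, ‖f (x - y) - f x‖ₑ * ENNReal.ofReal (poissonK ε y))
      (𝓝[>] 0) (𝓝 0) := by
  obtain ⟨K, hK, hKle⟩ := exists_meanOsc_le hf hx
  have h1 : Tendsto (fun ε : ℝ => ∑' n : ℕ, 2 ^ (d + 1) * 2⁻¹ ^ n * meanOsc f x (2 ^ n * ε))
      (𝓝[>] 0) (𝓝 (∑' _ : ℕ, 0)) := by
    simp only [← lintegral_count]
    refine tendsto_lintegral_filter_of_dominated_convergence
      (fun n => 2 ^ (d + 1) * 2⁻¹ ^ n * K) (Eventually.of_forall fun ε => measurable_of_countable _)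
      ?_ ?_ (ae_of_all _ fun n => ?_)
    · filter_upwards [self_mem_nhdsWithin] with ε (hε : 0 < ε)
      refine ae_of_all _ fun n => ?_
      gcongr
      exact hKle _ (by positivity)
    · rw [lintegral_count, ENNReal.tsum_mul_right, ENNReal.tsum_mul_left, ENNReal.tsum_geometric]
      simp only [ENNReal.one_sub_inv_two, inv_inv]
      finiteness
    · have h2 : Tendsto (fun ε : ℝ => 2 ^ n * ε) (𝓝[>] 0) (𝓝[>] 0) := by
        refine tendsto_nhdsWithin_iff.2 ⟨?_, ?_⟩
        · exact ((continuous_const_mul _).tendsto' _ _ (by simp)).mono_left nhdsWithin_le_nhds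
        · filter_upwards [self_mem_nhdsWithin] with ε (hε : 0 < ε)
          exact mul_pos (by positivity) hε
      have h3 : (2 : ℝ≥0∞) ^ (d + 1) * 2⁻¹ ^ n ≠ ⊤ := by finiteness
      simpa using ENNReal.Tendsto.const_mul (Filter.Tendsto.comp hx h2) (Or.inr h3)
  rw [tsum_zero] at h1
  refine tendsto_of_tendsto_of_tendsto_of_le_of_le' tendsto_const_nhds h1
    (Eventually.of_forall fun _ => zero_le) ?_
  filter_upwards [self_mem_nhdsWithin] with ε (hε : 0 < ε)
  exact lintegral_osc_mul_poissonK_le hf x hε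

lemma IsLebesguePoint.tendsto_integral {f : (Fin d → ℝ) → ℂ} (hf : Integrable f)
    {x : Fin d → ℝ} (hx : IsLebesguePoint f x) (k : ℝ → (Fin d → ℝ) → ℝ) {C : ℝ}
    (hk : ∀ ε > 0, ∀ y, |k ε y| ≤ C * poissonK ε y) :
    Tendsto (fun ε => ∫ y, (f (x - y) - f x) * (k ε y : ℂ)) (𝓝[>] 0) (𝓝 0) := by
  rw [tendsto_zero_iff_enorm_tendsto_zero]
  have h := ENNReal.Tendsto.const_mul (a := ENNReal.ofReal C) (hx.tendsto_lintegral_poissonK hf)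
    (by simp)
  rw [mul_zero] at h
  refine tendsto_of_tendsto_of_tendsto_of_le_of_le' tendsto_const_nhds h
    (Eventually.of_forall fun _ => zero_le) ?_
  filter_upwards [self_mem_nhdsWithin] with ε (hε : 0 < ε)
  refine (enorm_integral_le_lintegral_enorm _).trans ?_
  rw [← lintegral_const_mul' _ _ (by simp)]
  refine lintegral_mono fun y => ?_
  rw [enorm_mul, mul_left_comm, ← ENNReal.ofReal_mul' (poissonK_nonneg hε y)]
  gcongr
  rw [← ofReal_norm, Complex.norm_real]
  exact ENNReal.ofReal_le_ofReal (hk ε hε y)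

end LebesguePoints

/-- Convolution with the unnormalized Poisson kernel. -/
def pConv {d : ℕ} (f : (Fin d → ℝ) → ℂ) (ε : ℝ) (x : Fin d → ℝ) : ℂ :=
  ∫ y, f (x - y) * (poissonK ε y : ℂ)

/-- Convolution with the unnormalized `i`-th conjugate Poisson kernel. -/
def qConv {d : ℕ} (i : Fin d) (f : (Fin d → ℝ) → ℂ) (ε : ℝ) (x : Fin d → ℝ) : ℂ :=
  ∫ y, f (x - y) * (conjK i ε y : ℂ)

/-- The conjugate Poisson extension of `f` is the Poisson extension of `g`. -/
def IsPair {d : ℕ} (i : Fin d) (f g : (Fin d → ℝ) → ℂ) : Prop :=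
  ∀ ε > 0, ∀ x, qConv i f ε x = pConv g ε x

/-- The `i`-th truncated (unnormalized) Riesz kernel. -/
def truncK {d : ℕ} (i : Fin d) (ε : ℝ) : (Fin d → ℝ) → ℝ :=
  {y : Fin d → ℝ | ε < eucNorm y}.indicator fun y => y i / eucNorm y ^ (d + 1)

section Extensions

variable {d : ℕ}

lemma integrable_mul_bdd_ofReal {f : (Fin d → ℝ) → ℂ} (hf : Integrable f)
    {k : (Fin d → ℝ) → ℝ} (hk : AEStronglyMeasurable k) {C : ℝ} (hC : ∀ y, |k y| ≤ C) :
    Integrable fun y => f y * (k y : ℂ) :=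
  hf.mul_bdd (c := C) (Complex.continuous_ofReal.comp_aestronglyMeasurable hk)
    (ae_of_all _ fun y => by simpa using hC y)

lemma abs_poissonK_le {ε : ℝ} (hε : 0 < ε) (y : Fin d → ℝ) : |poissonK ε y| ≤ (ε ^ d)⁻¹ := by
  rw [abs_of_nonneg (poissonK_nonneg hε y)]; exact poissonK_le hε y

lemma integrable_mul_poissonK {f : (Fin d → ℝ) → ℂ} (hf : Integrable f) {ε : ℝ} (hε : 0 < ε) :
    Integrable fun y => f y * (poissonK ε y : ℂ) :=
  integrable_mul_bdd_ofReal hf (continuous_poissonK hε).aestronglyMeasurable (abs_poissonK_le hε)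

lemma integrable_mul_conjK {f : (Fin d → ℝ) → ℂ} (hf : Integrable f) (i : Fin d) {ε : ℝ}
    (hε : 0 < ε) : Integrable fun y => f y * (conjK i ε y : ℂ) :=
  integrable_mul_bdd_ofReal hf (continuous_conjK i hε).aestronglyMeasurable (abs_conjK_le hε i)

lemma continuous_eucNorm : Continuous (eucNorm : (Fin d → ℝ) → ℝ) := by
  unfold eucNorm; fun_prop

lemma eucNorm_neg (y : Fin d → ℝ) : eucNorm (-y) = eucNorm y := by simp [eucNorm]

lemma measurable_truncK (i : Fin d) (ε : ℝ) : Measurable (truncK i ε) := by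
  have h := (continuous_eucNorm (d := d)).measurable
  exact ((measurable_pi_apply i).div (h.pow_const _)).indicator
    (measurableSet_lt measurable_const h)

lemma truncK_neg (i : Fin d) (ε : ℝ) (y : Fin d → ℝ) : truncK i ε (-y) = -truncK i ε y := by
  simp only [truncK, indicator, mem_ofPred_eq, eucNorm_neg]
  split_ifs <;> simp [neg_div]

lemma abs_truncK_sub_conjK_le {ε : ℝ} (hε : 0 < ε) (i : Fin d) (y : Fin d → ℝ) :
    |truncK i ε y - conjK i ε y| ≤ (d + 1) * 2 ^ (d + 1) * poissonK ε y :=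
  abs_truncated_sub_conjK_le hε i y

lemma abs_truncK_le {ε : ℝ} (hε : 0 < ε) (i : Fin d) (y : Fin d → ℝ) :
    |truncK i ε y| ≤ ((d + 1) * 2 ^ (d + 1) + 1) * (ε ^ d)⁻¹ := by
  calc |truncK i ε y| = |(truncK i ε y - conjK i ε y) + conjK i ε y| := by ring_nf
    _ ≤ |truncK i ε y - conjK i ε y| + |conjK i ε y| := abs_add_le _ _
    _ ≤ (d + 1) * 2 ^ (d + 1) * poissonK ε y + (ε ^ d)⁻¹ :=
        add_le_add (abs_truncK_sub_conjK_le hε i y) (abs_conjK_le hε i y)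
    _ ≤ (d + 1) * 2 ^ (d + 1) * (ε ^ d)⁻¹ + (ε ^ d)⁻¹ := by gcongr; exact poissonK_le hε y
    _ = _ := by ring

lemma integral_eq_zero_of_odd {k : (Fin d → ℝ) → ℝ} (hk : ∀ y, k (-y) = -k y) :
    ∫ y, (k y : ℂ) = 0 := by
  have h := integral_neg_eq_self (fun y => (k y : ℂ)) (volume : Measure (Fin d → ℝ))
  simp only [hk, Complex.ofReal_neg, integral_neg] at h
  exact self_eq_neg.1 h.symm

lemma truncRiesz_apply {f : (Fin d → ℝ) → ℂ} (hf : Integrable f) (x : Fin d → ℝ) {ε : ℝ}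
    (hε : 0 < ε) (i : Fin d) :
    truncRiesz f x ε i = rieszConst d * ∫ y, f (x - y) * (truncK i ε y : ℂ) := by
  have hm : MeasurableSet {y : Fin d → ℝ | ε < eucNorm y} :=
    measurableSet_lt measurable_const continuous_eucNorm.measurable
  have key (j : Fin d) : {y : Fin d → ℝ | ε < eucNorm y}.indicator
      (fun y => f (x - y) * ((rieszKernel d y j : ℝ) : ℂ))
      = fun y => (rieszConst d : ℂ) * (f (x - y) * (truncK j ε y : ℂ)) := by
    ext y
    by_cases hy : ε < eucNorm y
    · have hy0 : y ≠ 0 := by rintro rfl; simp [eucNorm] at hy; linarith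
      rw [indicator_of_mem (by exact hy), truncK, indicator_of_mem (by exact hy), rieszKernel,
        if_neg hy0, mul_div_assoc]
      push_cast; ring
    · rw [indicator_of_notMem (by exact hy), truncK, indicator_of_notMem (by exact hy)]; simp
  rw [truncRiesz, eval_integral, ← integral_indicator hm, key i, integral_const_mul]
  intro j
  rw [← IntegrableOn, ← integrable_indicator_iff hm, key j]
  exact (integrable_mul_bdd_ofReal (hf.comp_sub_left x) (measurable_truncK j ε).aestronglyMeasurable
    (abs_truncK_le hε j)).const_mul _

lemma IsLebesguePoint.tendsto_pConv {f : (Fin d → ℝ) → ℂ} (hf : Integrable f)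
    {x : Fin d → ℝ} (hx : IsLebesguePoint f x) :
    Tendsto (fun ε => pConv f ε x) (𝓝[>] 0) (𝓝 (poissonMass d * f x)) := by
  have h := hx.tendsto_integral hf poissonK (C := 1) fun ε hε y => by
    rw [one_mul, abs_of_nonneg (poissonK_nonneg hε y)]
  have h2 := h.add_const ((poissonMass d : ℂ) * f x)
  rw [zero_add] at h2
  refine h2.congr' ?_
  filter_upwards [self_mem_nhdsWithin] with ε (hε : 0 < ε)
  simp only [sub_mul]
  have e1 := integrable_mul_poissonK (hf.comp_sub_left x) hε
  have e2 : Integrable fun y : Fin d → ℝ => f x * (poissonK ε y : ℂ) :=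
    (integrable_poissonK hε).ofReal.const_mul _
  rw [integral_sub e1 e2, integral_const_mul, integral_complex_ofReal, integral_poissonK hε,
    pConv]
  ring

lemma IsLebesguePoint.tendsto_truncRiesz_sub {f : (Fin d → ℝ) → ℂ} (hf : Integrable f)
    {x : Fin d → ℝ} (hx : IsLebesguePoint f x) (i : Fin d) :
    Tendsto (fun ε => truncRiesz f x ε i - rieszConst d * qConv i f ε x) (𝓝[>] 0) (𝓝 0) := by
  have h := hx.tendsto_integral hf (fun ε y => truncK i ε y - conjK i ε y)
    fun ε hε y => abs_truncK_sub_conjK_le hε i y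
  have h2 := h.const_mul (rieszConst d : ℂ)
  rw [mul_zero] at h2
  refine h2.congr' ?_
  filter_upwards [self_mem_nhdsWithin] with ε (hε : 0 < ε)
  have hfint : Integrable fun y : Fin d → ℝ => truncK i ε y - conjK i ε y :=
    ((integrable_poissonK hε).const_mul _).mono'
      ((measurable_truncK i ε).aestronglyMeasurable.sub
        (continuous_conjK i hε).aestronglyMeasurable)
      (ae_of_all _ fun y => abs_truncK_sub_conjK_le hε i y)
  have hfx := hf.comp_sub_left x
  have e1 := integrable_mul_bdd_ofReal hfx (measurable_truncK i ε).aestronglyMeasurable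
    (abs_truncK_le hε i)
  have e2 := integrable_mul_conjK hfx i hε
  have hodd : ∫ y, ((truncK i ε y - conjK i ε y : ℝ) : ℂ) = 0 :=
    integral_eq_zero_of_odd fun y => by rw [truncK_neg, conjK_neg]; ring
  rw [truncRiesz_apply hf x hε i, qConv, ← mul_sub, ← integral_sub e1 e2]
  simp only [sub_mul]
  rw [integral_sub _ (hfint.ofReal.const_mul _), integral_const_mul, hodd, mul_zero, sub_zero]
  · congr 2 with y; push_cast; ring
  · convert e1.sub e2 using 2 with y; simp only [Pi.sub_apply]; push_cast; ring

lemma hasRiesz_iff {f : (Fin d → ℝ) → ℂ} (hf : Integrable f) (g : (Fin d → ℝ) → Fin d → ℂ) :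
    HasRiesz f g ↔ ∀ i, ∀ᵐ x, Tendsto (fun ε => rieszConst d * qConv i f ε x)
      (𝓝[>] 0) (𝓝 (g x i)) := by
  rw [HasRiesz, ← ae_all_iff]
  refine eventually_congr ?_
  filter_upwards [ae_isLebesguePoint hf] with x hx
  rw [tendsto_pi_nhds]
  refine forall_congr' fun i => ?_
  have h := hx.tendsto_truncRiesz_sub hf i
  constructor
  · intro h1; simpa using h1.sub h
  · intro h1; simpa using h1.add h

lemma IsPair.hasRiesz {f : (Fin d → ℝ) → ℂ} {g : Fin d → (Fin d → ℝ) → ℂ} (hf : Integrable f)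
    (hg : ∀ i, Integrable (g i)) (h : ∀ i, IsPair i f (g i)) :
    HasRiesz f fun x i => (rieszConst d * poissonMass d : ℝ) * g i x := by
  rw [hasRiesz_iff hf]
  intro i
  filter_upwards [ae_isLebesguePoint (hg i)] with x hx
  have h1 := (hx.tendsto_pConv (hg i)).const_mul (rieszConst d : ℂ)
  push_cast
  rw [mul_assoc]
  refine h1.congr' ?_
  filter_upwards [self_mem_nhdsWithin] with ε (hε : 0 < ε)
  rw [h i ε hε x]

lemma rieszConst_pos : 0 < rieszConst d :=
  div_pos (Real.Gamma_pos_of_pos (by positivity)) (Real.rpow_pos_of_pos Real.pi_pos _)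

end Extensions

/-- The plane wave `e^{2πi ξ·y}`. -/
def wave {d : ℕ} (ξ y : Fin d → ℝ) : ℂ := Complex.exp ((2 * Real.pi * dotP ξ y : ℝ) * Complex.I)

/-- The subordination integral `∫₀^∞ t^r e^{-tε² - σ/t} dt`. -/
def subord (r ε σ : ℝ) : ℝ := ∫ t in Ioi (0 : ℝ), t ^ r * Real.exp (-(t * ε ^ 2 + σ / t))

/-- The Fourier multiplier of the Poisson kernel. -/
def poissonSym {d : ℕ} (ε : ℝ) (ξ : Fin d → ℝ) : ℝ :=
  ε * (Real.Gamma ((d + 1) / 2))⁻¹ * Real.pi ^ ((d : ℝ) / 2) *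
    subord (-1 / 2) ε (Real.pi ^ 2 * sqNorm ξ)

/-- The Fourier multiplier of the `i`-th conjugate Poisson kernel, up to the factor `-i`. -/
def conjSym {d : ℕ} (i : Fin d) (ε : ℝ) (ξ : Fin d → ℝ) : ℝ :=
  ξ i * (Real.Gamma ((d + 1) / 2))⁻¹ * Real.pi ^ ((d : ℝ) / 2 + 1) *
    subord (-3 / 2) ε (Real.pi ^ 2 * sqNorm ξ)

section Gaussian

variable {d : ℕ}

lemma norm_wave (ξ y : Fin d → ℝ) : ‖wave ξ y‖ = 1 := Complex.norm_exp_ofReal_mul_I _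

@[fun_prop]
lemma continuous_wave {X : Type*} [TopologicalSpace X] {f g : X → Fin d → ℝ} (hf : Continuous f)
    (hg : Continuous g) : Continuous fun x => wave (f x) (g x) := by
  unfold wave dotP; fun_prop

lemma wave_comm (ξ y : Fin d → ℝ) : wave ξ y = wave y ξ := by
  simp only [wave, dotP, mul_comm]

lemma wave_add (ξ x y : Fin d → ℝ) : wave ξ (x + y) = wave ξ x * wave ξ y := by
  simp only [wave, dotP, ← Complex.exp_add, Pi.add_apply, mul_add, Finset.sum_add_distrib]
  push_cast; ring_nf

lemma wave_neg (ξ x : Fin d → ℝ) : wave ξ (-x) = (wave ξ x)⁻¹ := by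
  simp [wave, dotP, ← Complex.exp_neg]

lemma wave_zero (ξ : Fin d → ℝ) : wave ξ 0 = 1 := by simp [wave, dotP]

lemma integral_gaussian_wave {a : ℝ} (ha : 0 < a) (y : Fin d → ℝ) :
    ∫ ξ : Fin d → ℝ, (Real.exp (-(a * sqNorm ξ)) : ℂ) * wave ξ y =
      ((Real.pi / a) ^ ((d : ℝ) / 2) * Real.exp (-(Real.pi ^ 2 * sqNorm y / a)) : ℝ) := by
  have h := GaussianFourier.integral_cexp_neg_mul_sum_add (b := (a : ℂ)) (ι := Fin d)
    (by simpa using ha) (fun i => 2 * Real.pi * Complex.I * y i)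
  simp only [mul_pow, Complex.I_sq, Fintype.card_fin] at h
  convert h using 1
  · congr 1 with ξ
    simp only [wave, dotP, sqNorm]
    push_cast
    rw [← Complex.exp_add, Finset.mul_sum (s := Finset.univ) (a := (2 * Real.pi : ℂ)),
      Finset.sum_mul]
    congr 2
    · ring
    · exact Finset.sum_congr rfl fun i _ => by ring
  · rw [Complex.ofReal_mul, Complex.ofReal_cpow (by positivity)]
    push_cast
    congr 2
    rw [sqNorm]
    push_cast
    rw [← Finset.mul_sum]
    have : (a : ℂ) ≠ 0 := by exact_mod_cast ha.ne'
    field_simp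
    ring

lemma integrable_gaussian {a : ℝ} (ha : 0 < a) :
    Integrable fun ξ : Fin d → ℝ => Real.exp (-(a * sqNorm ξ)) := by
  have h := (GaussianFourier.integrable_cexp_neg_mul_sum_add (b := (a : ℂ)) (ι := Fin d)
    (by simpa using ha) 0).re
  convert h using 2 with ξ
  simp only [Pi.zero_apply, zero_mul, Finset.sum_const_zero, add_zero, RCLike.re_eq_complex_re]
  rw [show -(a : ℂ) * ∑ i, (ξ i : ℂ) ^ 2 = ((-(a * sqNorm ξ) : ℝ) : ℂ) by
    simp [sqNorm], ← Complex.ofReal_exp, Complex.ofReal_re]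

lemma integral_gaussian_sqNorm {a : ℝ} (ha : 0 < a) :
    ∫ ξ : Fin d → ℝ, Real.exp (-(a * sqNorm ξ)) = (Real.pi / a) ^ ((d : ℝ) / 2) := by
  have h := integral_gaussian_wave ha (0 : Fin d → ℝ)
  simp only [wave_zero, mul_one] at h
  rw [integral_complex_ofReal] at h
  have h2 := Complex.ofReal_injective h
  simpa [sqNorm] using h2

lemma integral_mul_gaussian_one {a : ℝ} (ha : 0 < a) (y : ℝ) :
    ∫ u : ℝ, (u : ℂ) * Complex.exp (-a * u ^ 2 + 2 * Real.pi * Complex.I * y * u) =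
      (Real.pi * y / a : ℝ) * Complex.I *
        ∫ u : ℝ, Complex.exp (-a * u ^ 2 + 2 * Real.pi * Complex.I * y * u) := by
  set F : ℝ → ℂ := fun u => Complex.exp (-a * u ^ 2 + 2 * Real.pi * Complex.I * y * u) with hF
  have hfint : Integrable F := by
    simpa [hF] using integrable_cexp_quadratic (b := (a : ℂ)) (by simpa using ha)
      (2 * Real.pi * Complex.I * y) 0
  have hf₁int : Integrable fun u : ℝ => (u : ℂ) * F u := by
    refine (integrable_mul_exp_neg_mul_sq ha).norm.mono' (by fun_prop) (ae_of_all _ fun u => ?_)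
    rw [norm_mul, norm_mul, Complex.norm_real, hF]
    simp only [Complex.norm_exp]
    rw [Real.norm_of_nonneg (Real.exp_pos _).le]
    refine le_of_eq ?_
    congr 2
    simp [← Complex.ofReal_pow]
  have hderiv (u : ℝ) :
      HasDerivAt F (-2 * a * (u * F u) + 2 * Real.pi * Complex.I * y * F u) u := by
    have h1 : HasDerivAt (fun u : ℝ => (u : ℂ)) 1 u := Complex.ofRealCLM.hasDerivAt
    have h2 := ((h1.pow 2).const_mul (-a : ℂ)).add (h1.const_mul (2 * Real.pi * Complex.I * y))
    have h3 := h2.cexp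
    simp only [Pi.add_apply, Pi.pow_apply] at h3
    refine (h3.congr_of_eventuallyEq (f₁ := F) (.of_forall fun _ => rfl)).congr_deriv ?_
    simp [hF]; ring
  have h := integral_eq_zero_of_hasDerivAt_of_integrable hderiv
    ((hf₁int.const_mul _).add (hfint.const_mul _)) hfint
  rw [integral_add (hf₁int.const_mul _) (hfint.const_mul _), integral_const_mul,
    integral_const_mul] at h
  have ha' : (a : ℂ) ≠ 0 := by exact_mod_cast ha.ne'
  change ∫ u : ℝ, (u : ℂ) * F u = _ * ∫ u, F u
  push_cast
  field_simp
  linear_combination (-1 / 2) * h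

lemma integral_mul_gaussian_wave {a : ℝ} (ha : 0 < a) (i : Fin d) (y : Fin d → ℝ) :
    ∫ ξ : Fin d → ℝ, ((ξ i * Real.exp (-(a * sqNorm ξ)) : ℝ) : ℂ) * wave ξ y =
      ((Real.pi * y i / a : ℝ) * Complex.I) *
        ((Real.pi / a) ^ ((d : ℝ) / 2) * Real.exp (-(Real.pi ^ 2 * sqNorm y / a)) : ℝ) := by
  set F : Fin d → ℝ → ℂ := fun j u =>
    Complex.exp (-a * u ^ 2 + 2 * Real.pi * Complex.I * y j * u) with hF
  have hprod (ξ : Fin d → ℝ) :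
      (Real.exp (-(a * sqNorm ξ)) : ℂ) * wave ξ y = ∏ j, F j (ξ j) := by
    rw [hF, ← Complex.exp_sum, wave, Complex.ofReal_exp, ← Complex.exp_add, dotP, sqNorm]
    congr 1
    push_cast
    rw [Finset.mul_sum, Finset.mul_sum, Finset.sum_mul, ← Finset.sum_neg_distrib,
      ← Finset.sum_add_distrib]
    exact Finset.sum_congr rfl fun j _ => by ring
  have hprod2 (ξ : Fin d → ℝ) : ((ξ i * Real.exp (-(a * sqNorm ξ)) : ℝ) : ℂ) * wave ξ y =
      ∏ j, (if j = i then fun u : ℝ => (u : ℂ) * F j u else F j) (ξ j) := by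
    rw [Complex.ofReal_mul, mul_assoc, hprod, ← Finset.mul_prod_erase _ _ (Finset.mem_univ i),
      ← Finset.mul_prod_erase _ _ (Finset.mem_univ i), if_pos rfl, mul_assoc]
    congr 2
    exact Finset.prod_congr rfl fun j hj => by rw [if_neg (Finset.ne_of_mem_erase hj)]
  have key := integral_gaussian_wave ha y
  simp only [hprod] at key
  simp only [hprod2]
  rw [← key, integral_fintype_prod_volume_eq_prod, integral_fintype_prod_volume_eq_prod,
    ← Finset.mul_prod_erase _ _ (Finset.mem_univ i),
    ← Finset.mul_prod_erase _ (fun j => ∫ u, F j u) (Finset.mem_univ i), if_pos rfl,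
    integral_mul_gaussian_one ha, mul_assoc]
  congr 2
  exact Finset.prod_congr rfl fun j hj => by rw [if_neg (Finset.ne_of_mem_erase hj)]

lemma integrable_subord_prod {r a ε : ℝ} (hr : -1 < r + (d : ℝ) / 2) (ha : 0 < a) (hε : 0 < ε) :
    Integrable (fun p : ℝ × (Fin d → ℝ) =>
      p.1 ^ r * Real.exp (-(p.1 * ε ^ 2 + a * sqNorm p.2 / p.1)))
      ((volume.restrict (Ioi 0)).prod volume) := by
  have hs := (continuous_sqNorm (d := d)).measurable
  have hm : Measurable (fun p : ℝ × (Fin d → ℝ) =>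
      p.1 ^ r * Real.exp (-(p.1 * ε ^ 2 + a * sqNorm p.2 / p.1))) := by fun_prop
  have heq (t : ℝ) (ξ : Fin d → ℝ) : t ^ r * Real.exp (-(t * ε ^ 2 + a * sqNorm ξ / t)) =
      t ^ r * Real.exp (-(t * ε ^ 2)) * Real.exp (-(a / t * sqNorm ξ)) := by
    rw [mul_assoc, ← Real.exp_add]; ring_nf
  rw [integrable_prod_iff hm.aestronglyMeasurable]
  constructor
  · filter_upwards [ae_restrict_mem measurableSet_Ioi] with t (ht : 0 < t)
    simp only [heq]
    exact (integrable_gaussian (div_pos ha ht)).const_mul _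
  · have h1 : IntegrableOn (fun t : ℝ => (Real.pi / a) ^ ((d : ℝ) / 2) *
        (t ^ (r + (d : ℝ) / 2) * Real.exp (-(ε ^ 2) * t ^ (1 : ℝ)))) (Ioi 0) :=
      (integrableOn_rpow_mul_exp_neg_mul_rpow hr one_pos (pow_pos hε 2)).const_mul _
    refine h1.congr_fun (fun t ht => ?_) measurableSet_Ioi
    have ht : 0 < t := ht
    simp only [heq]
    have hn (ξ : Fin d → ℝ) : ‖t ^ r * Real.exp (-(t * ε ^ 2)) * Real.exp (-(a / t * sqNorm ξ))‖
        = t ^ r * Real.exp (-(t * ε ^ 2)) * Real.exp (-(a / t * sqNorm ξ)) :=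
      Real.norm_of_nonneg (by positivity)
    simp only [hn]
    rw [integral_const_mul, integral_gaussian_sqNorm (div_pos ha ht), Real.rpow_one,
      Real.rpow_add ht, div_div_eq_mul_div, mul_comm Real.pi t, mul_div_assoc,
      Real.mul_rpow ht.le (by positivity)]
    ring_nf

end Gaussian

section Symbols

variable {d : ℕ}

lemma integral_rpow_mul_exp_depth {ε : ℝ} (hε : 0 < ε) (y : Fin d → ℝ) :
    ∫ t in Ioi (0 : ℝ), t ^ (((d : ℝ) + 1) / 2 - 1) * Real.exp (-(t * ε ^ 2 + t * sqNorm y)) =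
      Real.Gamma ((d + 1) / 2) / depth ε y ^ (d + 1) := by
  have hD := depth_pos hε y
  have h := Real.integral_rpow_mul_exp_neg_mul_Ioi (a := ((d : ℝ) + 1) / 2) (r := depth ε y ^ 2)
    (by positivity) (by positivity)
  have h2 : (1 / depth ε y ^ 2) ^ (((d : ℝ) + 1) / 2) = (depth ε y ^ (d + 1))⁻¹ := by
    rw [one_div, Real.inv_rpow (by positivity), ← Real.rpow_natCast, ← Real.rpow_natCast,
      ← Real.rpow_mul hD.le]
    congr 2
    push_cast; ring
  rw [h2] at h
  rw [div_eq_inv_mul (Real.Gamma _)]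
  refine Eq.trans ?_ h
  refine setIntegral_congr_fun measurableSet_Ioi fun t _ => ?_
  simp only [depth_sq]; ring_nf

lemma integrable_mul_wave {μ : Measure ℝ} {g : ℝ × (Fin d → ℝ) → ℝ} (y : Fin d → ℝ)
    (hg : Integrable g (μ.prod volume)) :
    Integrable (fun p => (g p : ℂ) * wave p.2 y) (μ.prod volume) :=
  hg.ofReal.mul_bdd (c := 1) (by fun_prop) (ae_of_all _ fun p => (norm_wave _ _).le)

lemma pi_div_pi_sq_div {t : ℝ} (ht : 0 < t) : Real.pi / (Real.pi ^ 2 / t) = t / Real.pi := by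
  have := Real.pi_pos
  field_simp

lemma rpow_mul_div_pi_rpow {t r : ℝ} (ht : 0 < t) :
    t ^ r * (t / Real.pi) ^ ((d : ℝ) / 2) =
      (Real.pi ^ ((d : ℝ) / 2))⁻¹ * t ^ (r + (d : ℝ) / 2) := by
  rw [Real.div_rpow ht.le Real.pi_pos.le, Real.rpow_add ht]; ring

lemma integral_subord_wave {ε : ℝ} (hε : 0 < ε) (y : Fin d → ℝ) :
    ∫ ξ : Fin d → ℝ, (subord (-1 / 2) ε (Real.pi ^ 2 * sqNorm ξ) : ℂ) * wave ξ y =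
      ((Real.pi ^ ((d : ℝ) / 2))⁻¹ * (Real.Gamma ((d + 1) / 2) / depth ε y ^ (d + 1)) : ℝ) := by
  have hfint := integrable_mul_wave y (integrable_subord_prod (d := d) (r := -1 / 2)
    (a := Real.pi ^ 2) (by have : (0 : ℝ) ≤ d := by positivity
                           linarith) (by positivity) hε)
  have hswap := integral_integral_swap (f := fun (t : ℝ) (ξ : Fin d → ℝ) =>
    ((t ^ (-1 / 2 : ℝ) * Real.exp (-(t * ε ^ 2 + Real.pi ^ 2 * sqNorm ξ / t)) : ℝ) : ℂ) *
      wave ξ y) hfint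
  calc _ = ∫ ξ : Fin d → ℝ, ∫ t in Ioi (0 : ℝ),
        ((t ^ (-1 / 2 : ℝ) * Real.exp (-(t * ε ^ 2 + Real.pi ^ 2 * sqNorm ξ / t)) : ℝ) : ℂ) *
          wave ξ y := by
        congr 1 with ξ
        rw [integral_mul_const, integral_complex_ofReal, subord]
    _ = _ := hswap.symm
    _ = ∫ t in Ioi (0 : ℝ), (((Real.pi ^ ((d : ℝ) / 2))⁻¹ * (t ^ (((d : ℝ) + 1) / 2 - 1) *
          Real.exp (-(t * ε ^ 2 + t * sqNorm y))) : ℝ) : ℂ) := by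
        refine setIntegral_congr_fun measurableSet_Ioi fun t (ht : 0 < t) => ?_
        have h := integral_gaussian_wave (a := Real.pi ^ 2 / t) (by positivity) y
        rw [pi_div_pi_sq_div ht] at h
        have e1 (ξ : Fin d → ℝ) :
            ((t ^ (-1 / 2 : ℝ) * Real.exp (-(t * ε ^ 2 + Real.pi ^ 2 * sqNorm ξ / t)) : ℝ) : ℂ) *
            wave ξ y = ((t ^ (-1 / 2 : ℝ) * Real.exp (-(t * ε ^ 2)) : ℝ) : ℂ) *
              (Real.exp (-(Real.pi ^ 2 / t * sqNorm ξ)) * wave ξ y) := by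
          rw [neg_add, Real.exp_add]; push_cast; ring_nf
        simp only [e1]
        rw [integral_const_mul, h, ← Complex.ofReal_mul]
        congr 1
        have e2 := rpow_mul_div_pi_rpow (d := d) (r := -1 / 2) ht
        rw [show -1 / 2 + (d : ℝ) / 2 = ((d : ℝ) + 1) / 2 - 1 by ring] at e2
        rw [neg_add, Real.exp_add,
          show Real.pi ^ 2 * sqNorm y / (Real.pi ^ 2 / t) = t * sqNorm y by
            have := Real.pi_pos; field_simp]
        linear_combination Real.exp (-(t * ε ^ 2)) * Real.exp (-(t * sqNorm y)) * e2
    _ = _ := by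
        rw [integral_complex_ofReal, integral_const_mul, integral_rpow_mul_exp_depth hε]

lemma integrable_mul_subord_prod (i : Fin d) {ε : ℝ} (hε : 0 < ε) :
    Integrable (fun p : ℝ × (Fin d → ℝ) => p.2 i *
      (p.1 ^ (-3 / 2 : ℝ) * Real.exp (-(p.1 * ε ^ 2 + Real.pi ^ 2 * sqNorm p.2 / p.1))))
      ((volume.restrict (Ioi 0)).prod volume) := by
  have hd : (1 : ℝ) ≤ d := by exact_mod_cast i.pos
  have hs := (continuous_sqNorm (d := d)).measurable
  have hm : Measurable (fun p : ℝ × (Fin d → ℝ) => p.2 i *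
      (p.1 ^ (-3 / 2 : ℝ) * Real.exp (-(p.1 * ε ^ 2 + Real.pi ^ 2 * sqNorm p.2 / p.1)))) := by
    fun_prop
  refine (integrable_subord_prod (d := d) (r := -1) (a := Real.pi ^ 2 / 2) (by linarith)
    (by positivity) hε).mono' hm.aestronglyMeasurable ?_
  have : ∀ᵐ p ∂((volume.restrict (Ioi (0 : ℝ))).prod (volume : Measure (Fin d → ℝ))),
      0 < p.1 :=
    Measure.quasiMeasurePreserving_fst.ae (ae_restrict_mem measurableSet_Ioi)
  filter_upwards [this] with ⟨t, ξ⟩ ht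
  simp only at ht ⊢
  rw [norm_mul, Real.norm_of_nonneg (r := _ * _) (by positivity), Real.norm_eq_abs]
  have hpi := Real.pi_gt_three
  have hst : 0 < √t := Real.sqrt_pos.2 ht
  have hsq : √t ^ 2 = t := Real.sq_sqrt ht.le
  have hx : |ξ i| / √t ≤ Real.exp (Real.pi ^ 2 * sqNorm ξ / (2 * t)) := by
    have h1 : (|ξ i| / √t) ^ 2 ≤ sqNorm ξ / t := by
      rw [div_pow, hsq, sq_abs]
      gcongr
      exact Finset.single_le_sum (f := fun i => ξ i ^ 2) (fun _ _ => sq_nonneg _)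
        (Finset.mem_univ i)
    have h2 : sqNorm ξ / t ≤ Real.pi ^ 2 * sqNorm ξ / (2 * t) * 2 := by
      have := sqNorm_nonneg ξ
      rw [div_mul_eq_mul_div, div_le_div_iff₀ ht (by positivity)]
      nlinarith [mul_nonneg this ht.le, mul_nonneg (mul_nonneg this ht.le)
        (by nlinarith : (0 : ℝ) ≤ Real.pi ^ 2 - 1)]
    have h3 := Real.add_one_le_exp (Real.pi ^ 2 * sqNorm ξ / (2 * t))
    nlinarith [sq_nonneg (|ξ i| / √t - 1)]
  have ht32 : t ^ (-3 / 2 : ℝ) = t ^ (-1 : ℝ) / √t := by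
    rw [Real.sqrt_eq_rpow, ← Real.rpow_sub ht]; norm_num
  calc |ξ i| * (t ^ (-3 / 2 : ℝ) * Real.exp (-(t * ε ^ 2 + Real.pi ^ 2 * sqNorm ξ / t)))
      = |ξ i| / √t * (t ^ (-1 : ℝ) *
          Real.exp (-(t * ε ^ 2 + Real.pi ^ 2 * sqNorm ξ / t))) := by rw [ht32]; ring
    _ ≤ Real.exp (Real.pi ^ 2 * sqNorm ξ / (2 * t)) * (t ^ (-1 : ℝ) *
          Real.exp (-(t * ε ^ 2 + Real.pi ^ 2 * sqNorm ξ / t))) := by gcongr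
    _ = _ := by
        rw [mul_left_comm, ← Real.exp_add]
        congr 2
        field_simp
        ring

lemma integral_mul_subord_wave (i : Fin d) {ε : ℝ} (hε : 0 < ε) (y : Fin d → ℝ) :
    ∫ ξ : Fin d → ℝ, ((ξ i * subord (-3 / 2) ε (Real.pi ^ 2 * sqNorm ξ) : ℝ) : ℂ) * wave ξ y =
      Complex.I * ((y i * (Real.pi ^ ((d : ℝ) / 2 + 1))⁻¹ *
        (Real.Gamma ((d + 1) / 2) / depth ε y ^ (d + 1)) : ℝ) : ℂ) := by
  have hfint := integrable_mul_wave y (integrable_mul_subord_prod i hε)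
  have hswap := integral_integral_swap (f := fun (t : ℝ) (ξ : Fin d → ℝ) =>
    ((ξ i * (t ^ (-3 / 2 : ℝ) * Real.exp (-(t * ε ^ 2 + Real.pi ^ 2 * sqNorm ξ / t))) : ℝ) : ℂ) *
      wave ξ y) hfint
  calc _ = ∫ ξ : Fin d → ℝ, ∫ t in Ioi (0 : ℝ),
        ((ξ i * (t ^ (-3 / 2 : ℝ) * Real.exp (-(t * ε ^ 2 + Real.pi ^ 2 * sqNorm ξ / t))) : ℝ) : ℂ)
          * wave ξ y := by
        congr 1 with ξ
        rw [integral_mul_const, integral_complex_ofReal, integral_const_mul, subord]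
    _ = _ := hswap.symm
    _ = ∫ t in Ioi (0 : ℝ), Complex.I * ((y i * (Real.pi ^ ((d : ℝ) / 2 + 1))⁻¹ *
          (t ^ (((d : ℝ) + 1) / 2 - 1) * Real.exp (-(t * ε ^ 2 + t * sqNorm y))) : ℝ) : ℂ) := by
        refine setIntegral_congr_fun measurableSet_Ioi fun t (ht : 0 < t) => ?_
        have h := integral_mul_gaussian_wave (a := Real.pi ^ 2 / t) (by positivity) i y
        rw [pi_div_pi_sq_div ht] at h
        have e1 (ξ : Fin d → ℝ) : ((ξ i * (t ^ (-3 / 2 : ℝ) *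
            Real.exp (-(t * ε ^ 2 + Real.pi ^ 2 * sqNorm ξ / t))) : ℝ) : ℂ) *
            wave ξ y = ((t ^ (-3 / 2 : ℝ) * Real.exp (-(t * ε ^ 2)) : ℝ) : ℂ) *
              (((ξ i * Real.exp (-(Real.pi ^ 2 / t * sqNorm ξ)) : ℝ) : ℂ) * wave ξ y) := by
          rw [neg_add, Real.exp_add]; push_cast; ring_nf
        simp only [e1]
        rw [integral_const_mul, h, mul_comm _ Complex.I, mul_assoc Complex.I, ← Complex.ofReal_mul,
          mul_left_comm, ← Complex.ofReal_mul]
        congr 2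
        have e2 := rpow_mul_div_pi_rpow (d := d) (r := -1 / 2) ht
        have e3 : t ^ (-1 / 2 : ℝ) = t ^ (-3 / 2 : ℝ) * t := by
          rw [← Real.rpow_add_one ht.ne']; norm_num
        rw [show -1 / 2 + (d : ℝ) / 2 = ((d : ℝ) + 1) / 2 - 1 by ring, e3] at e2
        rw [neg_add, Real.exp_add, Real.rpow_add_one Real.pi_ne_zero, mul_inv,
          show Real.pi ^ 2 * sqNorm y / (Real.pi ^ 2 / t) = t * sqNorm y by
            have := Real.pi_pos; field_simp,
          show Real.pi * y i / (Real.pi ^ 2 / t) = Real.pi⁻¹ * y i * t by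
            have := Real.pi_pos; field_simp]
        linear_combination y i * Real.pi⁻¹ * Real.exp (-(t * ε ^ 2)) *
          Real.exp (-(t * sqNorm y)) * e2
    _ = _ := by
        rw [integral_const_mul, integral_complex_ofReal, integral_const_mul,
          integral_rpow_mul_exp_depth hε]

lemma Gamma_half_pos : 0 < Real.Gamma (((d : ℝ) + 1) / 2) := Real.Gamma_pos_of_pos (by positivity)

lemma integral_poissonSym_wave {ε : ℝ} (hε : 0 < ε) (y : Fin d → ℝ) :
    ∫ ξ, (poissonSym ε ξ : ℂ) * wave ξ y = poissonK ε y := by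
  have h := integral_subord_wave hε y
  have hΓ := (Gamma_half_pos (d := d)).ne'
  have hpi : Real.pi ^ ((d : ℝ) / 2) ≠ 0 := (Real.rpow_pos_of_pos Real.pi_pos _).ne'
  have e (ξ : Fin d → ℝ) : (poissonSym ε ξ : ℂ) * wave ξ y =
      (ε * (Real.Gamma ((d + 1) / 2))⁻¹ * Real.pi ^ ((d : ℝ) / 2) : ℝ) *
        ((subord (-1 / 2) ε (Real.pi ^ 2 * sqNorm ξ) : ℂ) * wave ξ y) := by
    rw [poissonSym, Complex.ofReal_mul, mul_assoc]
  simp only [e]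
  rw [integral_const_mul, h, ← Complex.ofReal_mul, poissonK]
  congr 1
  field_simp

lemma integral_conjSym_wave (i : Fin d) {ε : ℝ} (hε : 0 < ε) (y : Fin d → ℝ) :
    ∫ ξ, (-Complex.I * conjSym i ε ξ) * wave ξ y = conjK i ε y := by
  have h := integral_mul_subord_wave i hε y
  have hΓ := (Gamma_half_pos (d := d)).ne'
  have hpi : Real.pi ^ ((d : ℝ) / 2 + 1) ≠ 0 := (Real.rpow_pos_of_pos Real.pi_pos _).ne'
  have e (ξ : Fin d → ℝ) : (-Complex.I * conjSym i ε ξ) * wave ξ y =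
      (-Complex.I * ((Real.Gamma ((d + 1) / 2))⁻¹ * Real.pi ^ ((d : ℝ) / 2 + 1) : ℝ)) *
      (((ξ i * subord (-3 / 2) ε (Real.pi ^ 2 * sqNorm ξ) : ℝ) : ℂ) * wave ξ y) := by
    rw [conjSym]; push_cast; ring
  simp only [e]
  rw [integral_const_mul, h, mul_mul_mul_comm, ← Complex.ofReal_mul, neg_mul, Complex.I_mul_I,
    neg_neg, one_mul, conjK]
  congr 1
  field_simp

lemma integrable_poissonSym {ε : ℝ} (hε : 0 < ε) :
    Integrable (poissonSym ε : (Fin d → ℝ) → ℝ) :=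
  ((integrable_subord_prod (d := d) (r := -1 / 2) (a := Real.pi ^ 2)
    (by have : (0 : ℝ) ≤ d := by positivity
        linarith) (by positivity) hε).integral_prod_right).const_mul _

lemma subord_nonneg (r ε σ : ℝ) : 0 ≤ subord r ε σ :=
  setIntegral_nonneg measurableSet_Ioi fun t ht => by
    have ht : 0 < t := ht
    positivity

lemma poissonSym_nonneg {ε : ℝ} (hε : 0 < ε) (ξ : Fin d → ℝ) : 0 ≤ poissonSym ε ξ := by
  have := Gamma_half_pos (d := d)
  have := subord_nonneg (-1 / 2) ε (Real.pi ^ 2 * sqNorm ξ)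
  exact mul_nonneg (mul_nonneg (mul_nonneg hε.le (inv_nonneg.2 Gamma_half_pos.le))
    (by positivity)) this

lemma mul_subord_eq {ε s : ℝ} (hε : 0 < ε) (hs : 0 < s) :
    s * subord (-3 / 2) ε (s ^ 2) = ε * subord (-1 / 2) ε (s ^ 2) := by
  set g : ℝ → ℝ := fun t => t ^ (-3 / 2 : ℝ) * Real.exp (-(t * ε ^ 2 + s ^ 2 / t)) with hg
  set β := s ^ 2 / ε ^ 2 with hβ
  have hβ0 : 0 < β := by positivity
  have h1 := integral_comp_mul_left_Ioi g 0 hβ0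
  have h2 := integral_comp_rpow_Ioi (fun x => g (β * x)) (p := -1) (by norm_num)
  rw [h1, mul_zero] at h2
  have h3 : subord (-3 / 2) ε (s ^ 2) = ∫ t in Ioi (0 : ℝ), g t := rfl
  have h4 (x : ℝ) (hx : 0 < x) : (|(-1 : ℝ)| * x ^ ((-1 : ℝ) - 1)) • g (β * x ^ (-1 : ℝ)) =
      β ^ (-3 / 2 : ℝ) * (x ^ (-1 / 2 : ℝ) * Real.exp (-(x * ε ^ 2 + s ^ 2 / x))) := by
    rw [hg]
    simp only [smul_eq_mul, abs_neg, abs_one, one_mul]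
    rw [Real.mul_rpow hβ0.le (by positivity), ← Real.rpow_mul hx.le, Real.rpow_neg_one,
      show β * x⁻¹ * ε ^ 2 + s ^ 2 / (β * x⁻¹) = x * ε ^ 2 + s ^ 2 / x by
        rw [hβ]; field_simp; ring,
      show x ^ (-1 / 2 : ℝ) = x ^ (-1 - 1 : ℝ) * x ^ (-1 * (-3 / 2) : ℝ) by
        rw [← Real.rpow_add hx]; norm_num]
    ring
  rw [setIntegral_congr_fun measurableSet_Ioi h4, integral_const_mul, smul_eq_mul] at h2
  have h5 : β ^ (-3 / 2 : ℝ) * β * s = ε := by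
    rw [← Real.rpow_add_one hβ0.ne', hβ, ← div_pow, ← Real.rpow_natCast, ← Real.rpow_mul
      (by positivity)]
    norm_num
    rw [Real.rpow_neg_one]
    field_simp
  have h6 : β * β⁻¹ = 1 := mul_inv_cancel₀ hβ0.ne'
  rw [h3]
  rw [subord]
  linear_combination -(s * β) * h2 - s * (∫ t in Ioi (0 : ℝ), g t) * h6 +
    (∫ t in Ioi (0 : ℝ), t ^ (-1 / 2 : ℝ) * Real.exp (-(t * ε ^ 2 + s ^ 2 / t))) * h5

lemma sqNorm_eq (ξ : Fin d → ℝ) : sqNorm ξ = eucNorm ξ ^ 2 := (Real.sq_sqrt (sqNorm_nonneg ξ)).symm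

lemma eucNorm_nonneg (ξ : Fin d → ℝ) : 0 ≤ eucNorm ξ := Real.sqrt_nonneg _

lemma abs_apply_le_eucNorm (ξ : Fin d → ℝ) (i : Fin d) : |ξ i| ≤ eucNorm ξ :=
  Real.abs_le_sqrt (Finset.single_le_sum (f := fun i => ξ i ^ 2) (fun _ _ => sq_nonneg _)
    (Finset.mem_univ i))

lemma conjSym_eq (i : Fin d) {ε : ℝ} (hε : 0 < ε) (ξ : Fin d → ℝ) :
    conjSym i ε ξ = ξ i / eucNorm ξ * poissonSym ε ξ := by
  rcases (eucNorm_nonneg ξ).eq_or_lt with h | h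
  · have hi := abs_apply_le_eucNorm ξ i
    rw [← h, abs_nonpos_iff] at hi
    simp [conjSym, hi]
  have h1 := mul_subord_eq hε (mul_pos Real.pi_pos h)
  rw [mul_pow, ← sqNorm_eq] at h1
  rw [conjSym, poissonSym, Real.rpow_add_one Real.pi_ne_zero]
  generalize subord (-3 / 2) ε (Real.pi ^ 2 * sqNorm ξ) = A at h1 ⊢
  generalize subord (-1 / 2) ε (Real.pi ^ 2 * sqNorm ξ) = B at h1 ⊢
  have := (Gamma_half_pos (d := d)).ne'
  field_simp
  linear_combination ξ i * h1

lemma abs_div_eucNorm_le (ξ : Fin d → ℝ) (i : Fin d) : |ξ i / eucNorm ξ| ≤ 1 := by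
  rw [abs_div, abs_of_nonneg (eucNorm_nonneg ξ)]
  exact div_le_one_of_le₀ (abs_apply_le_eucNorm ξ i) (eucNorm_nonneg ξ)

lemma abs_conjSym_le (i : Fin d) {ε : ℝ} (hε : 0 < ε) (ξ : Fin d → ℝ) :
    |conjSym i ε ξ| ≤ poissonSym ε ξ := by
  rw [conjSym_eq i hε, abs_mul, abs_of_nonneg (poissonSym_nonneg hε ξ)]
  exact mul_le_of_le_one_left (poissonSym_nonneg hε ξ) (abs_div_eucNorm_le ξ i)

lemma integrable_conjSym (i : Fin d) {ε : ℝ} (hε : 0 < ε) : Integrable (conjSym i ε) := by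
  have hm : AEStronglyMeasurable (conjSym i ε) := by
    have h1 : AEStronglyMeasurable fun ξ : Fin d → ℝ => ξ i / eucNorm ξ :=
      ((measurable_pi_apply i).div continuous_eucNorm.measurable).aestronglyMeasurable
    rw [funext (conjSym_eq i hε)]
    exact h1.mul (integrable_poissonSym hε).aestronglyMeasurable
  exact (integrable_poissonSym hε).mono' hm (ae_of_all _ (abs_conjSym_le i hε))

lemma rpow_mul_pi_div_rpow {t : ℝ} (ht : 0 < t) :
    t ^ (((d : ℝ) + 1) / 2 - 1) * (Real.pi / t) ^ ((d : ℝ) / 2) =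
      Real.pi ^ ((d : ℝ) / 2) * t ^ (-1 / 2 : ℝ) := by
  rw [Real.div_rpow Real.pi_pos.le ht.le, mul_div_left_comm, ← Real.rpow_sub ht]
  ring_nf

lemma integrable_depth_prod {ε : ℝ} (hε : 0 < ε) :
    Integrable (fun p : ℝ × (Fin d → ℝ) =>
      p.1 ^ (((d : ℝ) + 1) / 2 - 1) * Real.exp (-(p.1 * ε ^ 2 + p.1 * sqNorm p.2)))
      ((volume.restrict (Ioi 0)).prod volume) := by
  have hs := (continuous_sqNorm (d := d)).measurable
  have hm : Measurable (fun p : ℝ × (Fin d → ℝ) =>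
      p.1 ^ (((d : ℝ) + 1) / 2 - 1) * Real.exp (-(p.1 * ε ^ 2 + p.1 * sqNorm p.2))) := by fun_prop
  have heq (t : ℝ) (ξ : Fin d → ℝ) :
      t ^ (((d : ℝ) + 1) / 2 - 1) * Real.exp (-(t * ε ^ 2 + t * sqNorm ξ)) =
      t ^ (((d : ℝ) + 1) / 2 - 1) * Real.exp (-(t * ε ^ 2)) * Real.exp (-(t * sqNorm ξ)) := by
    rw [mul_assoc, ← Real.exp_add]; ring_nf
  rw [integrable_prod_iff hm.aestronglyMeasurable]
  constructor
  · filter_upwards [ae_restrict_mem measurableSet_Ioi] with t (ht : 0 < t)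
    simp only [heq]
    exact (integrable_gaussian ht).const_mul _
  · have h1 : IntegrableOn (fun t : ℝ => Real.pi ^ ((d : ℝ) / 2) *
        (t ^ (-1 / 2 : ℝ) * Real.exp (-(ε ^ 2) * t ^ (1 : ℝ)))) (Ioi 0) :=
      (integrableOn_rpow_mul_exp_neg_mul_rpow (by norm_num) one_pos (pow_pos hε 2)).const_mul _
    refine h1.congr_fun (fun t ht => ?_) measurableSet_Ioi
    have ht : 0 < t := ht
    simp only [heq]
    have hn (ξ : Fin d → ℝ) : ‖t ^ (((d : ℝ) + 1) / 2 - 1) * Real.exp (-(t * ε ^ 2)) *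
        Real.exp (-(t * sqNorm ξ))‖ = t ^ (((d : ℝ) + 1) / 2 - 1) * Real.exp (-(t * ε ^ 2)) *
        Real.exp (-(t * sqNorm ξ)) := Real.norm_of_nonneg (by positivity)
    simp only [hn]
    rw [integral_const_mul, integral_gaussian_sqNorm ht, Real.rpow_one, ← mul_assoc,
      ← rpow_mul_pi_div_rpow ht]
    ring_nf

/-- The multiplier is the Fourier transform of the Poisson kernel. -/
lemma integral_poissonK_wave {ε : ℝ} (hε : 0 < ε) (ξ : Fin d → ℝ) :
    ∫ y, (poissonK ε y : ℂ) * wave y ξ = poissonSym ε ξ := by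
  have hswap := integral_integral_swap (f := fun (t : ℝ) (y : Fin d → ℝ) =>
    ((t ^ (((d : ℝ) + 1) / 2 - 1) * Real.exp (-(t * ε ^ 2 + t * sqNorm y)) : ℝ) : ℂ) *
      wave y ξ) (integrable_mul_wave ξ (integrable_depth_prod hε))
  have hΓ := (Gamma_half_pos (d := d)).ne'
  have e (y : Fin d → ℝ) : (poissonK ε y : ℂ) * wave y ξ =
      (ε * (Real.Gamma ((d + 1) / 2))⁻¹ : ℝ) * ∫ t in Ioi (0 : ℝ),
        ((t ^ (((d : ℝ) + 1) / 2 - 1) * Real.exp (-(t * ε ^ 2 + t * sqNorm y)) : ℝ) : ℂ) *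
          wave y ξ := by
    rw [integral_mul_const, integral_complex_ofReal, integral_rpow_mul_exp_depth hε, ← mul_assoc,
      ← Complex.ofReal_mul, poissonK]
    congr 2
    field_simp
  simp only [e]
  rw [integral_const_mul, ← hswap, poissonSym, mul_assoc _ _ (subord _ _ _),
    Complex.ofReal_mul (ε * _), subord]
  congr 1
  rw [← integral_const_mul, ← integral_complex_ofReal]
  refine setIntegral_congr_fun measurableSet_Ioi fun t (ht : 0 < t) => ?_
  have h := integral_gaussian_wave ht ξ
  have e1 (y : Fin d → ℝ) :
      ((t ^ (((d : ℝ) + 1) / 2 - 1) * Real.exp (-(t * ε ^ 2 + t * sqNorm y)) : ℝ) : ℂ) *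
      wave y ξ = ((t ^ (((d : ℝ) + 1) / 2 - 1) * Real.exp (-(t * ε ^ 2)) : ℝ) : ℂ) *
        (Real.exp (-(t * sqNorm y)) * wave y ξ) := by
    rw [neg_add, Real.exp_add]; push_cast; ring_nf
  simp only [e1]
  rw [integral_const_mul, h, ← Complex.ofReal_mul]
  congr 1
  rw [neg_add, Real.exp_add]
  linear_combination Real.exp (-(t * ε ^ 2)) * Real.exp (-(Real.pi ^ 2 * sqNorm ξ / t)) *
    rpow_mul_pi_div_rpow (d := d) ht

end Symbols

/-- The Fourier transform, written with plane waves. -/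
def fHat {d : ℕ} (f : (Fin d → ℝ) → ℂ) (ξ : Fin d → ℝ) : ℂ := ∫ x, f x * wave ξ (-x)

section FourierSide

variable {d : ℕ}

lemma wave_neg_left (ξ x : Fin d → ℝ) : wave (-ξ) x = wave ξ (-x) := by
  simp [wave, dotP]

lemma conj_wave (ξ x : Fin d → ℝ) : (starRingEnd ℂ) (wave ξ x) = wave ξ (-x) := by
  rw [wave_neg, Complex.inv_def, Complex.normSq_eq_norm_sq, norm_wave]; simp

lemma integrable_mul_wave_right {f : (Fin d → ℝ) → ℂ} (hf : Integrable f) (ξ : Fin d → ℝ) :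
    Integrable fun x => f x * wave ξ (-x) :=
  hf.mul_bdd (c := 1) (by fun_prop) (ae_of_all _ fun p => (norm_wave _ _).le)

lemma integrable_mul_wave_left {f : (Fin d → ℝ) → ℂ} (hf : Integrable f) (x : Fin d → ℝ) :
    Integrable fun ξ => f ξ * wave ξ x :=
  hf.mul_bdd (c := 1) (by fun_prop) (ae_of_all _ fun p => (norm_wave _ _).le)

lemma norm_fHat_le (f : (Fin d → ℝ) → ℂ) (ξ : Fin d → ℝ) : ‖fHat f ξ‖ ≤ ∫ x, ‖f x‖ := by
  refine (norm_integral_le_integral_norm _).trans_eq ?_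
  simp [norm_wave]

lemma continuous_fHat {f : (Fin d → ℝ) → ℂ} (hf : Integrable f) : Continuous (fHat f) := by
  refine continuous_of_dominated (bound := fun x => ‖f x‖)
    (fun ξ => (integrable_mul_wave_right hf ξ).aestronglyMeasurable)
    (fun ξ => ae_of_all _ fun x => by simp [norm_wave]) hf.norm (ae_of_all _ fun x => ?_)
  fun_prop

lemma integrable_fHat_mul {f M : (Fin d → ℝ) → ℂ} (hf : Integrable f) (hM : Integrable M) :
    Integrable fun ξ => fHat f ξ * M ξ :=
  hM.bdd_mul (c := ∫ x, ‖f x‖) (continuous_fHat hf).aestronglyMeasurable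
    (ae_of_all _ (norm_fHat_le f))

/-- Multiplication formula: pairing a function with an inverse Fourier transform. -/
lemma integral_mul_integral_wave {w N : (Fin d → ℝ) → ℂ} (hw : Integrable w) (hN : Integrable N) :
    ∫ x, w x * ∫ ξ, N ξ * wave ξ x = ∫ ξ, N ξ * fHat w (-ξ) := by
  have hfint : Integrable (Function.uncurry fun x ξ : Fin d → ℝ => w x * N ξ * wave ξ x)
      (volume.prod volume) :=
    (hw.mul_prod hN).mul_bdd (c := 1)
      ((continuous_wave continuous_snd continuous_fst).aestronglyMeasurable)
      (ae_of_all _ fun p => (norm_wave _ _).le)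
  calc _ = ∫ x, ∫ ξ, w x * N ξ * wave ξ x := by
        simp only [mul_assoc, integral_const_mul]
    _ = ∫ ξ, ∫ x, w x * N ξ * wave ξ x := integral_integral_swap hfint
    _ = _ := by
        congr 1 with ξ
        rw [fHat, ← integral_const_mul]
        congr 1 with x
        rw [wave_neg_left, neg_neg]; ring

lemma fHat_comp_sub_left (f : (Fin d → ℝ) → ℂ) (x ξ : Fin d → ℝ) :
    fHat (fun y => f (x - y)) (-ξ) = fHat f ξ * wave ξ x := by
  rw [fHat, fHat, ← integral_mul_const, ← integral_sub_left_eq_self _ _ x]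
  congr 1 with y
  rw [sub_sub_cancel, wave_neg_left, neg_neg, sub_eq_add_neg, wave_add]; ring

lemma integrable_ofReal_poissonSym {ε : ℝ} (hε : 0 < ε) :
    Integrable fun ξ : Fin d → ℝ => (poissonSym ε ξ : ℂ) := (integrable_poissonSym hε).ofReal

lemma integrable_ofReal_conjSym (i : Fin d) {ε : ℝ} (hε : 0 < ε) :
    Integrable fun ξ : Fin d → ℝ => -Complex.I * (conjSym i ε ξ : ℂ) :=
  (integrable_conjSym i hε).ofReal.const_mul (-Complex.I)

lemma integrable_ofReal_poissonK_sub {s : ℝ} (hs : 0 < s) (x₀ : Fin d → ℝ) :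
    Integrable fun x => (poissonK s (x₀ - x) : ℂ) :=
  ((integrable_poissonK hs).comp_sub_left x₀).ofReal

lemma pConv_eq {f : (Fin d → ℝ) → ℂ} (hf : Integrable f) {ε : ℝ} (hε : 0 < ε) (x : Fin d → ℝ) :
    pConv f ε x = ∫ ξ, fHat f ξ * poissonSym ε ξ * wave ξ x := by
  have h := integral_mul_integral_wave (hf.comp_sub_left x) (integrable_ofReal_poissonSym hε)
  simp only [integral_poissonSym_wave hε, fHat_comp_sub_left] at h
  rw [pConv, h]
  congr 1 with ξ; ring

lemma qConv_eq (i : Fin d) {f : (Fin d → ℝ) → ℂ} (hf : Integrable f) {ε : ℝ} (hε : 0 < ε)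
    (x : Fin d → ℝ) :
    qConv i f ε x = ∫ ξ, fHat f ξ * (-Complex.I * conjSym i ε ξ) * wave ξ x := by
  have h := integral_mul_integral_wave (hf.comp_sub_left x)
    (integrable_ofReal_conjSym i hε)
  simp only [integral_conjSym_wave i hε, fHat_comp_sub_left] at h
  rw [qConv, h]
  congr 1 with ξ; ring

lemma isPair_of_fHat {i : Fin d} {f g : (Fin d → ℝ) → ℂ} (hf : Integrable f) (hg : Integrable g)
    (h : ∀ᵐ ξ, fHat g ξ = -Complex.I * (ξ i / eucNorm ξ : ℝ) * fHat f ξ) : IsPair i f g := by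
  intro ε hε x
  rw [qConv_eq i hf hε, pConv_eq hg hε]
  refine integral_congr_ae ?_
  filter_upwards [h] with ξ hξ
  rw [hξ, conjSym_eq i hε]; push_cast; ring

lemma norm_qConv_le (i : Fin d) (f : (Fin d → ℝ) → ℂ) {ε : ℝ} (hε : 0 < ε) (x : Fin d → ℝ)
    (hf : Integrable f) : ‖qConv i f ε x‖ ≤ (ε ^ d)⁻¹ * ∫ y, ‖f y‖ := by
  rw [← integral_sub_left_eq_self (fun y => ‖f y‖) volume x, ← integral_const_mul]
  refine norm_integral_le_of_norm_le ((hf.comp_sub_left x).norm.const_mul _)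
    (ae_of_all _ fun y => ?_)
  rw [norm_mul, mul_comm, Complex.norm_real]
  gcongr
  exact abs_conjK_le hε i y

lemma continuous_qConv (i : Fin d) {f : (Fin d → ℝ) → ℂ} (hf : Integrable f) {ε : ℝ} (hε : 0 < ε) :
    Continuous (qConv i f ε) := by
  rw [funext (qConv_eq i hf hε)]
  have hfint := integrable_fHat_mul hf (integrable_ofReal_conjSym i hε)
  refine continuous_of_dominated (bound := fun ξ => ‖fHat f ξ * (-Complex.I * conjSym i ε ξ)‖)
    (fun x => (integrable_mul_wave_left hfint x).aestronglyMeasurable)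
    (fun x => ae_of_all _ fun ξ => by simp [norm_wave]) hfint.norm (ae_of_all _ fun ξ => ?_)
  fun_prop

lemma fHat_poissonK_comp {s : ℝ} (hs : 0 < s) (x₀ ξ : Fin d → ℝ) :
    fHat (fun x => (poissonK s (x₀ - x) : ℂ)) (-ξ) = poissonSym s ξ * wave ξ x₀ := by
  rw [fHat_comp_sub_left (fun x => (poissonK s x : ℂ)), ← integral_poissonK_wave hs ξ, fHat,
    ← integral_neg_eq_self]
  congr 2 with y
  rw [poissonK_neg, neg_neg, wave_comm]

lemma integrable_poissonK_sub {s : ℝ} (hs : 0 < s) (x₀ : Fin d → ℝ) :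
    Integrable fun x => poissonK s (x₀ - x) := (integrable_poissonK hs).comp_sub_left x₀

lemma integral_poissonK_mul_qConv (i : Fin d) {f : (Fin d → ℝ) → ℂ} (hf : Integrable f) {ε s : ℝ}
    (hε : 0 < ε) (hs : 0 < s) (x₀ : Fin d → ℝ) :
    ∫ x, (poissonK s (x₀ - x) : ℂ) * qConv i f ε x =
      ∫ ξ, (fHat f ξ * (-Complex.I * conjSym i s ξ) * wave ξ x₀) * poissonSym ε ξ := by
  have h := integral_mul_integral_wave (integrable_ofReal_poissonK_sub hs x₀)
    (integrable_fHat_mul hf (integrable_ofReal_conjSym i hε))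
  simp only [← qConv_eq i hf hε] at h
  rw [h]
  congr 1 with ξ
  rw [fHat_poissonK_comp hs, conjSym_eq i hε, conjSym_eq i hs]
  push_cast; ring

lemma poissonSym_eq (ξ : Fin d → ℝ) {ε : ℝ} (hε : 0 < ε) :
    (poissonSym ε ξ : ℂ) = ∫ y, (poissonK 1 y : ℂ) * wave (ε • y) ξ := by
  rw [← integral_poissonK_wave hε]
  have h := Measure.integral_comp_smul volume (fun y => (poissonK ε y : ℂ) * wave y ξ) ε
  have hε' : ε ^ d ≠ 0 := (pow_pos hε d).ne'
  rw [Module.finrank_fin_fun, abs_of_pos (by positivity), eq_inv_smul_iff₀ hε',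
    ← integral_smul] at h
  rw [← h]
  congr 1 with y
  rw [poissonK_eq hε, smul_smul, inv_mul_cancel₀ hε.ne', one_smul]
  push_cast
  rw [Complex.real_smul]
  have hε'' : (ε : ℂ) ^ d ≠ 0 := by exact_mod_cast hε'
  push_cast
  rw [← mul_assoc, mul_inv_cancel_left₀ hε'']

lemma abs_poissonSym_le (ξ : Fin d → ℝ) {ε : ℝ} (hε : 0 < ε) :
    ‖(poissonSym ε ξ : ℂ)‖ ≤ poissonMass d := by
  rw [← integral_poissonK_wave hε, ← integral_poissonK hε]
  refine norm_integral_le_of_norm_le (integrable_poissonK hε) (ae_of_all _ fun y => ?_)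
  rw [norm_mul, norm_wave, mul_one, Complex.norm_real, Real.norm_of_nonneg (poissonK_nonneg hε y)]

lemma tendsto_poissonSym (ξ : Fin d → ℝ) :
    Tendsto (fun ε => (poissonSym ε ξ : ℂ)) (𝓝[>] 0) (𝓝 (poissonMass d)) := by
  have h : Tendsto (fun ε : ℝ => ∫ y, (poissonK 1 y : ℂ) * wave (ε • y) ξ) (𝓝 0)
      (𝓝 (∫ y : Fin d → ℝ, (poissonK 1 y : ℂ))) := by
    refine tendsto_integral_filter_of_dominated_convergence (fun y => poissonK 1 y)
      (.of_forall fun ε => ?_) (.of_forall fun ε => ae_of_all _ fun y => ?_)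
      integrable_poissonK_one (ae_of_all _ fun y => ?_)
    · have := continuous_poissonK (d := d) one_pos
      exact (by fun_prop : Continuous _).aestronglyMeasurable
    · rw [norm_mul, norm_wave, mul_one, Complex.norm_real,
        Real.norm_of_nonneg (poissonK_nonneg one_pos y)]
    · refine Continuous.tendsto' (by fun_prop) _ _ ?_
      rw [zero_smul, wave_comm, wave_zero, mul_one]
  rw [integral_complex_ofReal] at h
  refine (h.mono_left nhdsWithin_le_nhds).congr' ?_
  filter_upwards [self_mem_nhdsWithin] with ε (hε : 0 < ε)
  rw [poissonSym_eq ξ hε]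

lemma tendsto_integral_poissonK_mul_qConv (i : Fin d) {f : (Fin d → ℝ) → ℂ} (hf : Integrable f)
    {s : ℝ} (hs : 0 < s) (x₀ : Fin d → ℝ) :
    Tendsto (fun ε => ∫ x, (poissonK s (x₀ - x) : ℂ) * qConv i f ε x) (𝓝[>] 0)
      (𝓝 (poissonMass d * qConv i f s x₀)) := by
  have hfint := integrable_mul_wave_left
    (integrable_fHat_mul hf (integrable_ofReal_conjSym i hs)) x₀
  rw [mul_comm, qConv_eq i hf hs, ← integral_mul_const]
  have h : Tendsto (fun ε => ∫ ξ, (fHat f ξ * (-Complex.I * conjSym i s ξ) * wave ξ x₀) *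
      (poissonSym ε ξ : ℂ)) (𝓝[>] 0)
      (𝓝 (∫ ξ, (fHat f ξ * (-Complex.I * conjSym i s ξ) * wave ξ x₀) * poissonMass d)) := by
    refine tendsto_integral_filter_of_dominated_convergence
      (fun ξ => ‖fHat f ξ * (-Complex.I * conjSym i s ξ) * wave ξ x₀‖ * poissonMass d) ?_ ?_
      (hfint.norm.mul_const _) (ae_of_all _ fun ξ => (tendsto_poissonSym ξ).const_mul _)
    · filter_upwards [self_mem_nhdsWithin] with ε (hε : 0 < ε)
      exact hfint.aestronglyMeasurable.mul (integrable_poissonSym hε).ofReal.aestronglyMeasurable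
    · filter_upwards [self_mem_nhdsWithin] with ε (hε : 0 < ε)
      refine ae_of_all _ fun ξ => ?_
      rw [norm_mul]
      gcongr
      exact abs_poissonSym_le ξ hε
  refine h.congr' ?_
  filter_upwards [self_mem_nhdsWithin] with ε (hε : 0 < ε)
  rw [integral_poissonK_mul_qConv i hf hε hs]

lemma fHat_conj (w : (Fin d → ℝ) → ℂ) (ξ : Fin d → ℝ) :
    fHat (fun x => (starRingEnd ℂ) (w x)) ξ = (starRingEnd ℂ) (fHat w (-ξ)) := by
  rw [fHat, fHat, ← integral_conj]
  congr 1 with x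
  rw [map_mul, conj_wave, wave_neg_left, neg_neg]

lemma integral_conv_poissonK {h : (Fin d → ℝ) → ℝ} (hh : Integrable h) {ε : ℝ} (hε : 0 < ε) :
    Integrable (fun x => ∫ y, h (x - y) * poissonK ε y) ∧
      ∫ x, ∫ y, h (x - y) * poissonK ε y = (∫ x, h x) * poissonMass d := by
  have h1 := (integrable_poissonK (d := d) hε).integrable_convolution
    (ContinuousLinearMap.mul ℝ ℝ) hh
  have h2 := integral_convolution (ContinuousLinearMap.mul ℝ ℝ)
    (integrable_poissonK (d := d) hε) hh
  rw [integral_poissonK hε, ContinuousLinearMap.mul_apply', mul_comm] at h2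
  rw [← h2]
  have h3 : (fun x => ∫ y, h (x - y) * poissonK ε y) =
      convolution (poissonK ε) h (ContinuousLinearMap.mul ℝ ℝ) := by
    ext x
    simp only [convolution, ContinuousLinearMap.mul_apply']
    congr 1 with y; ring
  exact ⟨h3 ▸ h1, by simp only [← h3]⟩

lemma norm_integral_mul_pConv_le {h w : (Fin d → ℝ) → ℂ}
    (hw2 : Integrable fun x => ‖w x‖ ^ 2)
    (hh2 : Integrable fun x => ‖h x‖ ^ 2) {ε : ℝ} (hε : 0 < ε) :
    ‖∫ x, w x * pConv h ε x‖ ≤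
      poissonMass d * ((∫ x, ‖w x‖ ^ 2) + ∫ x, ‖h x‖ ^ 2) / 2 := by
  obtain ⟨hi, he⟩ := integral_conv_poissonK hh2 hε
  have hb : Integrable fun x => ((∫ y, ‖h (x - y)‖ ^ 2 * poissonK ε y) +
      ‖w x‖ ^ 2 * poissonMass d) / 2 := (hi.add (hw2.mul_const _)).div_const 2
  refine (norm_integral_le_of_norm_le hb (ae_of_all _ fun x => ?_)).trans_eq ?_
  · have i1 : Integrable fun y => ‖h (x - y)‖ ^ 2 * poissonK ε y :=
      (hh2.comp_sub_left x).mul_bdd (continuous_poissonK hε).aestronglyMeasurable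
        (ae_of_all _ fun y => by
          rw [Real.norm_of_nonneg (poissonK_nonneg hε y)]; exact poissonK_le hε y)
    have i2 : Integrable fun y : Fin d → ℝ => ‖w x‖ ^ 2 * poissonK ε y :=
      (integrable_poissonK hε).const_mul _
    rw [pConv, ← integral_poissonK (d := d) hε, ← integral_const_mul, ← integral_const_mul,
      ← integral_add i1 i2, ← integral_div]
    refine norm_integral_le_of_norm_le ((i1.add i2).div_const 2) (ae_of_all _ fun y => ?_)
    rw [norm_mul, norm_mul, Complex.norm_real, Real.norm_of_nonneg (poissonK_nonneg hε y)]
    nlinarith [poissonK_nonneg hε y, mul_nonneg (poissonK_nonneg hε y)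
      (sq_nonneg (‖w x‖ - ‖h (x - y)‖))]
  · rw [integral_div, integral_add hi (hw2.mul_const _), he, integral_mul_const]; ring

lemma integral_sq_fHat_mul_poissonSym_le {h : (Fin d → ℝ) → ℂ} (hh : Integrable h)
    (hh2 : Integrable fun x => ‖h x‖ ^ 2) {ε : ℝ} (hε : 0 < ε) :
    ∫ ξ, ‖fHat h ξ‖ ^ 2 * poissonSym ε ξ ≤ poissonMass d * ∫ x, ‖h x‖ ^ 2 := by
  have hc : Integrable fun x => (starRingEnd ℂ) (h x) :=
    (LinearIsometryEquiv.integrable_comp_iff (Complex.conjLIE)).2 hh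
  have h1 := integral_mul_integral_wave hc
    (integrable_fHat_mul hh (integrable_ofReal_poissonSym hε))
  simp only [← pConv_eq hh hε, fHat_conj, neg_neg] at h1
  have h2 : ∫ ξ, fHat h ξ * poissonSym ε ξ * (starRingEnd ℂ) (fHat h ξ) =
      ((∫ ξ, ‖fHat h ξ‖ ^ 2 * poissonSym ε ξ : ℝ) : ℂ) := by
    rw [← integral_complex_ofReal]
    congr 1 with ξ
    rw [mul_right_comm, Complex.mul_conj, Complex.normSq_eq_norm_sq]; push_cast; ring
  have h3 := norm_integral_mul_pConv_le (w := fun x => (starRingEnd ℂ) (h x)) (h := h)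
    (by simpa using hh2) hh2 hε
  rw [h1, h2, Complex.norm_real] at h3
  refine (le_abs_self _).trans (h3.trans_eq ?_)
  simp only [RCLike.norm_conj]; ring

lemma integrable_sq_fHat_mul_poissonSym {h : (Fin d → ℝ) → ℂ} (hh : Integrable h)
    {ε : ℝ} (hε : 0 < ε) : Integrable fun ξ => ‖fHat h ξ‖ ^ 2 * poissonSym ε ξ :=
  (integrable_poissonSym hε).bdd_mul (c := (∫ x, ‖h x‖) ^ 2)
    ((continuous_fHat hh).norm.pow 2).aestronglyMeasurable
    (ae_of_all _ fun ξ => by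
      rw [norm_pow, norm_norm]; gcongr; exact norm_fHat_le h ξ)

/-- Uniform `L²` bound for the conjugate Poisson integrals, in bilinear form. -/
lemma norm_integral_mul_qConv_le (i : Fin d) {h w : (Fin d → ℝ) → ℂ} (hh : Integrable h)
    (hw : Integrable w) (hh2 : Integrable fun x => ‖h x‖ ^ 2)
    (hw2 : Integrable fun x => ‖w x‖ ^ 2) {ε s : ℝ} (hε : 0 < ε) (hs : 0 < s) :
    ‖∫ x, w x * qConv i h ε x‖ ≤
      poissonMass d / 2 * (s * (∫ x, ‖h x‖ ^ 2) + s⁻¹ * ∫ x, ‖w x‖ ^ 2) := by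
  simp only [qConv_eq i hh hε]
  rw [integral_mul_integral_wave hw (integrable_fHat_mul hh (integrable_ofReal_conjSym i hε))]
  have hc : Integrable fun x => (starRingEnd ℂ) (w x) :=
    (LinearIsometryEquiv.integrable_comp_iff (Complex.conjLIE)).2 hw
  have e1 := integral_sq_fHat_mul_poissonSym_le hh hh2 hε
  have e2 := integral_sq_fHat_mul_poissonSym_le hc (by simpa using hw2) hε
  have i1 := (integrable_sq_fHat_mul_poissonSym hh hε).const_mul s
  have i2 := (integrable_sq_fHat_mul_poissonSym hc hε).const_mul s⁻¹
  refine (norm_integral_le_of_norm_le ((i1.add i2).div_const 2) (ae_of_all _ fun ξ => ?_)).trans ?_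
  · simp only [Pi.add_apply, fHat_conj, RCLike.norm_conj]
    rw [norm_mul, norm_mul, norm_mul, norm_neg, Complex.norm_I, one_mul,
      Complex.norm_real, Real.norm_eq_abs]
    have hP := poissonSym_nonneg hε ξ
    have h1 := abs_conjSym_le i hε ξ
    set a := ‖fHat h ξ‖
    set b := ‖fHat w (-ξ)‖
    have ha : 0 ≤ a := norm_nonneg _
    have hb : 0 ≤ b := norm_nonneg _
    have h2 : 2 * (a * b) ≤ s * a ^ 2 + s⁻¹ * b ^ 2 := by
      have : s * a ^ 2 + s⁻¹ * b ^ 2 - 2 * (a * b) = s * (a - s⁻¹ * b) ^ 2 := by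
        field_simp; ring
      nlinarith [mul_nonneg hs.le (sq_nonneg (a - s⁻¹ * b))]
    calc a * |conjSym i ε ξ| * b ≤ a * poissonSym ε ξ * b := by gcongr
      _ ≤ _ := by nlinarith
  · simp only [Pi.add_apply]
    rw [integral_div, integral_add i1 i2, integral_const_mul, integral_const_mul]
    simp only [RCLike.norm_conj] at e2
    have := mul_le_mul_of_nonneg_left e1 hs.le
    have := mul_le_mul_of_nonneg_left e2 (inv_pos.2 hs).le
    linarith

end FourierSide

/-- The set where the (uncentered-growth) maximal function of `μ` exceeds `lam`. -/
def bigSet {d : ℕ} (μ : Measure (Fin d → ℝ)) (lam : ℝ) : Set (Fin d → ℝ) :=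
  {x | ∃ r > 0, ENNReal.ofReal (lam * r ^ d) < μ (Metric.closedBall x r)}

/-- Normalized indicator of the ball of radius `δ y / 2` about `y`. -/
def avgK {d : ℕ} (δ : (Fin d → ℝ) → ℝ) (y u : Fin d → ℝ) : ℝ :=
  if dist u y < δ y / 2 then (δ y ^ d)⁻¹ else 0

section CalderonZygmund

variable {d : ℕ}

lemma isOpen_bigSet (μ : Measure (Fin d → ℝ)) (lam : ℝ) : IsOpen (bigSet μ lam) := by
  rw [Metric.isOpen_iff]
  rintro x ⟨r, hr, hx⟩
  have h1 : ∀ᶠ r' in 𝓝[>] r, ENNReal.ofReal (lam * r' ^ d) < μ (Metric.closedBall x r) := by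
    have : Continuous fun r' : ℝ => ENNReal.ofReal (lam * r' ^ d) :=
      ENNReal.continuous_ofReal.comp (by fun_prop)
    exact ((this.tendsto r).mono_left nhdsWithin_le_nhds).eventually_lt_const hx
  obtain ⟨r', h2, hr' : r < r'⟩ := (h1.and self_mem_nhdsWithin).exists
  refine ⟨r' - r, sub_pos.2 hr', fun y hy => ⟨r', hr.trans hr', h2.trans_le ?_⟩⟩
  refine measure_mono fun z hz => ?_
  rw [Metric.mem_closedBall] at *
  rw [Metric.mem_ball, dist_comm] at hy
  linarith [dist_triangle z x y]

lemma volume_bigSet_le [Nonempty (Fin d)] (μ : Measure (Fin d → ℝ)) [IsFiniteMeasure μ] {lam : ℝ}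
    (hlam : 0 < lam) :
    volume (bigSet μ lam) ≤ ENNReal.ofReal (10 ^ d / lam) * μ univ := by
  have hd : d ≠ 0 := fun h => by subst h; exact IsEmpty.false (Classical.arbitrary (Fin 0))
  have hex : ∀ x : Fin d → ℝ, ∃ r : ℝ, x ∈ bigSet μ lam → 0 < r ∧
      ENNReal.ofReal (lam * r ^ d) < μ (Metric.closedBall x r) := by
    intro x
    by_cases hx : x ∈ bigSet μ lam
    · obtain ⟨r, hr, h⟩ := hx
      exact ⟨r, fun _ => ⟨hr, h⟩⟩
    · exact ⟨0, fun h => absurd h hx⟩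
  choose r hr using hex
  have hR : ∀ a ∈ bigSet μ lam, r a ≤ max 1 (μ.real univ / lam) := by
    intro a ha
    by_contra! hlt
    obtain ⟨h1, h2⟩ := max_lt_iff.1 hlt
    have h3 : lam * r a ^ d < μ.real univ :=
      (ENNReal.ofReal_lt_iff_lt_toReal (by have := (hr a ha).1; positivity)
        (measure_ne_top _ _)).1 ((hr a ha).2.trans_le (measure_mono (subset_univ _)))
    have h4 : r a ≤ r a ^ d := le_self_pow₀ h1.le hd
    rw [div_lt_iff₀ hlam] at h2
    nlinarith
  obtain ⟨u, hut, hdisj, hcov⟩ := Vitali.exists_disjoint_subfamily_covering_enlargement_closedBall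
    (bigSet μ lam) id r _ hR 5 (by norm_num)
  replace hdisj : u.PairwiseDisjoint fun a => Metric.closedBall a (r a) := hdisj
  have hcount : u.Countable := hdisj.countable_of_nonempty_interior fun a ha => by
    rw [interior_closedBall _ (hr a (hut ha)).1.ne']
    exact Metric.nonempty_ball.2 (hr a (hut ha)).1
  have hsub : bigSet μ lam ⊆ ⋃ a ∈ u, Metric.closedBall a (5 * r a) := by
    intro x hx
    obtain ⟨a, ha, h⟩ := hcov x hx
    exact mem_biUnion ha (h (Metric.mem_closedBall_self (hr x hx).1.le))
  calc volume (bigSet μ lam) ≤ ∑' a : u, volume (Metric.closedBall (a : Fin d → ℝ) (5 * r a)) :=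
        (measure_mono hsub).trans (measure_biUnion_le _ hcount _)
    _ ≤ ∑' a : u, ENNReal.ofReal (10 ^ d / lam) * μ (Metric.closedBall (a : Fin d → ℝ) (r a)) := by
        refine ENNReal.tsum_le_tsum fun a => ?_
        obtain ⟨h1, h2⟩ := hr a (hut a.2)
        rw [volume_closedBall_eq _ (by positivity)]
        refine le_trans (le_of_eq ?_) (mul_le_mul_right h2.le _)
        rw [← ENNReal.ofReal_mul (by positivity)]
        congr 1
        field_simp
        rw [← mul_pow]; ring_nf
    _ = ENNReal.ofReal (10 ^ d / lam) * μ (⋃ a ∈ u, Metric.closedBall a (r a)) := by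
        rw [ENNReal.tsum_mul_left, measure_biUnion hcount hdisj
          fun _ _ => Metric.isClosed_closedBall.measurableSet]
    _ ≤ _ := mul_le_mul_right (measure_mono (subset_univ _)) _

lemma measurable_avgK {δ : (Fin d → ℝ) → ℝ} (hδ : Measurable δ) :
    Measurable (Function.uncurry (avgK δ)) := by
  unfold Function.uncurry avgK
  refine Measurable.ite ?_ (by fun_prop) measurable_const
  exact measurableSet_lt (by fun_prop) (by fun_prop)

lemma avgK_nonneg {δ : (Fin d → ℝ) → ℝ} (hδ : ∀ y, 0 ≤ δ y) (y u : Fin d → ℝ) :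
    0 ≤ avgK δ y u := by
  have := hδ y
  unfold avgK; split_ifs <;> positivity

lemma avgK_eq_zero {δ : (Fin d → ℝ) → ℝ} {y : Fin d → ℝ} (hy : δ y = 0) (u : Fin d → ℝ) :
    avgK δ y u = 0 := by
  rw [avgK, hy, if_neg]; simp [dist_nonneg]

lemma avgK_eq_indicator (δ : (Fin d → ℝ) → ℝ) (y : Fin d → ℝ) :
    avgK δ y = (Metric.ball y (δ y / 2)).indicator fun _ => (δ y ^ d)⁻¹ := by
  ext u; simp [avgK, indicator]

lemma integral_avgK {δ : (Fin d → ℝ) → ℝ} {y : Fin d → ℝ} (hy : 0 < δ y) :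
    ∫ u, avgK δ y u = 1 := by
  rw [avgK_eq_indicator, integral_indicator_const _ Metric.isOpen_ball.measurableSet,
    measureReal_def,
    Real.volume_pi_ball _ (by positivity), Fintype.card_fin, ENNReal.toReal_ofReal (by positivity),
    smul_eq_mul, mul_div_cancel₀ _ two_ne_zero, mul_inv_cancel₀ (by positivity)]

lemma integrable_avgK (δ : (Fin d → ℝ) → ℝ) (y : Fin d → ℝ) : Integrable (avgK δ y) := by
  rw [avgK_eq_indicator, integrable_indicator_iff Metric.isOpen_ball.measurableSet]
  exact integrableOn_const measure_ball_lt_top.ne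

lemma lintegral_avgK_le {δ : (Fin d → ℝ) → ℝ} (hδ : ∀ y, 0 ≤ δ y) (y : Fin d → ℝ) :
    ∫⁻ u, ‖(avgK δ y u : ℂ)‖ₑ ≤ 1 := by
  have h : ∀ u, ‖(avgK δ y u : ℂ)‖ₑ = ENNReal.ofReal (avgK δ y u) := fun u => by
    rw [← ofReal_norm, Complex.norm_real, Real.norm_of_nonneg (avgK_nonneg hδ y u)]
  simp only [h]
  rcases (hδ y).eq_or_lt with h0 | h0
  · simp [avgK_eq_zero h0.symm]
  · rw [← ofReal_integral_eq_lintegral_ofReal (integrable_avgK δ y)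
      (ae_of_all _ fun u => avgK_nonneg hδ y u), integral_avgK h0, ENNReal.ofReal_one]

lemma integrable_mul_avgK {f : (Fin d → ℝ) → ℂ} (hf : Integrable f) {δ : (Fin d → ℝ) → ℝ}
    (hδm : Measurable δ) (hδ : ∀ y, 0 ≤ δ y) :
    Integrable (fun p : (Fin d → ℝ) × (Fin d → ℝ) => f p.1 * (avgK δ p.1 p.2 : ℂ))
      (volume.prod volume) := by
  have hm : AEStronglyMeasurable
      (fun p : (Fin d → ℝ) × (Fin d → ℝ) => f p.1 * (avgK δ p.1 p.2 : ℂ))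
      (volume.prod volume) :=
    hf.aestronglyMeasurable.comp_fst.mul
      (Complex.measurable_ofReal.comp (measurable_avgK hδm)).aestronglyMeasurable
  refine ⟨hm, ?_⟩
  rw [HasFiniteIntegral, lintegral_prod _ hm.enorm]
  refine lt_of_le_of_lt (lintegral_mono fun y => ?_) hf.2
  simp only [enorm_mul]
  rw [lintegral_const_mul' _ _ enorm_ne_top]
  exact mul_le_of_le_one_right' (lintegral_avgK_le hδ y)

lemma integrable_avg {f : (Fin d → ℝ) → ℂ} (hf : Integrable f) {δ : (Fin d → ℝ) → ℝ}
    (hδm : Measurable δ) (hδ : ∀ y, 0 ≤ δ y) :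
    Integrable (fun x => ∫ y, f y * (avgK δ y x : ℂ)) :=
  (integrable_mul_avgK hf hδm hδ).integral_prod_right

/-- The cancellation estimate for the averaged kernel outside the exceptional set. -/
lemma norm_conjK_sub_avg_le {C : ℝ} (hC : ∀ (i : Fin d) (ε δ : ℝ)
    (u v : Fin d → ℝ), 0 < ε → 0 < δ → δ ≤ ‖u‖ → ‖u - v‖ ≤ δ / 2 →
    |conjK i ε u - conjK i ε v| ≤ C * poissonK δ u) (i : Fin d) {ε : ℝ} (hε : 0 < ε)
    {δ : (Fin d → ℝ) → ℝ} {x y : Fin d → ℝ} (hy : 0 < δ y) (hxy : δ y ≤ ‖x - y‖) :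
    |conjK i ε (x - y) - ∫ u, avgK δ y u * conjK i ε (x - u)| ≤ C * poissonK (δ y) (x - y) := by
  have i1 : Integrable fun u => avgK δ y u * conjK i ε (x - u) :=
    (integrable_avgK δ y).mul_bdd (by
      have := continuous_conjK i hε
      exact (by fun_prop : Continuous fun u => conjK i ε (x - u)).aestronglyMeasurable)
      (ae_of_all _ fun u => by
        rw [Real.norm_eq_abs]; exact abs_conjK_le hε i _)
  rw [← one_mul (conjK i ε (x - y)), ← integral_avgK hy, ← integral_mul_const,
    ← integral_sub ((integrable_avgK δ y).mul_const _) i1]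
  have h := norm_integral_le_of_norm_le
    (f := fun u => avgK δ y u * conjK i ε (x - y) - avgK δ y u * conjK i ε (x - u))
    ((integrable_avgK δ y).mul_const (C * poissonK (δ y) (x - y))) (ae_of_all _ fun u => ?_)
  · rw [integral_mul_const, integral_avgK hy, one_mul, Real.norm_eq_abs] at h
    exact h
  · rw [← mul_sub, Real.norm_eq_abs, abs_mul]
    by_cases hu : dist u y < δ y / 2
    · have hpos : 0 ≤ avgK δ y u := by rw [avgK, if_pos hu]; positivity
      rw [abs_of_nonneg hpos]
      gcongr
      refine hC i ε (δ y) _ _ hε hy hxy ?_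
      rw [sub_sub_sub_cancel_left, ← dist_eq_norm]; exact hu.le
    · simp [avgK, hu]

lemma qConv_eq_integral (i : Fin d) (f : (Fin d → ℝ) → ℂ) (ε : ℝ) (x : Fin d → ℝ) :
    qConv i f ε x = ∫ y, f y * (conjK i ε (x - y) : ℂ) := by
  rw [qConv, ← integral_sub_left_eq_self _ _ x]
  simp only [sub_sub_cancel]

lemma lintegral_qConv_bad_le {C : ℝ} (hC0 : 0 < C) (hC : ∀ (i : Fin d) (ε δ : ℝ)
    (u v : Fin d → ℝ), 0 < ε → 0 < δ → δ ≤ ‖u‖ → ‖u - v‖ ≤ δ / 2 →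
    |conjK i ε u - conjK i ε v| ≤ C * poissonK δ u) (i : Fin d) {f : (Fin d → ℝ) → ℂ}
    (hf : Integrable f) {s : Set (Fin d → ℝ)} (hs : IsOpen s) (hne : sᶜ.Nonempty)
    {ε : ℝ} (hε : 0 < ε) :
    ∫⁻ x in sᶜ, ‖qConv i (fun x => s.indicator f x -
      ∫ y, f y * (avgK (fun z => Metric.infDist z sᶜ) y x : ℂ)) ε x‖ₑ ≤
      ENNReal.ofReal (C * poissonMass d) * ∫⁻ x, ‖f x‖ₑ := by
  set δ : (Fin d → ℝ) → ℝ := fun z => Metric.infDist z sᶜ with hδdef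
  have hδc : Continuous δ := Metric.continuous_infDist_pt _
  have hδ : ∀ y, 0 ≤ δ y := fun y => Metric.infDist_nonneg
  have hδpos : ∀ y ∈ s, 0 < δ y := fun y hy =>
    (hs.isClosed_compl.notMem_iff_infDist_pos hne).1 (by simpa using hy)
  have hδzero : ∀ y ∉ s, δ y = 0 := fun y hy => Metric.infDist_zero_of_mem hy
  have hFu := integrable_mul_avgK hf hδc.measurable hδ
  have hq : ∀ x, Continuous fun u => conjK i ε (x - u) := fun x => by
    have := continuous_conjK i hε
    fun_prop
  have hbd : ∀ x ∈ sᶜ, ‖qConv i (fun x => s.indicator f x - ∫ y, f y * (avgK δ y x : ℂ)) ε x‖ₑ ≤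
      ∫⁻ y, ‖f y‖ₑ * ENNReal.ofReal (C * poissonK (δ y) (x - y)) := by
    intro x hx
    have i3 : Integrable (fun p : (Fin d → ℝ) × (Fin d → ℝ) =>
        f p.1 * (avgK δ p.1 p.2 : ℂ) * (conjK i ε (x - p.2) : ℂ)) (volume.prod volume) :=
      hFu.mul_bdd (c := (ε ^ d)⁻¹)
        (Complex.continuous_ofReal.comp ((hq x).comp continuous_snd)).aestronglyMeasurable
        (ae_of_all _ fun p => by rw [Complex.norm_real]; exact abs_conjK_le hε i _)
    have hsw := integral_integral_swap (f := fun y u =>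
      f y * (avgK δ y u : ℂ) * (conjK i ε (x - u) : ℂ)) i3
    have i1 : Integrable fun y => s.indicator f y * (conjK i ε (x - y) : ℂ) :=
      (hf.indicator hs.measurableSet).mul_bdd (c := (ε ^ d)⁻¹)
        (Complex.continuous_ofReal.comp (hq x)).aestronglyMeasurable
        (ae_of_all _ fun p => by rw [Complex.norm_real]; exact abs_conjK_le hε i _)
    have i2 : Integrable fun u => (∫ y, f y * (avgK δ y u : ℂ)) * (conjK i ε (x - u) : ℂ) :=
      (integrable_avg hf hδc.measurable hδ).mul_bdd (c := (ε ^ d)⁻¹)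
        (Complex.continuous_ofReal.comp (hq x)).aestronglyMeasurable
        (ae_of_all _ fun p => by rw [Complex.norm_real]; exact abs_conjK_le hε i _)
    have key : qConv i (fun x => s.indicator f x - ∫ y, f y * (avgK δ y x : ℂ)) ε x =
        ∫ y, (s.indicator f y * (conjK i ε (x - y) : ℂ) -
          f y * ((∫ u, avgK δ y u * conjK i ε (x - u) : ℝ) : ℂ)) := by
      rw [qConv_eq_integral]
      simp only [sub_mul]
      simp only [integral_mul_const] at hsw
      rw [integral_sub i1 i2, ← hsw, ← integral_sub i1 i3.integral_prod_left]
      congr 1 with y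
      rw [← integral_complex_ofReal, ← integral_const_mul]
      congr 2 with u
      push_cast; ring
    rw [key]
    refine (enorm_integral_le_lintegral_enorm _).trans (lintegral_mono fun y => ?_)
    by_cases hy : y ∈ s
    · have hxy : δ y ≤ ‖x - y‖ := by
        rw [← dist_eq_norm, dist_comm]; exact Metric.infDist_le_dist_of_mem hx
      rw [indicator_of_mem hy, ← mul_sub, enorm_mul, ← Complex.ofReal_sub,
        ← ofReal_norm (_ : ℂ), ← ofReal_norm ((_ : ℝ) : ℂ), Complex.norm_real]
      gcongr
      exact norm_conjK_sub_avg_le hC i hε (hδpos y hy) hxy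
    · simp [indicator_of_notMem hy, avgK_eq_zero (hδzero y hy)]
  calc _ ≤ ∫⁻ x in sᶜ, ∫⁻ y, ‖f y‖ₑ * ENNReal.ofReal (C * poissonK (δ y) (x - y)) :=
        setLIntegral_mono' hs.isClosed_compl.measurableSet hbd
    _ ≤ ∫⁻ x, ∫⁻ y, ‖f y‖ₑ * ENNReal.ofReal (C * poissonK (δ y) (x - y)) :=
        setLIntegral_le_lintegral _ _
    _ = ∫⁻ y, ∫⁻ x, ‖f y‖ₑ * ENNReal.ofReal (C * poissonK (δ y) (x - y)) := by
        refine lintegral_lintegral_swap ?_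
        refine (hf.aestronglyMeasurable.enorm.comp_snd).mul (Measurable.aemeasurable ?_)
        unfold poissonK depth sqNorm
        fun_prop
    _ ≤ ∫⁻ y, ‖f y‖ₑ * ENNReal.ofReal (C * poissonMass d) := by
        refine lintegral_mono fun y => ?_
        rw [lintegral_const_mul' _ _ enorm_ne_top]
        gcongr
        rcases (hδ y).eq_or_lt with h0 | h0
        · simp [poissonK, ← h0]
        · rw [← ofReal_integral_eq_lintegral_ofReal
            (((integrable_poissonK h0).comp_sub_right y).const_mul C)
            (ae_of_all _ fun x => mul_nonneg hC0.le (poissonK_nonneg h0 _)), integral_const_mul,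
            integral_sub_right_eq_self (poissonK (δ y)) y, integral_poissonK h0]
    _ = _ := by rw [lintegral_mul_const' _ _ ENNReal.ofReal_ne_top, mul_comm]

end CalderonZygmund

section Decomposition

variable {d : ℕ}

lemma ae_norm_le_of_notMem_bigSet {f : (Fin d → ℝ) → ℂ} (hf : Integrable f) {lam : ℝ}
    (hlam : 0 < lam) :
    ∀ᵐ x, x ∉ bigSet (volume.withDensity fun x => ‖f x‖ₑ) lam → ‖f x‖ ≤ lam := by
  filter_upwards [IsUnifLocDoublingMeasure.ae_tendsto_average volume hf.norm.locallyIntegrable 1]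
    with x hx hxs
  have h := hx (l := 𝓝[>] (0 : ℝ)) (fun _ => x) id tendsto_id (by
    filter_upwards [self_mem_nhdsWithin] with r (hr : 0 < r)
    exact Metric.mem_closedBall_self (by simpa using hr.le))
  refine le_of_tendsto h ?_
  filter_upwards [self_mem_nhdsWithin] with r (hr : 0 < r)
  have h1 : ∫⁻ y in Metric.closedBall x r, ‖f y‖ₑ ≤ ENNReal.ofReal (lam * r ^ d) := by
    rw [← withDensity_apply _ Metric.isClosed_closedBall.measurableSet]
    by_contra! hlt
    exact hxs ⟨r, hr, hlt⟩
  have h2 : ∫ y in Metric.closedBall x r, ‖f y‖ ≤ lam * r ^ d := by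
    rw [integral_norm_eq_lintegral_enorm hf.aestronglyMeasurable.restrict]
    exact ENNReal.toReal_le_of_le_ofReal (by positivity) h1
  rw [id, setAverage_eq, measureReal_def, volume_closedBall_eq _ hr.le,
    ENNReal.toReal_ofReal (by positivity), smul_eq_mul, inv_mul_le_iff₀ (by positivity)]
  refine h2.trans ?_
  rw [mul_comm]
  gcongr
  linarith

lemma enorm_avg_le {f : (Fin d → ℝ) → ℂ} {lam : ℝ} (hlam : 0 < lam) {s : Set (Fin d → ℝ)}
    (hs : s = bigSet (volume.withDensity fun x => ‖f x‖ₑ) lam) (hne : sᶜ.Nonempty)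
    {x : Fin d → ℝ} (hx : 0 < Metric.infDist x sᶜ) :
    ‖∫ y, f y * (avgK (fun z => Metric.infDist z sᶜ) y x : ℂ)‖ ≤ 4 ^ d * lam := by
  set δ : (Fin d → ℝ) → ℝ := fun z => Metric.infDist z sᶜ with hδdef
  replace hx : 0 < δ x := hx
  obtain ⟨z, hz, hxz⟩ := (Metric.infDist_lt_iff hne).1 (by linarith : δ x < 1.5 * δ x)
  have hball : ∫⁻ y in Metric.closedBall z (2.5 * δ x), ‖f y‖ₑ ≤
      ENNReal.ofReal (lam * (2.5 * δ x) ^ d) := by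
    rw [← withDensity_apply _ Metric.isClosed_closedBall.measurableSet]
    by_contra! hlt
    exact hz (hs ▸ ⟨_, by positivity, hlt⟩)
  have hle : ∀ y, ‖f y * (avgK δ y x : ℂ)‖ₑ ≤
      (Metric.closedBall z (2.5 * δ x)).indicator (fun y => ‖f y‖ₑ) y *
        ENNReal.ofReal (((2 / 3 * δ x) ^ d)⁻¹) := by
    intro y
    by_cases hy : dist x y < δ y / 2
    · have h1 : δ y ≤ δ x + dist y x := Metric.infDist_le_infDist_add_dist
      have h2 : δ x ≤ δ y + dist x y := Metric.infDist_le_infDist_add_dist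
      rw [dist_comm] at h1
      have hmem : y ∈ Metric.closedBall z (2.5 * δ x) := by
        rw [Metric.mem_closedBall]
        have := dist_triangle y x z
        rw [dist_comm y x] at this
        linarith
      rw [indicator_of_mem hmem, enorm_mul, avgK, if_pos hy, ← ofReal_norm ((_ : ℝ) : ℂ),
        Complex.norm_real, Real.norm_of_nonneg (by
          have : 0 < δ y := by linarith
          positivity)]
      gcongr
      linarith
    · simp [avgK, hy]
  have h3 : ‖∫ y, f y * (avgK δ y x : ℂ)‖ₑ ≤ ENNReal.ofReal (4 ^ d * lam) := by
    calc _ ≤ ∫⁻ y, ‖f y * (avgK δ y x : ℂ)‖ₑ := enorm_integral_le_lintegral_enorm _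
      _ ≤ _ := lintegral_mono hle
      _ = (∫⁻ y in Metric.closedBall z (2.5 * δ x), ‖f y‖ₑ) *
          ENNReal.ofReal (((2 / 3 * δ x) ^ d)⁻¹) := by
          rw [lintegral_mul_const' _ _ ENNReal.ofReal_ne_top,
            lintegral_indicator Metric.isClosed_closedBall.measurableSet]
      _ ≤ ENNReal.ofReal (lam * (2.5 * δ x) ^ d) * ENNReal.ofReal (((2 / 3 * δ x) ^ d)⁻¹) := by
          gcongr
      _ ≤ _ := by
          rw [← ENNReal.ofReal_mul (by positivity)]
          refine ENNReal.ofReal_le_ofReal ?_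
          rw [mul_assoc, mul_comm, ← inv_pow, ← mul_pow]
          gcongr
          field_simp
          norm_num
  rw [← ofReal_norm] at h3
  exact (ENNReal.ofReal_le_ofReal_iff (by positivity)).1 h3

lemma integral_norm_avg_le {f : (Fin d → ℝ) → ℂ} (hf : Integrable f) {δ : (Fin d → ℝ) → ℝ}
    (hδm : Measurable δ) (hδ : ∀ y, 0 ≤ δ y) :
    ∫ x, ‖∫ y, f y * (avgK δ y x : ℂ)‖ ≤ ∫ x, ‖f x‖ := by
  have hF := integrable_mul_avgK hf hδm hδ
  rw [integral_norm_eq_lintegral_enorm hf.aestronglyMeasurable,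
    integral_norm_eq_lintegral_enorm (integrable_avg hf hδm hδ).aestronglyMeasurable]
  refine ENNReal.toReal_mono hf.2.ne ?_
  calc _ ≤ ∫⁻ x, ∫⁻ y, ‖f y * (avgK δ y x : ℂ)‖ₑ :=
        lintegral_mono fun x => enorm_integral_le_lintegral_enorm _
    _ = ∫⁻ y, ∫⁻ x, ‖f y * (avgK δ y x : ℂ)‖ₑ :=
        lintegral_lintegral_swap hF.swap.aestronglyMeasurable.enorm
    _ ≤ ∫⁻ y, ‖f y‖ₑ := by
        refine lintegral_mono fun y => ?_
        simp only [enorm_mul]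
        rw [lintegral_const_mul' _ _ enorm_ne_top]
        exact mul_le_of_le_one_right' (lintegral_avgK_le hδ y)

/-- The Calderón–Zygmund decomposition at height `lam`, for conjugate Poisson integrals. -/
theorem exists_calderonZygmund (d : ℕ) [Nonempty (Fin d)] : ∃ C : ℝ, 0 < C ∧
    ∀ (f : (Fin d → ℝ) → ℂ), Integrable f → ∀ lam > 0, ∃ (g : (Fin d → ℝ) → ℂ)
      (s : Set (Fin d → ℝ)), MeasurableSet s ∧ Integrable g ∧ (∀ᵐ x, ‖g x‖ ≤ C * lam) ∧
      ∫ x, ‖g x‖ ≤ 2 * ∫ x, ‖f x‖ ∧ volume s ≤ ENNReal.ofReal (C / lam * ∫ x, ‖f x‖) ∧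
      ∀ (i : Fin d) (ε : ℝ), 0 < ε →
        ∫⁻ x in sᶜ, ‖qConv i (fun x => f x - g x) ε x‖ₑ ≤ ENNReal.ofReal (C * ∫ x, ‖f x‖) := by
  obtain ⟨C, hC0, hC⟩ := exists_abs_conjK_sub_le d
  have hκ : 0 < poissonMass d := poissonMass_pos
  refine ⟨10 ^ d + C * poissonMass d, by positivity, fun f hf lam hlam => ?_⟩
  have hn : 0 ≤ ∫ x, ‖f x‖ := integral_nonneg fun _ => norm_nonneg _
  set μ := volume.withDensity fun x => ‖f x‖ₑ with hμ
  have hμu : μ univ = ENNReal.ofReal (∫ x, ‖f x‖) := by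
    rw [hμ, withDensity_apply _ MeasurableSet.univ, setLIntegral_univ,
      ofReal_integral_norm_eq_lintegral_enorm hf]
  have : IsFiniteMeasure μ := ⟨by rw [hμu]; exact ENNReal.ofReal_lt_top⟩
  set s := bigSet μ lam with hs
  have hso : IsOpen s := isOpen_bigSet _ _
  have hvol : volume s ≤ ENNReal.ofReal (10 ^ d / lam * ∫ x, ‖f x‖) := by
    rw [ENNReal.ofReal_mul (by positivity), ← hμu]
    exact volume_bigSet_le μ hlam
  have hne : sᶜ.Nonempty := by
    rw [nonempty_compl]
    intro h
    rw [h] at hvol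
    exact (hvol.trans_lt ENNReal.ofReal_lt_top).ne (measure_univ_of_isAddLeftInvariant _)
  set δ : (Fin d → ℝ) → ℝ := fun z => Metric.infDist z sᶜ with hδdef
  have hδc : Continuous δ := Metric.continuous_infDist_pt _
  have hδ : ∀ y, 0 ≤ δ y := fun y => Metric.infDist_nonneg
  set A : (Fin d → ℝ) → ℂ := fun x => ∫ y, f y * (avgK δ y x : ℂ) with hA
  have hAi : Integrable A := integrable_avg hf hδc.measurable hδ
  have hsm := hso.measurableSet
  refine ⟨fun x => sᶜ.indicator f x + A x, s, hsm, (hf.indicator hsm.compl).add hAi, ?_, ?_, ?_, ?_⟩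
  · filter_upwards [ae_norm_le_of_notMem_bigSet hf hlam] with x hx
    by_cases hxs : x ∈ s
    · have hpos : 0 < δ x := (hso.isClosed_compl.notMem_iff_infDist_pos hne).1 (by simpa using hxs)
      rw [indicator_of_notMem (by simpa using hxs), zero_add]
      refine (enorm_avg_le hlam hs hne hpos).trans ?_
      gcongr
      have : (4 : ℝ) ^ d ≤ 10 ^ d := by gcongr; norm_num
      nlinarith
    · have h0 : A x = 0 := by
        refine (integral_congr_ae (ae_of_all _ fun y => ?_)).trans (integral_zero _ _)
        have : δ y ≤ dist y x := Metric.infDist_le_dist_of_mem hxs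
        have h1 : ¬ dist x y < δ y / 2 := by
          rw [dist_comm]; have := hδ y; linarith [dist_nonneg (x := y) (y := x)]
        simp [avgK, h1]
      rw [indicator_of_mem (by simpa using hxs), h0, add_zero]
      refine (hx hxs).trans ?_
      have : (1 : ℝ) ≤ 10 ^ d := one_le_pow₀ (by norm_num)
      nlinarith [mul_pos hC0 hκ]
  · have h1 : ∫ x, ‖sᶜ.indicator f x‖ ≤ ∫ x, ‖f x‖ :=
      integral_mono (hf.indicator hsm.compl).norm hf.norm fun x => norm_indicator_le_norm_self _ _
    have h2 : ∫ x, ‖A x‖ ≤ ∫ x, ‖f x‖ := integral_norm_avg_le hf hδc.measurable hδ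
    have h3 : ∫ x, ‖sᶜ.indicator f x + A x‖ ≤ ∫ x, (‖sᶜ.indicator f x‖ + ‖A x‖) :=
      integral_mono ((hf.indicator hsm.compl).add hAi).norm
        ((hf.indicator hsm.compl).norm.add hAi.norm) fun x => norm_add_le _ _
    rw [integral_add (hf.indicator hsm.compl).norm hAi.norm] at h3
    linarith
  · refine hvol.trans (ENNReal.ofReal_le_ofReal ?_)
    gcongr
    nlinarith [mul_pos hC0 hκ]
  · intro i ε hε
    have heq : (fun x => f x - (sᶜ.indicator f x + A x)) = fun x => s.indicator f x - A x := by
      ext x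
      rw [← sub_sub]
      congr 1
      by_cases hxs : x ∈ s <;> simp [hxs]
    rw [heq]
    refine (lintegral_qConv_bad_le hC0 hC i hf hso hne hε).trans ?_
    rw [← ofReal_integral_norm_eq_lintegral_enorm hf, ← ENNReal.ofReal_mul (by positivity)]
    refine ENNReal.ofReal_le_ofReal ?_
    gcongr
    exact le_add_of_nonneg_left (by positivity)

end Decomposition

section BoundaryValues

variable {d : ℕ}

lemma qConv_add (i : Fin d) {f g : (Fin d → ℝ) → ℂ} (hf : Integrable f) (hg : Integrable g)
    {ε : ℝ} (hε : 0 < ε) (x : Fin d → ℝ) :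
    qConv i (fun x => f x + g x) ε x = qConv i f ε x + qConv i g ε x := by
  simp only [qConv, add_mul]
  exact integral_add (integrable_mul_conjK (hf.comp_sub_left x) i hε)
    (integrable_mul_conjK (hg.comp_sub_left x) i hε)

lemma integrable_poissonK_mul_qConv (i : Fin d) {f : (Fin d → ℝ) → ℂ} (hf : Integrable f)
    {ε s : ℝ} (hε : 0 < ε) (hs : 0 < s) (x₀ : Fin d → ℝ) :
    Integrable fun x => (poissonK s (x₀ - x) : ℂ) * qConv i f ε x :=
  (integrable_ofReal_poissonK_sub hs x₀).mul_bdd (c := (ε ^ d)⁻¹ * ∫ y, ‖f y‖)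
    (continuous_qConv i hf hε).aestronglyMeasurable
    (ae_of_all _ fun x => norm_qConv_le i f hε x hf)

lemma norm_integral_poissonK_mul_qConv_le (i : Fin d) {f : (Fin d → ℝ) → ℂ} (hf : Integrable f)
    {ε s : ℝ} (hε : 0 < ε) (hs : 0 < s) (x₀ : Fin d → ℝ) :
    ‖∫ x, (poissonK s (x₀ - x) : ℂ) * qConv i f ε x‖ ≤
      (∫ x, ‖f x‖) * (poissonMass d * ∫ ξ : Fin d → ℝ, poissonSym s ξ) := by
  rw [integral_poissonK_mul_qConv i hf hε hs, ← integral_const_mul, ← integral_const_mul]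
  refine norm_integral_le_of_norm_le (((integrable_poissonSym hs).const_mul _).const_mul _)
    (ae_of_all _ fun ξ => ?_)
  rw [norm_mul, norm_mul, norm_mul, norm_wave, mul_one, norm_mul, norm_neg, Complex.norm_I, one_mul,
    Complex.norm_real, Real.norm_eq_abs, mul_assoc, mul_comm (poissonMass d)]
  have h1 := norm_fHat_le f ξ
  have h2 := abs_conjSym_le i hs ξ
  have h3 := abs_poissonSym_le ξ hε
  have h4 := poissonSym_nonneg hs ξ
  gcongr

/-- The conjugate Poisson integrals `u_ε` of an integrable function are uniformly integrable
off small sets, when tested against a Poisson kernel. -/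
lemma exists_uniformly_small (i : Fin d) {f : (Fin d → ℝ) → ℂ} (hf : Integrable f) {s : ℝ}
    (hs : 0 < s) (x₀ : Fin d → ℝ) : ∃ K : ℝ, 0 < K ∧ ∀ η : ℝ, 0 < η → η ≤ 1 →
      ∃ δ : ℝ, 0 < δ ∧ ∃ Ω : Set (Fin d → ℝ), MeasurableSet Ω ∧
        ∫ x in Ω, poissonK s (x₀ - x) ≤ K * η ∧
        ∀ E : Set (Fin d → ℝ), MeasurableSet E → ∫ x in E, poissonK s (x₀ - x) ≤ δ →
          ∀ ε > 0, ‖∫ x in Ω ∪ E, (poissonK s (x₀ - x) : ℂ) * qConv i f ε x‖ ≤ K * η := by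
  have : Nonempty (Fin d) := ⟨i⟩
  obtain ⟨C, hC0, hCZ⟩ := exists_calderonZygmund d
  have hκ : 0 < poissonMass d := poissonMass_pos
  set κ := poissonMass d
  set S := ∫ ξ : Fin d → ℝ, poissonSym s ξ with hS
  have hS0 : 0 ≤ S := integral_nonneg fun ξ => poissonSym_nonneg hs ξ
  set M := (s ^ d)⁻¹ with hM
  have hM0 : 0 < M := by positivity
  have hφ := integrable_poissonK_sub hs x₀
  have hφM : ∀ x, poissonK s (x₀ - x) ≤ M := fun x => poissonK_le hs _
  have hφ0 : ∀ x, 0 ≤ poissonK s (x₀ - x) := fun x => poissonK_nonneg hs _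
  refine ⟨κ / 2 * (2 + 4 * C + M * (M * C + 1)) + 3 * (κ * S) + M * C, by positivity,
    fun η hη hη1 => ?_⟩
  set n₀ := ∫ x, ‖f x‖ with hn₀
  have hn0 : 0 ≤ n₀ := integral_nonneg fun _ => norm_nonneg _
  obtain ⟨g₀, hsupp, hfg₀, hg₀c, hg₀⟩ := hf.exists_hasCompactSupport_integral_sub_le hη
  obtain ⟨N, hN⟩ := hsupp.exists_bound_of_continuous hg₀c
  have hN0 : 0 ≤ N := (norm_nonneg _).trans (hN 0)
  set A := N * (n₀ + 1) + 1 with hA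
  have hA1 : 1 ≤ A := by rw [hA]; nlinarith
  have hA0 : 0 < A := by linarith
  have hf₁ : Integrable fun x => f x - g₀ x := hf.sub hg₀
  obtain ⟨g, Ω, hΩ, hg, hgb, hgn, hvol, hbad⟩ := hCZ _ hf₁ (A / η) (by positivity)
  have hg₀n : ∫ x, ‖g₀ x‖ ≤ n₀ + 1 := by
    have : ∫ x, ‖g₀ x‖ ≤ ∫ x, (‖f x‖ + ‖f x - g₀ x‖) := by
      refine integral_mono hg₀.norm (hf.norm.add hf₁.norm) fun x => ?_
      calc ‖g₀ x‖ = ‖f x - (f x - g₀ x)‖ := by rw [sub_sub_cancel]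
        _ ≤ _ := norm_sub_le _ _
    rw [integral_add hf.norm hf₁.norm] at this
    linarith
  have hΩφ : ∫ x in Ω, poissonK s (x₀ - x) ≤ M * C * (η ^ 2 / A) := by
    have hvr : volume.real Ω ≤ C * (η ^ 2 / A) := by
      refine ENNReal.toReal_le_of_le_ofReal (by positivity)
        (hvol.trans (ENNReal.ofReal_le_ofReal ?_))
      calc C / (A / η) * ∫ x, ‖f x - g₀ x‖ ≤ C / (A / η) * η := by gcongr
        _ = _ := by field_simp
    have h := setIntegral_mono_on hφ.integrableOn
      (integrableOn_const (hvol.trans_lt ENNReal.ofReal_lt_top).ne) hΩ fun x _ => hφM x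
    rw [setIntegral_const, smul_eq_mul] at h
    nlinarith
  have hηA : η ^ 2 / A ≤ η := by
    rw [div_le_iff₀ hA0]; nlinarith
  refine ⟨η ^ 2 / A, by positivity, Ω, hΩ, ?_, fun E hE hEφ ε hε => ?_⟩
  · refine hΩφ.trans ?_
    calc M * C * (η ^ 2 / A) ≤ M * C * η := by gcongr
      _ ≤ _ := by gcongr; exact le_add_of_nonneg_left (by positivity)
  set h : (Fin d → ℝ) → ℂ := fun x => g₀ x + g x with hh
  set b : (Fin d → ℝ) → ℂ := fun x => f x - g₀ x - g x with hb
  have hhi : Integrable h := hg₀.add hg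
  have hbi : Integrable b := hf₁.sub hg
  have hfeq : f = fun x => h x + b x := by ext x; simp only [hh, hb]; ring
  have hsqb : ∀ᵐ x, ‖h x‖ ^ 2 ≤ 2 * N * ‖g₀ x‖ + 2 * (C * (A / η)) * ‖g x‖ := by
    filter_upwards [hgb] with x hx
    have h1 := hN x
    have h2 : ‖h x‖ ≤ ‖g₀ x‖ + ‖g x‖ := norm_add_le _ _
    have h3 := norm_nonneg (g₀ x)
    have h4 := norm_nonneg (g x)
    calc ‖h x‖ ^ 2 ≤ (‖g₀ x‖ + ‖g x‖) ^ 2 := by gcongr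
      _ ≤ 2 * ‖g₀ x‖ * ‖g₀ x‖ + 2 * ‖g x‖ * ‖g x‖ := by nlinarith [sq_nonneg (‖g₀ x‖ - ‖g x‖)]
      _ ≤ _ := by gcongr
  have hbnd : Integrable fun x => 2 * N * ‖g₀ x‖ + 2 * (C * (A / η)) * ‖g x‖ :=
    (hg₀.norm.const_mul _).add (hg.norm.const_mul _)
  have hh2 : Integrable fun x => ‖h x‖ ^ 2 := by
    refine hbnd.mono' (hhi.aestronglyMeasurable.norm.pow 2) ?_
    filter_upwards [hsqb] with x hx
    rwa [Real.norm_of_nonneg (by positivity)]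
  have hh2n : ∫ x, ‖h x‖ ^ 2 ≤ (2 + 4 * C) * A := by
    refine (integral_mono_ae hh2 hbnd hsqb).trans ?_
    rw [integral_add (hg₀.norm.const_mul _) (hg.norm.const_mul _), integral_const_mul,
      integral_const_mul]
    have h1 : N * ∫ x, ‖g₀ x‖ ≤ A := by
      rw [hA]; nlinarith [mul_le_mul_of_nonneg_left hg₀n hN0]
    have h2 : 2 * (C * (A / η)) * ∫ x, ‖g x‖ ≤ 2 * (C * (A / η)) * (2 * η) := by
      gcongr; linarith
    have h3 : 2 * (C * (A / η)) * (2 * η) = 4 * C * A := by field_simp; ring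
    linarith
  have hbn : ∫ x, ‖b x‖ ≤ 3 * η := by
    have : ∫ x, ‖b x‖ ≤ ∫ x, (‖f x - g₀ x‖ + ‖g x‖) :=
      integral_mono hbi.norm (hf₁.norm.add hg.norm) fun x => norm_sub_le _ _
    rw [integral_add hf₁.norm hg.norm] at this
    linarith
  have hU : MeasurableSet (Ω ∪ E) := hΩ.union hE
  set w : (Fin d → ℝ) → ℂ := (Ω ∪ E).indicator fun x => (poissonK s (x₀ - x) : ℂ) with hw
  have hφc := integrable_ofReal_poissonK_sub hs x₀
  have hwi : Integrable w := hφc.indicator hU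
  have hwsq : ∀ x, ‖w x‖ ^ 2 ≤ (Ω ∪ E).indicator (fun x => M * poissonK s (x₀ - x)) x := by
    intro x
    by_cases hx : x ∈ Ω ∪ E
    · simp only [hw, indicator_of_mem hx, Complex.norm_real, Real.norm_of_nonneg (hφ0 x)]
      nlinarith [hφM x, hφ0 x]
    · simp [hw, indicator_of_notMem hx]
  have hwb : Integrable ((Ω ∪ E).indicator fun x => M * poissonK s (x₀ - x)) :=
    (hφ.const_mul M).indicator hU
  have hw2 : Integrable fun x => ‖w x‖ ^ 2 :=
    hwb.mono' (hwi.aestronglyMeasurable.norm.pow 2)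
      (ae_of_all _ fun x => by rw [Real.norm_of_nonneg (by positivity)]; exact hwsq x)
  have hw2n : ∫ x, ‖w x‖ ^ 2 ≤ M * (M * C + 1) * (η ^ 2 / A) := by
    refine (integral_mono hw2 hwb hwsq).trans ?_
    rw [integral_indicator hU, integral_const_mul]
    have h1 : ∫ x in Ω ∪ E, poissonK s (x₀ - x) ≤
        (∫ x in Ω, poissonK s (x₀ - x)) + ∫ x in E, poissonK s (x₀ - x) := by
      rw [← union_sdiff_self, setIntegral_union disjoint_sdiff_right (hE.diff hΩ) hφ.integrableOn
        hφ.integrableOn]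
      refine add_le_add le_rfl ?_
      exact setIntegral_mono_set hφ.integrableOn (ae_of_all _ hφ0) sdiff_subset.eventuallyLE
    rw [mul_assoc]
    gcongr
    linarith
  have hqf : ∀ x, qConv i f ε x = qConv i h ε x + qConv i b ε x := fun x => by
    conv_lhs => rw [hfeq]
    exact qConv_add i hhi hbi hε x
  have ih := integrable_poissonK_mul_qConv i hhi hε hs x₀
  have ib := integrable_poissonK_mul_qConv i hbi hε hs x₀
  have e1 : ∫ x in Ω ∪ E, (poissonK s (x₀ - x) : ℂ) * qConv i h ε x =
      ∫ x, w x * qConv i h ε x := by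
    rw [← integral_indicator hU]
    congr 1 with x
    by_cases hx : x ∈ Ω ∪ E
    · simp only [hw, indicator_of_mem hx]
    · simp only [hw, indicator_of_notMem hx, zero_mul]
  have b1 : ‖∫ x, w x * qConv i h ε x‖ ≤ κ / 2 * (2 + 4 * C + M * (M * C + 1)) * η := by
    refine (norm_integral_mul_qConv_le i hhi hwi hh2 hw2 hε (s := η / A) (by positivity)).trans ?_
    rw [mul_assoc (κ / 2)]
    gcongr
    calc η / A * (∫ x, ‖h x‖ ^ 2) + (η / A)⁻¹ * ∫ x, ‖w x‖ ^ 2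
        ≤ η / A * ((2 + 4 * C) * A) + (η / A)⁻¹ * (M * (M * C + 1) * (η ^ 2 / A)) := by gcongr
      _ = _ := by field_simp
  have b2 : ‖∫ x, (poissonK s (x₀ - x) : ℂ) * qConv i b ε x‖ ≤ 3 * (κ * S) * η := by
    refine (norm_integral_poissonK_mul_qConv_le i hbi hε hs x₀).trans ?_
    calc (∫ x, ‖b x‖) * (κ * S) ≤ 3 * η * (κ * S) := by gcongr
      _ = _ := by ring
  have b3 : ‖∫ x in (Ω ∪ E)ᶜ, (poissonK s (x₀ - x) : ℂ) * qConv i b ε x‖ ≤ M * C * η := by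
    rw [← ENNReal.ofReal_le_ofReal_iff (by positivity), ofReal_norm]
    calc _ ≤ ∫⁻ x in (Ω ∪ E)ᶜ, ‖(poissonK s (x₀ - x) : ℂ) * qConv i b ε x‖ₑ :=
          enorm_integral_le_lintegral_enorm _
      _ ≤ ∫⁻ x in Ωᶜ, ‖(poissonK s (x₀ - x) : ℂ) * qConv i b ε x‖ₑ :=
          lintegral_mono_set (compl_subset_compl.2 subset_union_left)
      _ ≤ ∫⁻ x in Ωᶜ, ENNReal.ofReal M * ‖qConv i b ε x‖ₑ := by
          refine lintegral_mono fun x => ?_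
          rw [enorm_mul, ← ofReal_norm ((_ : ℝ) : ℂ), Complex.norm_real,
            Real.norm_of_nonneg (hφ0 x)]
          gcongr
          exact hφM x
      _ ≤ _ := by
          rw [lintegral_const_mul' _ _ ENNReal.ofReal_ne_top, mul_assoc,
            ENNReal.ofReal_mul hM0.le]
          gcongr
          refine (hbad i ε hε).trans (ENNReal.ofReal_le_ofReal ?_)
          gcongr
  have e2 : ∫ x in Ω ∪ E, (poissonK s (x₀ - x) : ℂ) * qConv i b ε x =
      (∫ x, (poissonK s (x₀ - x) : ℂ) * qConv i b ε x) -
        ∫ x in (Ω ∪ E)ᶜ, (poissonK s (x₀ - x) : ℂ) * qConv i b ε x := by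
    rw [← integral_add_compl hU ib]; ring
  simp only [hqf, mul_add]
  rw [integral_add ih.integrableOn ib.integrableOn, e1, e2]
  refine (norm_add_le _ _).trans ((add_le_add_right (norm_sub_le _ _) _).trans ?_)
  linarith

/-- An integrable boundary value of the conjugate Poisson integral of an integrable function
determines it: there is no singular part. -/
theorem isPair_of_tendsto (i : Fin d) {f G : (Fin d → ℝ) → ℂ} (hf : Integrable f)
    (hG : Integrable G)
    (h : ∀ᵐ x, Tendsto (fun ε => qConv i f ε x) (𝓝[>] 0) (𝓝 (G x))) :
    IsPair i f fun x => (poissonMass d : ℂ)⁻¹ * G x := by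
  have hκ : 0 < poissonMass d := poissonMass_pos
  have hκ' : (poissonMass d : ℂ) ≠ 0 := by exact_mod_cast hκ.ne'
  obtain ⟨G', hG'm, hGG'⟩ := hG.aestronglyMeasurable
  have hG' : Integrable G' := hG.congr hGG'
  intro s hs x₀
  have hφ := integrable_poissonK_sub hs x₀
  have hφc := integrable_ofReal_poissonK_sub hs x₀
  have hφ0 : ∀ x, 0 ≤ poissonK s (x₀ - x) := fun x => poissonK_nonneg hs _
  have hφm : Measurable fun x => ENNReal.ofReal (poissonK s (x₀ - x)) := by
    have := continuous_poissonK (d := d) hs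
    exact (ENNReal.continuous_ofReal.comp (by fun_prop)).measurable
  have hφe : ∀ x, ‖(poissonK s (x₀ - x) : ℂ)‖ₑ = ENNReal.ofReal (poissonK s (x₀ - x)) := fun x => by
    rw [← ofReal_norm, Complex.norm_real, Real.norm_of_nonneg (hφ0 x)]
  set ν := (volume : Measure (Fin d → ℝ)).withDensity
    fun x => ENNReal.ofReal (poissonK s (x₀ - x)) with hν
  have hνE : ∀ E, MeasurableSet E → ν E = ENNReal.ofReal (∫ x in E, poissonK s (x₀ - x)) := by
    intro E hE
    rw [hν, withDensity_apply _ hE, ofReal_integral_eq_lintegral_ofReal hφ.integrableOn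
      (ae_of_all _ hφ0)]
  have hνf : IsFiniteMeasure ν := ⟨by
    rw [hνE _ MeasurableSet.univ]; exact ENNReal.ofReal_lt_top⟩
  have hGφ : Integrable fun x => (poissonK s (x₀ - x) : ℂ) * G' x :=
    hG'.bdd_mul (c := (s ^ d)⁻¹) hφc.aestronglyMeasurable
      (ae_of_all _ fun x => by rw [Complex.norm_real]; exact abs_poissonK_le hs _)
  have hν_int : ∀ E, MeasurableSet E →
      ∫⁻ x in E, ‖G' x‖ₑ ∂ν = ∫⁻ x in E, ‖(poissonK s (x₀ - x) : ℂ) * G' x‖ₑ := by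
    intro E hE
    rw [hν, restrict_withDensity hE, lintegral_withDensity_eq_lintegral_mul _ hφm
      hG'm.enorm]
    simp only [enorm_mul, hφe, Pi.mul_apply]
  have hGν : ∫⁻ x, ‖G' x‖ₑ ∂ν ≠ ∞ := by
    rw [← setLIntegral_univ, hν_int _ MeasurableSet.univ, setLIntegral_univ]
    exact hGφ.2.ne
  set t : ℕ → ℝ := fun n => 1 / ((n : ℝ) + 1) with ht
  have ht0 : ∀ n, 0 < t n := fun n => by positivity
  have htt : Tendsto t atTop (𝓝[>] 0) :=
    tendsto_nhdsWithin_iff.2 ⟨tendsto_one_div_add_atTop_nhds_zero_nat, .of_forall ht0⟩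
  have hae : ∀ᵐ x ∂ν, Tendsto (fun n => qConv i f (t n) x) atTop (𝓝 (G' x)) := by
    refine (withDensity_absolutelyContinuous _ _).ae_le ?_
    filter_upwards [h, hGG'] with x hx hx'
    rw [← hx']
    exact hx.comp htt
  have hlim := (tendsto_integral_poissonK_mul_qConv i hf hs x₀).comp htt
  set L := (poissonMass d : ℂ) * qConv i f s x₀
  obtain ⟨K, hK0, hK⟩ := exists_uniformly_small i hf hs x₀
  have key : ∀ η : ℝ, 0 < η → η ≤ 1 →
      ‖L - ∫ x, (poissonK s (x₀ - x) : ℂ) * G' x‖ ≤ (K + 1 + poissonMass d) * η := by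
    intro η₀ hη₀ hη₀1
    obtain ⟨δ₁, hδ₁, hsmall⟩ := exists_pos_setLIntegral_lt_of_measure_lt hGν
      (ENNReal.ofReal_pos.2 hη₀).ne'
    obtain ⟨r, hr0, hrδ⟩ := ENNReal.lt_iff_exists_nnreal_btwn.1 hδ₁
    have hr0' : (0 : ℝ) < r := by exact_mod_cast hr0
    set η := min η₀ (r / (K + 1)) with hη
    have hη0 : 0 < η := lt_min hη₀ (by positivity)
    have hηle : η ≤ η₀ := min_le_left _ _
    have hηr : (K + 1) * η ≤ r := by
      have := min_le_right η₀ (r / (K + 1))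
      rwa [← hη, le_div_iff₀ (by positivity), mul_comm] at this
    obtain ⟨δ, hδ, Ω, hΩ, hΩφ, hE⟩ := hK η hη0 (hηle.trans hη₀1)
    obtain ⟨E, hEm, hEν, hunif⟩ := tendstoUniformlyOn_of_ae_tendsto' (μ := ν)
      (fun n => (continuous_qConv i hf (ht0 n)).stronglyMeasurable) hG'm hae
      (lt_min hδ hη0)
    have hEφ : ∫ x in E, poissonK s (x₀ - x) ≤ min δ η := by
      rwa [hνE E hEm, ENNReal.ofReal_le_ofReal_iff (lt_min hδ hη0).le] at hEν
    have hU : MeasurableSet (Ω ∪ E) := hΩ.union hEm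
    have hνU : ν (Ω ∪ E) < δ₁ := by
      refine lt_of_le_of_lt ?_ hrδ
      calc ν (Ω ∪ E) ≤ ν Ω + ν E := measure_union_le _ _
        _ ≤ ENNReal.ofReal (K * η) + ENNReal.ofReal η := by
            rw [hνE _ hΩ]
            exact add_le_add (ENNReal.ofReal_le_ofReal hΩφ)
              (hEν.trans (ENNReal.ofReal_le_ofReal (min_le_right _ _)))
        _ = ENNReal.ofReal (K * η + η) := (ENNReal.ofReal_add (by positivity) hη0.le).symm
        _ ≤ r := by
            rw [← ENNReal.ofReal_coe_nnreal]
            exact ENNReal.ofReal_le_ofReal (by linarith)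
    have hb : ‖∫ x in Ω ∪ E, (poissonK s (x₀ - x) : ℂ) * G' x‖ ≤ η₀ := by
      rw [← ENNReal.ofReal_le_ofReal_iff hη₀.le, ofReal_norm]
      refine (enorm_integral_le_lintegral_enorm _).trans ?_
      rw [← hν_int _ hU]
      exact (hsmall _ hνU).le
    refine le_of_tendsto ((hlim.sub_const _).norm) ?_
    filter_upwards [Metric.tendstoUniformlyOn_iff.1 hunif η₀ hη₀] with n hn
    have iu := integrable_poissonK_mul_qConv i hf (ht0 n) hs x₀
    have ha := hE E hEm (hEφ.trans (min_le_left _ _)) (t n) (ht0 n)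
    have hc : ‖∫ x in (Ω ∪ E)ᶜ, ((poissonK s (x₀ - x) : ℂ) * qConv i f (t n) x -
        (poissonK s (x₀ - x) : ℂ) * G' x)‖ ≤ poissonMass d * η₀ := by
      have hb1 : ∫ x, η₀ * poissonK s (x₀ - x) = poissonMass d * η₀ := by
        rw [integral_const_mul, integral_sub_left_eq_self (poissonK s), integral_poissonK hs,
          mul_comm]
      rw [← hb1]
      refine (norm_integral_le_of_norm_le (hφ.const_mul η₀).integrableOn
        ((ae_restrict_mem hU.compl).mono fun x hx => ?_)).trans
        (setIntegral_le_integral (hφ.const_mul η₀)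
          (ae_of_all _ fun x => mul_nonneg hη₀.le (hφ0 x)))
      rw [← mul_sub, norm_mul, Complex.norm_real, Real.norm_of_nonneg (hφ0 x), mul_comm]
      have hxE : x ∈ Eᶜ := fun hxE => hx (Or.inr hxE)
      have := (hn x hxE).le
      rw [dist_comm, dist_eq_norm] at this
      exact mul_le_mul_of_nonneg_right this (hφ0 x)
    rw [integral_sub iu.integrableOn hGφ.integrableOn] at hc
    simp only [Function.comp_apply]
    rw [← integral_add_compl hU iu, ← integral_add_compl hU hGφ, add_sub_add_comm]
    refine (norm_add_le _ _).trans ?_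
    have h3 := norm_sub_le (∫ x in Ω ∪ E, (poissonK s (x₀ - x) : ℂ) * qConv i f (t n) x)
      (∫ x in Ω ∪ E, (poissonK s (x₀ - x) : ℂ) * G' x)
    have h4 : K * η ≤ K * η₀ := by gcongr
    linarith
  have hzero : ‖L - ∫ x, (poissonK s (x₀ - x) : ℂ) * G' x‖ ≤ 0 := by
    have ht1 : Tendsto (fun η : ℝ => (K + 1 + poissonMass d) * η) (𝓝[>] 0) (𝓝 0) :=
      ((Continuous.tendsto' (by fun_prop) _ _ (mul_zero _)).mono_left nhdsWithin_le_nhds)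
    refine ge_of_tendsto ht1 ?_
    filter_upwards [Ioc_mem_nhdsGT one_pos] with η hη
    exact key η hη.1 hη.2
  have heq := sub_eq_zero.1 (norm_le_zero_iff.1 hzero)
  have hp : pConv (fun x => (poissonMass d : ℂ)⁻¹ * G x) s x₀ =
      (poissonMass d : ℂ)⁻¹ * ∫ x, (poissonK s (x₀ - x) : ℂ) * G' x := by
    rw [pConv, ← integral_const_mul,
      ← integral_sub_left_eq_self (fun x => (poissonMass d : ℂ)⁻¹ *
        ((poissonK s (x₀ - x) : ℂ) * G' x)) volume x₀]
    refine integral_congr_ae ?_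
    have hq : ∀ᵐ y, G (x₀ - y) = G' (x₀ - y) :=
      (quasiMeasurePreserving_sub_left_of_right_invariant volume x₀).ae hGG'
    filter_upwards [hq] with y hy
    rw [sub_sub_cancel, hy]; ring
  rw [hp, ← heq, inv_mul_cancel_left₀ hκ']

end BoundaryValues

section ConjugatePairs

variable {d : ℕ}

lemma ae_comp_sub_left {p : (Fin d → ℝ) → Prop} (h : ∀ᵐ x, p x) (x : Fin d → ℝ) :
    ∀ᵐ y, p (x - y) :=
  (quasiMeasurePreserving_sub_left_of_right_invariant volume x).ae h

lemma IsPair.congr_ae {i : Fin d} {f f' g g' : (Fin d → ℝ) → ℂ} (h : IsPair i f g)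
    (hf : f =ᵐ[volume] f') (hg : g =ᵐ[volume] g') : IsPair i f' g' := fun ε hε x =>
  calc qConv i f' ε x = qConv i f ε x := integral_congr_ae
        ((ae_comp_sub_left hf x).mono fun y hy => by simp only [hy])
    _ = pConv g ε x := h ε hε x
    _ = pConv g' ε x := integral_congr_ae
        ((ae_comp_sub_left hg x).mono fun y hy => by simp only [hy])

lemma IsPair.const_mul {i : Fin d} {f g : (Fin d → ℝ) → ℂ} (h : IsPair i f g) (a : ℂ) :
    IsPair i (fun x => a * f x) fun x => a * g x := fun ε hε x => by
  have := h ε hε x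
  simp only [qConv, pConv, mul_assoc, integral_const_mul] at this ⊢
  rw [this]

lemma IsPair.add {i : Fin d} {f g f' g' : (Fin d → ℝ) → ℂ} (h : IsPair i f g)
    (h' : IsPair i f' g') (hf : Integrable f) (hf' : Integrable f') (hg : Integrable g)
    (hg' : Integrable g') : IsPair i (fun x => f x + f' x) fun x => g x + g' x :=
  fun ε hε x => by
  rw [qConv_add i hf hf' hε, h ε hε, h' ε hε]
  simp only [pConv, add_mul]
  rw [← integral_add]
  · simpa using ((integrable_mul_poissonK ((hg.comp_sub_left x)) hε))
  · simpa using ((integrable_mul_poissonK ((hg'.comp_sub_left x)) hε))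

lemma IsPair.comp_sub_right {i : Fin d} {f g : (Fin d → ℝ) → ℂ} (h : IsPair i f g)
    (a : Fin d → ℝ) : IsPair i (fun x => f (x - a)) fun x => g (x - a) := fun ε hε x => by
  have := h ε hε (x - a)
  simpa only [qConv, pConv, sub_right_comm x _ a] using this

lemma IsPair.comp_smul {i : Fin d} {f g : (Fin d → ℝ) → ℂ} (h : IsPair i f g) {r : ℝ}
    (hr : r ≠ 0) : IsPair i (fun x => f (r • x)) fun x => ((|r| / r : ℝ) : ℂ) * g (r • x) :=
  fun ε hε x => by
  have hr' : |r| ≠ 0 := abs_ne_zero.2 hr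
  have hrd : |r| ^ d ≠ 0 := pow_ne_zero _ hr'
  have key := h (|r| * ε) (mul_pos (abs_pos.2 hr) hε) (r • x)
  have e1 : qConv i (fun x => f (r • x)) ε x =
      ((|r| / r : ℝ) : ℂ) * qConv i f (|r| * ε) (r • x) := by
    have := Measure.integral_comp_smul volume
      (fun y : Fin d → ℝ => f (r • x - y) * (conjK i (|r| * ε) y : ℂ)) r
    simp only [conjK_smul hr, ← smul_sub] at this
    rw [qConv, qConv, ← mul_right_inj' (Complex.ofReal_ne_zero.2
      (mul_ne_zero (div_ne_zero hr hr') (inv_ne_zero hrd)) : ((r / |r| * (|r| ^ d)⁻¹ : ℝ) : ℂ) ≠ 0),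
      ← integral_const_mul]
    have h2 : ∀ y : Fin d → ℝ, ((r / |r| * (|r| ^ d)⁻¹ : ℝ) : ℂ) *
        (f (r • (x - y)) * (conjK i ε y : ℂ)) =
        f (r • (x - y)) * ((r / |r| * (|r| ^ d)⁻¹ * conjK i ε y : ℝ) : ℂ) := fun y => by
      push_cast; ring
    simp only [h2]
    rw [this, Complex.real_smul, ← mul_assoc, ← Complex.ofReal_mul]
    congr 2
    simp only [Module.finrank_fintype_fun_eq_card, Fintype.card_fin, abs_inv, abs_pow]
    field_simp
  have e2 : pConv (fun x => ((|r| / r : ℝ) : ℂ) * g (r • x)) ε x =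
      ((|r| / r : ℝ) : ℂ) * pConv g (|r| * ε) (r • x) := by
    have := Measure.integral_comp_smul volume
      (fun y : Fin d → ℝ => g (r • x - y) * (poissonK (|r| * ε) y : ℂ)) r
    simp only [poissonK_smul hr, ← smul_sub] at this
    simp only [pConv, mul_assoc, integral_const_mul]
    congr 1
    rw [← mul_right_inj' (Complex.ofReal_ne_zero.2
      (inv_ne_zero hrd) : (((|r| ^ d)⁻¹ : ℝ) : ℂ) ≠ 0), ← integral_const_mul]
    have h2 : ∀ y : Fin d → ℝ, (((|r| ^ d)⁻¹ : ℝ) : ℂ) *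
        (g (r • (x - y)) * (poissonK ε y : ℂ)) =
        g (r • (x - y)) * (((|r| ^ d)⁻¹ * poissonK ε y : ℝ) : ℂ) := fun y => by
      push_cast; ring
    simp only [h2]
    rw [this, Complex.real_smul]
    simp only [Module.finrank_fintype_fun_eq_card, Fintype.card_fin, abs_inv, abs_pow]
  rw [e1, e2, key]

lemma integral_norm_comp_smul (f : (Fin d → ℝ) → ℂ) {r : ℝ} (hr : r ≠ 0) :
    |r| ^ d * ∫ x, ‖f (r • x)‖ = ∫ x, ‖f x‖ := by
  have hrd : |r| ^ d ≠ 0 := pow_ne_zero _ (abs_ne_zero.2 hr)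
  rw [Measure.integral_comp_smul volume (fun x => ‖f x‖) r]
  simp only [Module.finrank_fintype_fun_eq_card, Fintype.card_fin, abs_inv, abs_pow, smul_eq_mul]
  rw [mul_inv_cancel_left₀ hrd]

/-- Convolution against a bounded kernel commutes with `L¹`-convergent series. -/
lemma integral_tsum_mul_bdd {ι : Type*} [Countable ι] {F : ι → (Fin d → ℝ) → ℂ}
    (hF : ∀ n, Integrable (F n)) (hs : Summable fun n => ∫ x, ‖F n x‖) {k : (Fin d → ℝ) → ℝ}
    (hk : AEStronglyMeasurable k) {C : ℝ} (hC : ∀ y, |k y| ≤ C) (x : Fin d → ℝ) :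
    ∫ y, (∑' n, F n (x - y)) * (k y : ℂ) = ∑' n, ∫ y, F n (x - y) * (k y : ℂ) := by
  have hi : ∀ n, Integrable fun y : Fin d → ℝ => F n (x - y) * (k y : ℂ) := fun n =>
    integrable_mul_bdd_ofReal ((hF n).comp_sub_left x) hk hC
  rw [integral_tsum_of_summable_integral_norm hi]
  · simp only [tsum_mul_right]
  · refine Summable.of_nonneg_of_le (fun n => integral_nonneg fun y => norm_nonneg _)
      (fun n => ?_) (hs.mul_right C)
    rw [← integral_sub_left_eq_self (fun y => ‖F n y‖) volume x, ← integral_mul_const]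
    refine integral_mono (hi n).norm (((hF n).comp_sub_left x).norm.mul_const C) fun y => ?_
    simp only [norm_mul, Complex.norm_real, Real.norm_eq_abs]
    exact mul_le_mul_of_nonneg_left (hC y) (norm_nonneg _)

lemma IsPair.tsum {ι : Type*} [Countable ι] {i : Fin d} {F G : ι → (Fin d → ℝ) → ℂ}
    (hF : ∀ n, Integrable (F n)) (hG : ∀ n, Integrable (G n))
    (hFs : Summable fun n => ∫ x, ‖F n x‖) (hGs : Summable fun n => ∫ x, ‖G n x‖)
    (h : ∀ n, IsPair i (F n) (G n)) :
    IsPair i (fun x => ∑' n, F n x) fun x => ∑' n, G n x := fun ε hε x => by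
  rw [qConv, pConv, integral_tsum_mul_bdd hF hFs (continuous_conjK i hε).aestronglyMeasurable
    (abs_conjK_le hε i), integral_tsum_mul_bdd hG hGs
    (continuous_poissonK hε).aestronglyMeasurable (abs_poissonK_le hε)]
  exact tsum_congr fun n => h n ε hε x

/-- Convolution against a bounded kernel commutes with integrals over a parameter. -/
lemma integral_integral_mul_bdd {F : (Fin d → ℝ) → (Fin d → ℝ) → ℂ}
    (hF : Integrable (Function.uncurry F) (volume.prod volume)) {k : (Fin d → ℝ) → ℝ}
    (hk : Continuous k) {C : ℝ} (hC : ∀ y, |k y| ≤ C) (x : Fin d → ℝ) :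
    ∫ u, (∫ y, F y (x - u)) * (k u : ℂ) = ∫ y, ∫ u, F y (x - u) * (k u : ℂ) := by
  simp only [← integral_mul_const]
  rw [integral_integral_swap]
  have h1 : Integrable (fun p : (Fin d → ℝ) × (Fin d → ℝ) => F p.1 (x - p.2))
      (volume.prod volume) :=
    ((MeasurePreserving.id volume).prod
      (Measure.measurePreserving_sub_left volume x)).integrable_comp_of_integrable hF
  have h2 : Integrable (fun p : (Fin d → ℝ) × (Fin d → ℝ) => F p.1 (x - p.2) * (k p.2 : ℂ))
      (volume.prod volume) := by
    refine h1.mul_bdd (c := C) (by fun_prop) (ae_of_all _ fun p => ?_)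
    rw [Complex.norm_real]
    exact hC p.2
  exact h2.swap

lemma IsPair.integral {i : Fin d} {F G : (Fin d → ℝ) → (Fin d → ℝ) → ℂ}
    (hF : Integrable (Function.uncurry F) (volume.prod volume))
    (hG : Integrable (Function.uncurry G) (volume.prod volume))
    (h : ∀ᵐ y, IsPair i (F y) (G y)) :
    IsPair i (fun x => ∫ y, F y x) fun x => ∫ y, G y x := fun ε hε x => by
  rw [qConv, pConv, integral_integral_mul_bdd hF (continuous_conjK i hε) (abs_conjK_le hε i),
    integral_integral_mul_bdd hG (continuous_poissonK hε) (abs_poissonK_le hε)]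
  exact integral_congr_ae (h.mono fun y hy => hy ε hε x)

lemma integrable_uncurry_mul_sub {u f : (Fin d → ℝ) → ℂ} (hu : Integrable u)
    (hf : Integrable f) :
    Integrable (Function.uncurry fun y x : Fin d → ℝ => u y * f (x - y))
      (volume.prod volume) :=
  (hu.convolution_integrand (ContinuousLinearMap.mul ℝ ℂ) hf).swap

lemma IsPair.conv_left {i : Fin d} {u f g : (Fin d → ℝ) → ℂ} (h : IsPair i f g)
    (hu : Integrable u) (hf : Integrable f) (hg : Integrable g) :
    IsPair i (fun x => ∫ y, u y * f (x - y)) fun x => ∫ y, u y * g (x - y) :=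
  IsPair.integral (integrable_uncurry_mul_sub hu hf) (integrable_uncurry_mul_sub hu hg)
    (ae_of_all _ fun y => (h.comp_sub_right y).const_mul (u y))

lemma integrable_integral_uncurry {F : (Fin d → ℝ) → (Fin d → ℝ) → ℂ}
    (hF : Integrable (Function.uncurry F) (volume.prod volume)) :
    Integrable fun x => ∫ y, F y x :=
  hF.integral_prod_right

lemma integrable_conv_left {u f : (Fin d → ℝ) → ℂ} (hu : Integrable u) (hf : Integrable f) :
    Integrable fun x => ∫ y, u y * f (x - y) :=
  integrable_integral_uncurry (integrable_uncurry_mul_sub hu hf)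

lemma integral_norm_conv_left_le {u f : (Fin d → ℝ) → ℂ} (hu : Integrable u)
    (hf : Integrable f) :
    ∫ x, ‖∫ y, u y * f (x - y)‖ ≤ (∫ y, ‖u y‖) * ∫ x, ‖f x‖ := by
  have hI := integrable_uncurry_mul_sub hu hf
  calc ∫ x, ‖∫ y, u y * f (x - y)‖ ≤ ∫ x, ∫ y, ‖u y * f (x - y)‖ :=
        integral_mono (integrable_conv_left hu hf).norm hI.norm.integral_prod_right
          fun x => norm_integral_le_integral_norm _
    _ = ∫ y, ∫ x, ‖u y * f (x - y)‖ := (integral_integral_swap hI.norm).symm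
    _ = (∫ y, ‖u y‖) * ∫ x, ‖f x‖ := by
        simp only [norm_mul, integral_const_mul]
        simp only [integral_sub_right_eq_self (fun x => ‖f x‖), integral_mul_const]

end ConjugatePairs

section Differences

variable {d : ℕ}

/-- `f` has an integrable conjugate of norm at most `B`. -/
def HasConjLE (i : Fin d) (f : (Fin d → ℝ) → ℂ) (B : ℝ) : Prop :=
  ∃ g : (Fin d → ℝ) → ℂ, Integrable g ∧ IsPair i f g ∧ ∫ x, ‖g x‖ ≤ B

lemma exists_hasConjLE_of_hasRiesz {f : (Fin d → ℝ) → ℂ} (hf : Integrable f)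
    {g : (Fin d → ℝ) → Fin d → ℂ} (hg : Integrable g) (h : HasRiesz f g) (i : Fin d) :
    HasConjLE i f ((poissonMass d)⁻¹ * (rieszConst d)⁻¹ * ∫ x, ‖g x‖) := by
  have hC : (rieszConst d : ℂ) ≠ 0 := Complex.ofReal_ne_zero.2 rieszConst_pos.ne'
  have hgi : Integrable fun x => g x i := hg.eval i
  have hp := isPair_of_tendsto i hf (hgi.const_mul (rieszConst d : ℂ)⁻¹)
    (((hasRiesz_iff hf g).1 h i).mono fun x hx => by
      simpa only [inv_mul_cancel_left₀ hC] using hx.const_mul (rieszConst d : ℂ)⁻¹)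
  refine ⟨_, (hgi.const_mul _).const_mul _, hp, ?_⟩
  simp only [norm_mul, norm_inv, Complex.norm_real, Real.norm_of_nonneg poissonMass_pos.le,
    Real.norm_of_nonneg rieszConst_pos.le]
  rw [integral_const_mul, integral_const_mul, ← mul_assoc]
  refine mul_le_mul_of_nonneg_left
    (integral_mono hgi.norm hg.norm fun x => norm_le_pi_norm (g x) i) ?_
  exact mul_nonneg (inv_nonneg.2 poissonMass_pos.le) (inv_nonneg.2 rieszConst_pos.le)

lemma HasConjLE.mono {i : Fin d} {f : (Fin d → ℝ) → ℂ} {B B' : ℝ} (h : HasConjLE i f B)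
    (hB : B ≤ B') : HasConjLE i f B' := by
  obtain ⟨g, hg, hp, hn⟩ := h
  exact ⟨g, hg, hp, hn.trans hB⟩

lemma HasConjLE.diff_add {i : Fin d} {f : (Fin d → ℝ) → ℂ} (hf : Integrable f)
    {y y' : Fin d → ℝ} {B B' : ℝ} (h : HasConjLE i (fun x => f x - f (x - y)) B)
    (h' : HasConjLE i (fun x => f x - f (x - y')) B') :
    HasConjLE i (fun x => f x - f (x - (y + y'))) (B + B') := by
  obtain ⟨g, hg, hp, hn⟩ := h
  obtain ⟨g', hg', hp', hn'⟩ := h'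
  refine ⟨fun x => g x + g' (x - y), hg.add (hg'.comp_sub_right y),
    (hp.add (hp'.comp_sub_right y) (hf.sub (hf.comp_sub_right y))
      ((hf.sub (hf.comp_sub_right y')).comp_sub_right y) hg (hg'.comp_sub_right y)).congr_ae
      (ae_of_all _ fun x => ?_) ae_eq_rfl, ?_⟩
  · simp only [sub_sub]; ring
  · calc ∫ x, ‖g x + g' (x - y)‖ ≤ ∫ x, (‖g x‖ + ‖g' (x - y)‖) :=
          integral_mono (hg.add (hg'.comp_sub_right y)).norm
            (hg.norm.add (hg'.comp_sub_right y).norm) fun x => norm_add_le _ _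
      _ = (∫ x, ‖g x‖) + ∫ x, ‖g' x‖ := by
          rw [integral_add hg.norm (hg'.comp_sub_right y).norm,
            integral_sub_right_eq_self (fun x => ‖g' x‖)]
      _ ≤ B + B' := add_le_add hn hn'

lemma HasConjLE.diff_nsmul {i : Fin d} {f : (Fin d → ℝ) → ℂ} (hf : Integrable f)
    {y : Fin d → ℝ} {B : ℝ} (h : HasConjLE i (fun x => f x - f (x - y)) B) (n : ℕ) :
    HasConjLE i (fun x => f x - f (x - n • y)) (n * B) := by
  induction n with
  | zero => exact ⟨fun _ => 0, integrable_zero _ _ _, fun ε _ x => by simp [qConv, pConv],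
      by simp⟩
  | succ n ih =>
    have := HasConjLE.diff_add hf ih h
    rw [succ_nsmul]
    exact this.mono (by push_cast; linarith)

lemma eucNorm_smul (r : ℝ) (x : Fin d → ℝ) : eucNorm (r • x) = |r| * eucNorm x := by
  simp only [eucNorm, Pi.smul_apply, smul_eq_mul, mul_pow, ← Finset.mul_sum]
  rw [Real.sqrt_mul (sq_nonneg r), Real.sqrt_sq_eq_abs]

lemma hasConjLE_diff {i : Fin d} {f : (Fin d → ℝ) → ℂ} (hf : Integrable f) {B : ℝ}
    (hB : 0 ≤ B)
    (h : ∀ y : Fin d → ℝ, eucNorm y ≤ 1 → HasConjLE i (fun x => f x - f (x - y)) B)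
    (y : Fin d → ℝ) : HasConjLE i (fun x => f x - f (x - y)) ((eucNorm y + 1) * B) := by
  have hy := eucNorm_nonneg y
  set n : ℕ := ⌊eucNorm y⌋₊ + 1
  have hn : eucNorm y < n := by exact_mod_cast Nat.lt_floor_add_one (eucNorm y)
  have hn0 : (0 : ℝ) < n := hy.trans_lt hn
  have h1 := HasConjLE.diff_nsmul hf (h ((n : ℝ)⁻¹ • y) (by
    rw [eucNorm_smul, abs_of_pos (inv_pos.2 hn0), inv_mul_le_iff₀ hn0]; linarith)) n
  rw [← Nat.cast_smul_eq_nsmul ℝ, smul_smul, mul_inv_cancel₀ hn0.ne', one_smul] at h1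
  refine h1.mono (mul_le_mul_of_nonneg_right ?_ hB)
  have := Nat.floor_le hy
  simp only [n, Nat.cast_add, Nat.cast_one]
  linarith

/-- The conjugates of the differences `f - f (· - y)` can be chosen jointly measurably. -/
lemma exists_measurable_conj {i : Fin d} {f : (Fin d → ℝ) → ℂ} (hf : Integrable f) {B : ℝ}
    (h : ∀ y : Fin d → ℝ, HasConjLE i (fun x => f x - f (x - y)) ((eucNorm y + 1) * B)) :
    ∃ G : (Fin d → ℝ) → (Fin d → ℝ) → ℂ, StronglyMeasurable (Function.uncurry G) ∧
      ∀ᵐ y, Integrable (G y) ∧ IsPair i (fun x => f x - f (x - y)) (G y) ∧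
        ∫ x, ‖G y x‖ ≤ (eucNorm y + 1) * B := by
  choose g hg hp hn using h
  have hκ : (poissonMass d : ℂ) ≠ 0 := Complex.ofReal_ne_zero.2 poissonMass_pos.ne'
  let ε : ℕ → ℝ := fun n => 1 / ((n : ℝ) + 1)
  have hε : ∀ n, 0 < ε n := fun n => by positivity
  have hεt : Tendsto ε atTop (𝓝[>] 0) :=
    tendsto_nhdsWithin_iff.2 ⟨tendsto_one_div_add_atTop_nhds_zero_nat,
      Eventually.of_forall hε⟩
  let u : ℕ → (Fin d → ℝ) × (Fin d → ℝ) → ℂ := fun n p =>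
    (poissonMass d : ℂ)⁻¹ * (qConv i f (ε n) p.2 - qConv i f (ε n) (p.2 - p.1))
  have hu : ∀ n, Continuous (u n) := fun n => by
    have := continuous_qConv i hf (hε n)
    fun_prop
  have hlim : ∀ y : Fin d → ℝ, ∀ᵐ x, Tendsto (fun n => u n (y, x)) atTop (𝓝 (g y x)) :=
    fun y => by
    filter_upwards [ae_isLebesguePoint (hg y)] with x hx
    have h1 := ((hx.tendsto_pConv (hg y)).comp hεt).const_mul (poissonMass d : ℂ)⁻¹
    rw [inv_mul_cancel_left₀ hκ] at h1
    refine h1.congr fun n => ?_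
    simp only [Function.comp_apply, u]
    rw [← hp y (ε n) (hε n) x, qConv, qConv, qConv, ← integral_sub
      (integrable_mul_conjK (hf.comp_sub_left x) i (hε n))
      (integrable_mul_conjK (hf.comp_sub_left (x - y)) i (hε n))]
    congr 1
    refine integral_congr_ae (ae_of_all _ fun t => ?_)
    simp only [sub_mul, sub_right_comm x t y]
  have hex : ∀ᵐ p ∂((volume : Measure (Fin d → ℝ)).prod (volume : Measure (Fin d → ℝ))),
      ∃ l, Tendsto (fun n => u n p) atTop (𝓝 l) :=
    (Measure.ae_prod_iff_ae_ae (measurableSet_exists_tendsto fun n => (hu n).measurable)).2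
      (ae_of_all _ fun y => (hlim y).mono fun x hx => ⟨_, hx⟩)
  obtain ⟨H, hH, hHt⟩ := exists_stronglyMeasurable_limit_of_tendsto_ae
    (fun n => (hu n).aestronglyMeasurable) hex
  refine ⟨fun y x => H (y, x), hH, ?_⟩
  filter_upwards [Measure.ae_ae_of_ae_prod hHt] with y hy
  have he : g y =ᵐ[volume] fun x => H (y, x) := by
    filter_upwards [hy, hlim y] with x h1 h2
    exact tendsto_nhds_unique h2 h1
  exact ⟨(hg y).congr he, (hp y).congr_ae ae_eq_rfl he,
    (integral_congr_ae (he.fun_comp norm)).ge.trans (hn y)⟩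

/-- If the differences `f - f (· - y)` have conjugates of norm `O(1 + |y|)`, then
`f - φ * f` has an integrable conjugate for every nice `φ` of integral one. -/
lemma exists_conj_sub_conv {i : Fin d} {f φ : (Fin d → ℝ) → ℂ} (hf : Integrable f) {B : ℝ}
    (h : ∀ y : Fin d → ℝ, HasConjLE i (fun x => f x - f (x - y)) ((eucNorm y + 1) * B))
    (hφ : Integrable φ) (hφ' : Integrable fun y => eucNorm y * ‖φ y‖) (hφ1 : ∫ y, φ y = 1) :
    ∃ g, Integrable g ∧ IsPair i (fun x => f x - ∫ y, φ y * f (x - y)) g := by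
  obtain ⟨G, hG, hGy⟩ := exists_measurable_conj hf h
  have hF : Integrable (Function.uncurry fun y x : Fin d → ℝ => φ y * (f x - f (x - y)))
      (volume.prod volume) := by
    refine ((hφ.mul_prod hf).sub (integrable_uncurry_mul_sub hφ hf)).congr
      (ae_of_all _ fun p => ?_)
    simp only [Pi.sub_apply, Function.uncurry]; ring
  have hGm : AEStronglyMeasurable
      (Function.uncurry fun y x : Fin d → ℝ => φ y * G y x) (volume.prod volume) :=
    hφ.aestronglyMeasurable.comp_fst.mul hG.aestronglyMeasurable
  have hGi : Integrable (Function.uncurry fun y x : Fin d → ℝ => φ y * G y x)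
      (volume.prod volume) := by
    refine (integrable_prod_iff hGm).2 ⟨hGy.mono fun y hy => hy.1.const_mul (φ y), ?_⟩
    refine ((hφ'.add hφ.norm).const_mul B).mono' hGm.norm.integral_prod_right'
      (hGy.mono fun y hy => ?_)
    simp only [Function.uncurry_apply_pair, norm_mul, integral_const_mul, norm_norm,
      Pi.add_apply]
    rw [Real.norm_of_nonneg (integral_nonneg fun x => norm_nonneg _)]
    nlinarith [norm_nonneg (φ y), hy.2.2]
  refine ⟨_, integrable_integral_uncurry hGi, (IsPair.integral hF hGi
    (hGy.mono fun y hy => hy.2.1.const_mul (φ y))).congr_ae ?_ ae_eq_rfl⟩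
  have hc := (integrable_uncurry_mul_sub hφ hf).prod_left_ae
  filter_upwards [hc] with x hx
  simp only [Function.uncurry_apply_pair] at hx
  simp only [mul_sub]
  rw [integral_sub (hφ.mul_const _) hx, integral_mul_const, hφ1, one_mul]

end Differences

section BandLimited

variable {d : ℕ}

open scoped FourierTransform SchwartzMap in
/-- There are Schwartz-like functions of integral one with spectrum in a given
neighborhood of the origin. -/
lemma exists_bandLimited {U : Set (Fin d → ℝ)} (hU : U ∈ 𝓝 0) :
    ∃ φ : (Fin d → ℝ) → ℂ, Continuous φ ∧ (∃ C, ∀ x, ‖φ x‖ ≤ C) ∧ Integrable φ ∧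
      Integrable (fun y => eucNorm y * ‖φ y‖) ∧ ∫ y, φ y = 1 ∧ ∀ ξ, ξ ∉ U → fHat φ ξ = 0 := by
  let E := EuclideanSpace ℝ (Fin d)
  have hU' : (WithLp.ofLp : E → Fin d → ℝ) ⁻¹' U ∈ 𝓝 (0 : E) :=
    (PiLp.continuous_ofLp 2 _).continuousAt.preimage_mem_nhds (by simpa using hU)
  obtain ⟨r, hr, hrU⟩ := Metric.mem_nhds_iff.1 hU'
  let χ₀ : ContDiffBump (0 : E) := ⟨r / 2, r, by positivity, by linarith⟩
  have hs : HasCompactSupport fun x : E => (χ₀ x : ℂ) :=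
    χ₀.hasCompactSupport.comp_left (g := Complex.ofReal) Complex.ofReal_zero
  let χ : 𝓢(E, ℂ) := hs.toSchwartzMap (Complex.ofRealCLM.contDiff.comp χ₀.contDiff)
  let Φ : 𝓢(E, ℂ) := 𝓕⁻ χ
  have hΦ : 𝓕 Φ = χ := FourierTransform.fourier_fourierInv_eq χ
  have hmp := PiLp.volume_preserving_toLp (Fin d)
  have hme : MeasurableEmbedding (WithLp.toLp 2 : (Fin d → ℝ) → E) :=
    (MeasurableEquiv.toLp 2 (Fin d → ℝ)).measurableEmbedding
  have hhat : ∀ ξ, fHat (fun x => Φ (WithLp.toLp 2 x)) ξ = χ₀ (WithLp.toLp 2 ξ) := fun ξ => by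
    have h1 : 𝓕 (Φ : E → ℂ) (WithLp.toLp 2 ξ) = χ (WithLp.toLp 2 ξ) := by
      rw [← SchwartzMap.fourier_coe, hΦ]
    rw [Real.fourier_eq', ← hmp.integral_comp hme] at h1
    rw [fHat]
    refine Eq.trans (integral_congr_ae (ae_of_all _ fun x => ?_)) h1
    simp only [wave, smul_eq_mul]
    rw [mul_comm]
    congr 4
    rw [EuclideanSpace.inner_toLp_toLp]
    simp [dotP, dotProduct]
  have hnorm : ∀ x : Fin d → ℝ, ‖(WithLp.toLp 2 x : E)‖ = eucNorm x := fun x => by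
    simp [EuclideanSpace.norm_eq, eucNorm]
  refine ⟨fun x => Φ (WithLp.toLp 2 x), Φ.continuous.comp (PiLp.continuous_toLp 2 _),
    ⟨_, fun x => Φ.norm_le_seminorm ℝ _⟩, (hmp.integrable_comp_emb hme).2 Φ.integrable, ?_, ?_,
    fun ξ hξ => ?_⟩
  · have := (hmp.integrable_comp_emb hme).2 (Φ.integrable_pow_mul volume 1)
    simpa only [Function.comp_def, pow_one, hnorm] using this
  · have := hhat 0
    rw [WithLp.toLp_zero, χ₀.one_of_mem_closedBall (Metric.mem_closedBall_self χ₀.rIn_pos.le)]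
      at this
    simpa [fHat, wave, dotP] using this
  · rw [hhat, χ₀.zero_of_le_dist, Complex.ofReal_zero]
    by_contra! h
    exact hξ (hrU (Metric.mem_ball.2 h))

end BandLimited

section FourierSeries

attribute [local instance] instMeasureSpaceUnitAddCircle
  instIsProbabilityMeasureUnitAddCircleVolume

variable {d : ℕ}

lemma centeredCube_ae_eq_Ioc : centeredCube d =ᵐ[volume]
    {x : Fin d → ℝ | ∀ i, x i ∈ Ioc (-(1 / 2) : ℝ) (-(1 / 2) + 1)} := by
  have h1 : centeredCube d =ᵐ[volume] Icc (fun _ => (-(1 / 2) : ℝ)) fun _ => 1 / 2 :=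
    Measure.univ_pi_Ioo_ae_eq_Icc
  have h2 : (univ.pi fun _ : Fin d => Ioc (-(1 / 2) : ℝ) (1 / 2)) =ᵐ[volume]
      Icc (fun _ => (-(1 / 2) : ℝ)) fun _ => 1 / 2 :=
    Measure.univ_pi_Ioc_ae_eq_Icc
  refine (h1.trans h2.symm).trans (Eq.eventuallyEq ?_)
  ext x
  change x ∈ univ.pi _ ↔ x ∈ {x : Fin d → ℝ | _}
  norm_num [Set.mem_pi]

lemma measurableSet_centeredCube : MeasurableSet (centeredCube d) :=
  MeasurableSet.univ_pi fun _ => measurableSet_Ioo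

instance : IsFiniteMeasure (volume.restrict (centeredCube d)) :=
  ⟨by rw [Measure.restrict_apply_univ, centeredCube, volume_pi_pi]
      exact ENNReal.prod_lt_top fun _ _ => by simp⟩

lemma mFourier_eq_wave (n : Fin d → ℤ) (x : Fin d → ℝ) :
    UnitAddTorus.mFourier n (fun i => (x i : UnitAddCircle)) = wave x (intVec n) := by
  simp only [UnitAddTorus.mFourier, ContinuousMap.coe_mk, fourier_coe_apply, wave, dotP, intVec,
    ← Complex.exp_sum]
  congr 1
  push_cast
  rw [Finset.mul_sum, Finset.sum_mul]
  exact Finset.sum_congr rfl fun i _ => by ring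

lemma setIntegral_wave_intVec (n : Fin d → ℤ) :
    ∫ ξ in centeredCube d, wave ξ (intVec n) = if n = 0 then 1 else 0 := by
  have h := orthonormal_iff_ite.1 (UnitAddTorus.orthonormal_mFourier (d := Fin d)) 0 n
  rw [ContinuousMap.inner_toLp, UnitAddTorus.integral_preimage _ fun _ => -(1 / 2)] at h
  rw [setIntegral_congr_set centeredCube_ae_eq_Ioc]
  simp only [mFourier_eq_wave, UnitAddTorus.mFourier_zero, ContinuousMap.one_apply, map_one,
    mul_one] at h
  rw [h]
  simp only [eq_comm]

/-- A bounded function on the cube with vanishing Fourier coefficients vanishes. -/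
lemma ae_eq_zero_of_fourier_eq_zero {h : (Fin d → ℝ) → ℂ} (hm : Measurable h) {C : ℝ}
    (hC : ∀ ξ, ‖h ξ‖ ≤ C)
    (h0 : ∀ k : Fin d → ℤ, ∫ ξ in centeredCube d, h ξ * wave ξ (intVec k) = 0) :
    ∀ᵐ ξ, ξ ∈ centeredCube d → h ξ = 0 := by
  let a : Fin d → ℝ := fun _ => -(1 / 2)
  let H : UnitAddTorus (Fin d) → ℂ := fun t => h (UnitAddTorus.measurableEquivPiIoc a t).1
  have hHm : Measurable H := hm.comp
    (measurable_subtype_coe.comp (UnitAddTorus.measurableEquivPiIoc a).measurable)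
  have hH : ∀ x : Fin d → ℝ, (∀ i, x i ∈ Ioc (-(1 / 2) : ℝ) (-(1 / 2) + 1)) →
      H (fun i => (x i : UnitAddCircle)) = h x := fun x hx => by
    have := (UnitAddTorus.measurableEquivPiIoc a).apply_symm_apply ⟨x, hx⟩
    rw [UnitAddTorus.coe_symm_measurableEquivPiIoc_apply] at this
    simp only [H]
    rw [this]
  have hHL : MemLp H 2 volume := MemLp.of_bound hHm.aestronglyMeasurable C
    (ae_of_all _ fun t => hC _)
  have hms : MeasurableSet {x : Fin d → ℝ | ∀ i, x i ∈ Ioc (-(1 / 2) : ℝ) (-(1 / 2) + 1)} :=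
    MeasurableSet.univ_pi' fun i => measurableSet_Ioc
  have hcoef : ∀ n, UnitAddTorus.mFourierCoeff (hHL.toLp H) n = 0 := fun n => by
    have e1 : UnitAddTorus.mFourierCoeff (hHL.toLp H) n = UnitAddTorus.mFourierCoeff H n :=
      integral_congr_ae (hHL.coeFn_toLp.mono fun t ht => by beta_reduce; rw [ht])
    rw [e1, UnitAddTorus.mFourierCoeff_eq_integral H n fun _ => -(1 / 2),
      ← h0 (-n), setIntegral_congr_set (centeredCube_ae_eq_Ioc (d := d))]
    refine setIntegral_congr_fun hms fun x hx => ?_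
    simp only [mFourier_eq_wave, hH x hx, smul_eq_mul, mul_comm]
  have hz : hHL.toLp H = 0 := by
    have := UnitAddTorus.hasSum_mFourier_series_L2 (hHL.toLp H)
    simp only [hcoef, zero_smul] at this
    exact this.unique hasSum_zero
  have hae : H =ᵐ[volume] 0 := hHL.coeFn_toLp.symm.trans
    (Lp.eq_zero_iff_ae_eq_zero.1 hz)
  have hl : ∫⁻ t, ‖H t‖ₑ = 0 := by
    rw [lintegral_eq_zero_iff hHm.enorm]
    exact hae.mono fun t ht => by simp [ht]
  rw [UnitAddTorus.lintegral_preimage _ fun _ => -(1 / 2),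
    setLIntegral_congr_fun hms fun x hx => by rw [hH x hx],
    ← setLIntegral_congr centeredCube_ae_eq_Ioc,
    lintegral_eq_zero_iff hm.enorm] at hl
  exact ((ae_restrict_iff' measurableSet_centeredCube).1 hl).mono fun ξ h1 h2 => by
    simpa using h1 h2

end FourierSeries

section DiscreteKernel

variable {d : ℕ}

/-- The Fourier series `Σ_k s_k e^{-2πi ξ k}`. -/
def latticeSum (s : (Fin d → ℤ) → ℂ) (ξ : Fin d → ℝ) : ℂ :=
  ∑' k, s k * wave ξ (-intVec k)

lemma norm_mul_wave (a : ℂ) (ξ x : Fin d → ℝ) : ‖a * wave ξ x‖ = ‖a‖ := by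
  rw [norm_mul, norm_wave, mul_one]

lemma continuous_latticeSum {s : (Fin d → ℤ) → ℂ} (hs : Summable fun k => ‖s k‖) :
    Continuous (latticeSum s) := by
  refine continuous_tsum (fun k => ?_) hs fun _ ξ => (norm_mul_wave _ _ _).le
  have : Continuous fun ξ : Fin d → ℝ => wave ξ (-intVec k) := by
    unfold wave dotP; fun_prop
  fun_prop

lemma norm_latticeSum_le {s : (Fin d → ℤ) → ℂ} (hs : Summable fun k => ‖s k‖)
    (ξ : Fin d → ℝ) : ‖latticeSum s ξ‖ ≤ ∑' k, ‖s k‖ :=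
  tsum_of_norm_bounded hs.hasSum fun _ => (norm_mul_wave _ _ _).le

lemma setIntegral_latticeSum_mul {s : (Fin d → ℤ) → ℂ} (hs : Summable fun k => ‖s k‖)
    {m : (Fin d → ℝ) → ℂ} (hm : Integrable m (volume.restrict (centeredCube d))) :
    ∫ ξ in centeredCube d, latticeSum s ξ * m ξ =
      ∑' k, s k * ∫ ξ in centeredCube d, wave ξ (-intVec k) * m ξ := by
  have hw : ∀ k : Fin d → ℤ, Continuous fun ξ : Fin d → ℝ => wave ξ (-intVec k) := fun k => by
    unfold wave dotP; fun_prop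
  have hi : ∀ k : Fin d → ℤ, Integrable (fun ξ => s k * (wave ξ (-intVec k) * m ξ))
      (volume.restrict (centeredCube d)) := fun k =>
    (hm.bdd_mul (hw k).aestronglyMeasurable (ae_of_all _ fun ξ => (norm_wave _ _).le)).const_mul _
  simp only [← integral_const_mul]
  rw [integral_tsum_of_summable_integral_norm hi]
  · simp only [latticeSum, ← tsum_mul_right, mul_assoc]
  · refine (hs.mul_right (∫ ξ in centeredCube d, ‖m ξ‖)).congr fun k => ?_
    simp only [norm_mul, norm_wave, one_mul, integral_const_mul]

lemma IsCutoff.exists_bound {ν : (Fin d → ℝ) → ℝ} (hν : IsCutoff d ν) :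
    ∃ C, ∀ ξ, |ν ξ| ≤ C := by
  have hb : Bornology.IsBounded (centeredCube d) :=
    Bornology.IsBounded.pi fun _ => Metric.isBounded_Ioo _ _
  exact hν.smooth.continuous.bounded_above_of_compact_support
    (Metric.isCompact_of_isClosed_isBounded (isClosed_tsupport ν) (hb.subset hν.supp))

lemma measurable_zetaFn (b : Matrix (Fin d) (Fin d) ℝ) {ν : (Fin d → ℝ) → ℝ}
    (hν : IsCutoff d ν) (i : Fin d) : Measurable fun ξ => zetaFn b ν ξ i := by
  have h1 : Continuous fun ξ : Fin d → ℝ => ξ ᵥ* b⁻¹ := continuous_id.matrix_vecMul continuous_const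
  have h2 : Measurable fun ξ : Fin d → ℝ => (ξ ᵥ* b⁻¹) i :=
    ((continuous_apply i).comp h1).measurable
  have h3 : Measurable fun ξ : Fin d → ℝ => eucNorm (ξ ᵥ* b⁻¹) :=
    (continuous_eucNorm.comp h1).measurable
  have h4 := hν.smooth.continuous.measurable
  unfold zetaFn
  fun_prop

lemma norm_zetaFn_le (b : Matrix (Fin d) (Fin d) ℝ) {ν : (Fin d → ℝ) → ℝ} {C : ℝ}
    (hC : ∀ ξ, |ν ξ| ≤ C) (i : Fin d) (ξ : Fin d → ℝ) : ‖zetaFn b ν ξ i‖ ≤ C := by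
  simp only [zetaFn, norm_mul, norm_neg, Complex.norm_I, one_mul, Complex.norm_real,
    Real.norm_eq_abs]
  calc _ ≤ 1 * |ν ξ| := mul_le_mul_of_nonneg_right (abs_div_eucNorm_le _ i) (abs_nonneg _)
    _ ≤ C := by rw [one_mul]; exact hC ξ

lemma integrable_zetaFn (b : Matrix (Fin d) (Fin d) ℝ) {ν : (Fin d → ℝ) → ℝ}
    (hν : IsCutoff d ν) (i : Fin d) :
    Integrable (fun ξ => zetaFn b ν ξ i) (volume.restrict (centeredCube d)) := by
  obtain ⟨C, hC⟩ := hν.exists_bound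
  exact Integrable.of_bound (measurable_zetaFn b hν i).aestronglyMeasurable C
    (ae_of_all _ (norm_zetaFn_le b hC i))

lemma continuous_wave_left (y : Fin d → ℝ) : Continuous fun ξ : Fin d → ℝ => wave ξ y := by
  unfold wave dotP; fun_prop

lemma zKernel_apply (b : Matrix (Fin d) (Fin d) ℝ) {ν : (Fin d → ℝ) → ℝ}
    (hν : IsCutoff d ν) (k : Fin d → ℤ) (i : Fin d) :
    zKernel b ν k i = ∫ ξ in centeredCube d, wave ξ (intVec k) * zetaFn b ν ξ i := by
  rw [zKernel, eval_integral]
  · rfl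
  · exact fun j => (integrable_zetaFn b hν j).bdd_mul
      (continuous_wave_left (intVec k)).aestronglyMeasurable
      (ae_of_all _ fun ξ => (norm_wave _ _).le)

lemma exists_norm_zKernel_le (b : Matrix (Fin d) (Fin d) ℝ) {ν : (Fin d → ℝ) → ℝ}
    (hν : IsCutoff d ν) : ∃ C, ∀ k, ‖zKernel b ν k‖ ≤ C := by
  refine ⟨∑ i, ∫ ξ in centeredCube d, ‖zetaFn b ν ξ i‖, fun k => ?_⟩
  refine (pi_norm_le_iff_of_nonneg (Finset.sum_nonneg fun i _ =>
    integral_nonneg fun ξ => norm_nonneg _)).2 fun i => ?_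
  rw [zKernel_apply b hν]
  refine (norm_integral_le_integral_norm _).trans ?_
  simp only [norm_mul, norm_wave, one_mul]
  exact Finset.single_le_sum (f := fun i => ∫ ξ in centeredCube d, ‖zetaFn b ν ξ i‖)
    (fun i _ => integral_nonneg fun ξ => norm_nonneg _) (Finset.mem_univ i)

lemma dConv_apply (b : Matrix (Fin d) (Fin d) ℝ) {ν : (Fin d → ℝ) → ℝ}
    (hν : IsCutoff d ν) {s : (Fin d → ℤ) → ℂ} (hs : Summable fun k => ‖s k‖)
    (k : Fin d → ℤ) (i : Fin d) :
    dConv s (zKernel b ν) k i = ∑' l, s l * zKernel b ν (k - l) i := by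
  obtain ⟨C, hC⟩ := exists_norm_zKernel_le b hν
  have hs' : Summable fun l => ‖s (k - l)‖ := (Equiv.subLeft k).summable_iff.2 hs
  have hsum : Summable fun l => s (k - l) • zKernel b ν l :=
    Summable.of_norm_bounded (hs'.mul_right C) fun l => by
      rw [norm_smul]; exact mul_le_mul_of_nonneg_left (hC l) (norm_nonneg _)
  rw [dConv, tsum_apply hsum, ← (Equiv.subLeft k).tsum_eq]
  simp

lemma wave_intVec_sub (ξ : Fin d → ℝ) (k l : Fin d → ℤ) :
    wave ξ (-intVec l) * wave ξ (intVec k) = wave ξ (intVec (k - l)) := by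
  rw [← wave_add]
  congr 1
  ext i
  simp only [intVec, Pi.add_apply, Pi.neg_apply, Pi.sub_apply]
  push_cast; ring

/-- The convolution theorem for the discrete Riesz kernel. -/
lemma latticeSum_dConv (b : Matrix (Fin d) (Fin d) ℝ) {ν : (Fin d → ℝ) → ℝ}
    (hν : IsCutoff d ν) {s : (Fin d → ℤ) → ℂ} (hs : Summable fun k => ‖s k‖) (i : Fin d)
    (he : Summable fun k => ‖dConv s (zKernel b ν) k i‖) :
    ∀ᵐ ξ, ξ ∈ centeredCube d → latticeSum (fun k => dConv s (zKernel b ν) k i) ξ =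
      latticeSum s ξ * zetaFn b ν ξ i := by
  obtain ⟨C, hC⟩ := hν.exists_bound
  have hζm := measurable_zetaFn b hν i
  have hcs := continuous_latticeSum hs
  have hce := continuous_latticeSum he
  have key := ae_eq_zero_of_fourier_eq_zero (h := fun ξ =>
    latticeSum (fun k => dConv s (zKernel b ν) k i) ξ - latticeSum s ξ * zetaFn b ν ξ i)
    (hce.measurable.sub (hcs.measurable.mul hζm))
    (C := (∑' k, ‖dConv s (zKernel b ν) k i‖) + (∑' k, ‖s k‖) * C) (fun ξ => ?_) fun k => ?_
  · exact key.mono fun ξ h hξ => sub_eq_zero.1 (h hξ)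
  · refine (norm_sub_le _ _).trans (add_le_add (norm_latticeSum_le he ξ) ?_)
    rw [norm_mul]
    exact mul_le_mul (norm_latticeSum_le hs ξ) (norm_zetaFn_le b hC i ξ) (norm_nonneg _)
      (tsum_nonneg fun k => norm_nonneg _)
  · have hw := (continuous_wave_left (intVec k)).aestronglyMeasurable
      (μ := volume.restrict (centeredCube d))
    have hwi : Integrable (fun ξ => wave ξ (intVec k)) (volume.restrict (centeredCube d)) :=
      Integrable.of_bound hw 1 (ae_of_all _ fun ξ => (norm_wave _ _).le)
    have hzw : Integrable (fun ξ => wave ξ (intVec k) * zetaFn b ν ξ i)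
        (volume.restrict (centeredCube d)) :=
      (integrable_zetaFn b hν i).bdd_mul hw (ae_of_all _ fun ξ => (norm_wave _ _).le)
    have e1 := setIntegral_latticeSum_mul he hwi
    have e2 := setIntegral_latticeSum_mul hs hzw
    simp only [wave_intVec_sub, setIntegral_wave_intVec, ← mul_assoc, sub_eq_zero, mul_ite,
      mul_one, mul_zero] at e1 e2
    rw [tsum_eq_single k fun l hl => if_neg hl.symm, if_pos rfl] at e1
    simp only [← zKernel_apply b hν, ← dConv_apply b hν hs] at e2
    simp only [sub_mul]
    rw [integral_sub]
    · rw [e1, sub_eq_zero, ← e2]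
      exact integral_congr_ae (ae_of_all _ fun ξ => by beta_reduce; ring)
    · exact hwi.bdd_mul hce.aestronglyMeasurable (ae_of_all _ (norm_latticeSum_le he))
    · refine (hzw.bdd_mul hcs.aestronglyMeasurable (ae_of_all _ (norm_latticeSum_le hs))).congr
        (ae_of_all _ fun ξ => by beta_reduce; ring)

end DiscreteKernel

section LatticeSynthesis

variable {d : ℕ}

/-- The lattice synthesis `Σ_k s_k f(x - bk)`. -/
def latticeSynth (b : Matrix (Fin d) (Fin d) ℝ) (f : (Fin d → ℝ) → ℂ)
    (s : (Fin d → ℤ) → ℂ) (x : Fin d → ℝ) : ℂ :=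
  ∑' k, s k * f (x - b *ᵥ intVec k)

lemma integrable_latticeTerm (b : Matrix (Fin d) (Fin d) ℝ) {f : (Fin d → ℝ) → ℂ}
    (hf : Integrable f) (s : (Fin d → ℤ) → ℂ) (k : Fin d → ℤ) :
    Integrable fun x : Fin d → ℝ => s k * f (x - b *ᵥ intVec k) :=
  (hf.comp_sub_right _).const_mul _

lemma integral_norm_latticeTerm (b : Matrix (Fin d) (Fin d) ℝ) (f : (Fin d → ℝ) → ℂ)
    (s : (Fin d → ℤ) → ℂ) (k : Fin d → ℤ) :
    ∫ x : Fin d → ℝ, ‖s k * f (x - b *ᵥ intVec k)‖ = ‖s k‖ * ∫ x, ‖f x‖ := by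
  simp only [norm_mul, integral_const_mul]
  rw [integral_sub_right_eq_self (fun x => ‖f x‖)]

lemma summable_integral_norm_latticeTerm (b : Matrix (Fin d) (Fin d) ℝ)
    (f : (Fin d → ℝ) → ℂ) {s : (Fin d → ℤ) → ℂ} (hs : Summable fun k => ‖s k‖) :
    Summable fun k => ∫ x : Fin d → ℝ, ‖s k * f (x - b *ᵥ intVec k)‖ := by
  simp only [integral_norm_latticeTerm]
  exact hs.mul_right _

/-- Absolutely convergent series in `L¹` have integrable sums, with the obvious bound. -/
lemma integrable_tsum_and_norm_le {ι : Type*} [Countable ι] {F : ι → (Fin d → ℝ) → ℂ}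
    (hF : ∀ n, Integrable (F n)) (hs : Summable fun n => ∫ x, ‖F n x‖) :
    Integrable (fun x => ∑' n, F n x) ∧ ∫ x, ‖∑' n, F n x‖ ≤ ∑' n, ∫ x, ‖F n x‖ := by
  have hb : ∑' n, ∫⁻ x, ‖F n x‖ₑ ≠ ⊤ := by
    have : ∀ n, ∫⁻ x, ‖F n x‖ₑ = ENNReal.ofReal (∫ x, ‖F n x‖) := fun n => by
      rw [ofReal_integral_norm_eq_lintegral_enorm (hF n)]
    simp only [this]
    exact hs.tsum_ofReal_ne_top
  have hm : AEStronglyMeasurable (fun x => ∑' n, F n x) :=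
    AEStronglyMeasurable.tsum fun n => (hF n).aestronglyMeasurable
  have hle : ∫⁻ x, ‖∑' n, F n x‖ₑ ≤ ∑' n, ∫⁻ x, ‖F n x‖ₑ := by
    rw [← lintegral_tsum fun n => (hF n).aestronglyMeasurable.enorm]
    exact lintegral_mono fun x => enorm_tsum_le_tsum_enorm
  have hi : Integrable fun x => ∑' n, F n x := ⟨hm, hle.trans_lt hb.lt_top⟩
  refine ⟨hi, ?_⟩
  rw [integral_norm_eq_lintegral_enorm hm]
  refine (ENNReal.toReal_mono hb hle).trans_eq ?_
  rw [ENNReal.tsum_toReal_eq fun n => (hF n).2.ne]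
  exact tsum_congr fun n => (integral_norm_eq_lintegral_enorm (hF n).aestronglyMeasurable).symm

lemma integrable_latticeSynth (b : Matrix (Fin d) (Fin d) ℝ) {f : (Fin d → ℝ) → ℂ}
    (hf : Integrable f) {s : (Fin d → ℤ) → ℂ} (hs : Summable fun k => ‖s k‖) :
    Integrable (latticeSynth b f s) :=
  (integrable_tsum_and_norm_le (integrable_latticeTerm b hf s)
    (summable_integral_norm_latticeTerm b f hs)).1

lemma integral_norm_latticeSynth_le (b : Matrix (Fin d) (Fin d) ℝ) {f : (Fin d → ℝ) → ℂ}
    (hf : Integrable f) {s : (Fin d → ℤ) → ℂ} (hs : Summable fun k => ‖s k‖) :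
    ∫ x, ‖latticeSynth b f s x‖ ≤ (∑' k, ‖s k‖) * ∫ x, ‖f x‖ := by
  refine (integrable_tsum_and_norm_le (integrable_latticeTerm b hf s)
    (summable_integral_norm_latticeTerm b f hs)).2.trans_eq ?_
  simp only [integral_norm_latticeTerm, tsum_mul_right]

lemma IsPair.latticeSynth {i : Fin d} {f g : (Fin d → ℝ) → ℂ} (h : IsPair i f g)
    (b : Matrix (Fin d) (Fin d) ℝ) (hf : Integrable f) (hg : Integrable g)
    {s : (Fin d → ℤ) → ℂ} (hs : Summable fun k => ‖s k‖) :
    IsPair i (latticeSynth b f s) (latticeSynth b g s) :=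
  IsPair.tsum (integrable_latticeTerm b hf s) (integrable_latticeTerm b hg s)
    (summable_integral_norm_latticeTerm b f hs) (summable_integral_norm_latticeTerm b g hs)
    fun k => (h.comp_sub_right _).const_mul (s k)

lemma wave_neg_mulVec (b : Matrix (Fin d) (Fin d) ℝ) (ξ x : Fin d → ℝ) :
    wave ξ (-(b *ᵥ x)) = wave (ξ ᵥ* b) (-x) := by
  have : dotP ξ (b *ᵥ x) = dotP (ξ ᵥ* b) x := dotProduct_mulVec ξ b x
  rw [wave_neg, wave_neg, wave, wave, this]

lemma fHat_latticeSynth (b : Matrix (Fin d) (Fin d) ℝ) {f : (Fin d → ℝ) → ℂ}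
    (hf : Integrable f) {s : (Fin d → ℤ) → ℂ} (hs : Summable fun k => ‖s k‖)
    (ξ : Fin d → ℝ) :
    fHat (latticeSynth b f s) ξ = fHat f ξ * latticeSum s (ξ ᵥ* b) := by
  have hw : AEStronglyMeasurable (fun x : Fin d → ℝ => wave ξ (-x)) := by
    refine Continuous.aestronglyMeasurable ?_
    unfold wave dotP; fun_prop
  have hi : ∀ k, Integrable fun x : Fin d → ℝ => s k * f (x - b *ᵥ intVec k) * wave ξ (-x) :=
    fun k => (integrable_latticeTerm b hf s k).mul_bdd (c := 1) hw
      (ae_of_all _ fun x => (norm_wave _ _).le)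
  rw [fHat]
  simp only [latticeSynth, ← tsum_mul_right]
  rw [← integral_tsum_of_summable_integral_norm hi]
  · rw [latticeSum, ← tsum_mul_left]
    refine tsum_congr fun k => ?_
    rw [← wave_neg_mulVec, ← integral_add_right_eq_self _ (b *ᵥ intVec k), fHat,
      ← integral_mul_const]
    refine integral_congr_ae (ae_of_all _ fun x => ?_)
    simp only [add_sub_cancel_right, neg_add, wave_add]
    ring
  · simp only [norm_mul_wave]
    exact summable_integral_norm_latticeTerm b f hs

lemma ae_comp_vecMul {b : Matrix (Fin d) (Fin d) ℝ} (hb : b.det ≠ 0)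
    {p : (Fin d → ℝ) → Prop} (h : ∀ᵐ ξ, p ξ) : ∀ᵐ ξ, p (ξ ᵥ* b) := by
  have := Measure.LinearMap.quasiMeasurePreserving
    (volume : Measure (Fin d → ℝ)) (Matrix.toLin' bᵀ)
    (by rwa [LinearMap.det_toLin', det_transpose])
  simpa only [Matrix.toLin'_apply, mulVec_transpose] using this.ae h

/-- For a suitable band-limited `φ`, the conjugate of `Σ_k s_k φ(x - bk)` is
`Σ_k (s * z)_k φ(x - bk)`. -/
lemma isPair_latticeSynth_dConv {b : Matrix (Fin d) (Fin d) ℝ} (hb : b.det ≠ 0)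
    {ν : (Fin d → ℝ) → ℝ} (hν : IsCutoff d ν) {φ : (Fin d → ℝ) → ℂ} (hφ : Integrable φ)
    (hsupp : ∀ ξ, ξ ∉ {ξ : Fin d → ℝ | ξ ᵥ* b ∈ centeredCube d ∧ ν (ξ ᵥ* b) = 1} → fHat φ ξ = 0)
    {s : (Fin d → ℤ) → ℂ} (hs : Summable fun k => ‖s k‖) (i : Fin d)
    (he : Summable fun k => ‖dConv s (zKernel b ν) k i‖) :
    IsPair i (latticeSynth b φ s) (latticeSynth b φ fun k => dConv s (zKernel b ν) k i) := by
  refine isPair_of_fHat (integrable_latticeSynth b hφ hs) (integrable_latticeSynth b hφ he) ?_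
  filter_upwards [ae_comp_vecMul hb (latticeSum_dConv b hν hs i he)] with ξ hξ
  rw [fHat_latticeSynth b hφ hs, fHat_latticeSynth b hφ he]
  by_cases h : ξ ᵥ* b ∈ centeredCube d ∧ ν (ξ ᵥ* b) = 1
  · rw [hξ h.1, zetaFn, h.2, vecMul_vecMul, mul_nonsing_inv b (isUnit_iff_ne_zero.2 hb),
      vecMul_one]
    push_cast; ring
  · rw [hsupp ξ h]; ring

lemma bandLimit_mem_nhds (b : Matrix (Fin d) (Fin d) ℝ) {ν : (Fin d → ℝ) → ℝ}
    (hν : IsCutoff d ν) :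
    {ξ : Fin d → ℝ | ξ ᵥ* b ∈ centeredCube d ∧ ν (ξ ᵥ* b) = 1} ∈ 𝓝 0 := by
  have hc : Tendsto (fun ξ : Fin d → ℝ => ξ ᵥ* b) (𝓝 0) (𝓝 0) :=
    Continuous.tendsto' (continuous_id.matrix_vecMul continuous_const) _ _ (zero_vecMul b)
  have hcube : centeredCube d ∈ 𝓝 (0 : Fin d → ℝ) :=
    (isOpen_set_pi finite_univ fun _ _ => isOpen_Ioo).mem_nhds fun i _ => by norm_num
  exact (hc.eventually hcube).and (hc.eventually hν.one_near_zero)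

lemma latticeSynth_conv (b : Matrix (Fin d) (Fin d) ℝ) {f φ : (Fin d → ℝ) → ℂ}
    (hf : Integrable f) (hφ : Continuous φ) {C : ℝ} (hC : ∀ x, ‖φ x‖ ≤ C)
    {s : (Fin d → ℤ) → ℂ} (hs : Summable fun k => ‖s k‖) (x : Fin d → ℝ) :
    latticeSynth b (fun x => ∫ y, φ y * f (x - y)) s x =
      ∫ y, f y * latticeSynth b φ s (x - y) := by
  have hi : ∀ k : Fin d → ℤ, Integrable fun y : Fin d → ℝ =>
      s k * (f y * φ (x - b *ᵥ intVec k - y)) := fun k =>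
    (hf.mul_bdd (c := C) (by fun_prop) (ae_of_all _ fun y => hC _)).const_mul _
  have hswap : ∀ u : Fin d → ℝ, ∫ y, φ y * f (u - y) = ∫ y, f y * φ (u - y) := fun u => by
    rw [← integral_sub_left_eq_self _ _ u]
    simp only [sub_sub_cancel, mul_comm]
  simp only [latticeSynth, hswap, ← integral_const_mul]
  rw [integral_tsum_of_summable_integral_norm hi]
  · refine integral_congr_ae (ae_of_all _ fun y => ?_)
    simp only [← tsum_mul_left, sub_right_comm x _ y]
    exact tsum_congr fun k => by ring
  · refine Summable.of_nonneg_of_le (fun k => integral_nonneg fun y => norm_nonneg _)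
      (fun k => ?_) (hs.mul_right (C * ∫ y, ‖f y‖))
    rw [← integral_const_mul, ← integral_const_mul]
    refine integral_mono (hi k).norm ((hf.norm.const_mul C).const_mul _) fun y => ?_
    simp only [norm_mul]
    rw [mul_comm C]
    gcongr
    exact hC _

end LatticeSynthesis

section HardyBounds

variable {d : ℕ}

/-- `f` is integrable, and `f` and all its conjugates have `L¹` norm at most `B`. -/
structure HardyLE (f : (Fin d → ℝ) → ℂ) (B : ℝ) : Prop where
  integrable : Integrable f
  integral_norm_le : ∫ x, ‖f x‖ ≤ B
  hasConjLE : ∀ i, HasConjLE i f B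

lemma HardyLE.nonneg {f : (Fin d → ℝ) → ℂ} {B : ℝ} (h : HardyLE f B) : 0 ≤ B :=
  (integral_nonneg fun _ => norm_nonneg _).trans h.integral_norm_le

lemma HardyLE.congr_ae {f f' : (Fin d → ℝ) → ℂ} {B : ℝ} (h : HardyLE f B)
    (he : f =ᵐ[volume] f') : HardyLE f' B where
  integrable := h.integrable.congr he
  integral_norm_le := (integral_congr_ae (he.fun_comp norm)).ge.trans h.integral_norm_le
  hasConjLE i := by
    obtain ⟨g, hg, hp, hn⟩ := h.hasConjLE i
    exact ⟨g, hg, hp.congr_ae he ae_eq_rfl, hn⟩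

lemma HardyLE.tsum {ι : Type*} [Countable ι] {F : ι → (Fin d → ℝ) → ℂ} {B : ι → ℝ}
    (h : ∀ n, HardyLE (F n) (B n)) (hB : Summable B) :
    HardyLE (fun x => ∑' n, F n x) (∑' n, B n) := by
  have hs : Summable fun n => ∫ x, ‖F n x‖ := Summable.of_nonneg_of_le
    (fun n => integral_nonneg fun _ => norm_nonneg _) (fun n => (h n).integral_norm_le) hB
  have hF := integrable_tsum_and_norm_le (fun n => (h n).integrable) hs
  refine ⟨hF.1, hF.2.trans (hs.tsum_le_tsum (fun n => (h n).integral_norm_le) hB),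
    fun i => ?_⟩
  choose G hG hp hn using fun n => (h n).hasConjLE i
  have hGs : Summable fun n => ∫ x, ‖G n x‖ := Summable.of_nonneg_of_le
    (fun n => integral_nonneg fun _ => norm_nonneg _) hn hB
  have hG' := integrable_tsum_and_norm_le hG hGs
  exact ⟨_, hG'.1, IsPair.tsum (fun n => (h n).integrable) hG hs hGs hp,
    hG'.2.trans (hGs.tsum_le_tsum hn hB)⟩

lemma HardyLE.dilate {f : (Fin d → ℝ) → ℂ} {B : ℝ} (h : HardyLE f B) {r : ℝ} (hr : r ≠ 0) :
    HardyLE (fun x => ((|r| ^ d : ℝ) : ℂ) * f (r • x)) B := by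
  have key : ∀ g : (Fin d → ℝ) → ℂ, ∫ x, ‖((|r| ^ d : ℝ) : ℂ) * g (r • x)‖ = ∫ x, ‖g x‖ :=
    fun g => by
      simp only [norm_mul, Complex.norm_real, Real.norm_eq_abs, abs_pow, abs_abs]
      rw [integral_const_mul, integral_norm_comp_smul g hr]
  refine ⟨(h.integrable.comp_smul hr).const_mul _, (key f).trans_le h.integral_norm_le,
    fun i => ?_⟩
  obtain ⟨g, hg, hp, hn⟩ := h.hasConjLE i
  refine ⟨_, ((hg.comp_smul hr).const_mul _).const_mul _, (hp.comp_smul hr).const_mul _, ?_⟩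
  have h1 : |(|r| / r)| = 1 := by rw [abs_div, abs_abs, div_self (abs_ne_zero.2 hr)]
  refine le_trans (le_of_eq ?_) hn
  rw [← key g]
  simp only [norm_mul, Complex.norm_real, Real.norm_eq_abs, h1, one_mul]

/-- The constant comparing the Hardy norm with the `L¹` norms of the conjugates. -/
def hardyConst (d : ℕ) : ℝ := 1 + d * (rieszConst d * poissonMass d)

lemma hardyConst_nonneg : 0 ≤ hardyConst d := by
  have := mul_pos (rieszConst_pos (d := d)) (poissonMass_pos (d := d))
  unfold hardyConst
  positivity

lemma HardyLE.exists_hasRiesz {f : (Fin d → ℝ) → ℂ} {B : ℝ} (h : HardyLE f B) :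
    ∃ g : (Fin d → ℝ) → Fin d → ℂ, Integrable g ∧ HasRiesz f g ∧
      ∫ x, ‖g x‖ ≤ d * (rieszConst d * poissonMass d) * B := by
  have hκ := mul_pos (rieszConst_pos (d := d)) (poissonMass_pos (d := d))
  choose G hG hp hn using h.hasConjLE
  have hi : Integrable fun (x : Fin d → ℝ) (i : Fin d) =>
      ((rieszConst d * poissonMass d : ℝ) : ℂ) * G i x :=
    Integrable.of_eval fun i => (hG i).const_mul _
  refine ⟨_, hi, IsPair.hasRiesz h.integrable hG hp, ?_⟩
  have hGi : ∀ i ∈ Finset.univ, Integrable fun x => rieszConst d * poissonMass d * ‖G i x‖ :=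
    fun i _ => (hG i).norm.const_mul _
  calc ∫ x, ‖fun i => ((rieszConst d * poissonMass d : ℝ) : ℂ) * G i x‖
      ≤ ∫ x, ∑ i, rieszConst d * poissonMass d * ‖G i x‖ := by
        refine integral_mono hi.norm (integrable_finsetSum _ hGi) fun x => ?_
        have hnn : ∀ i, 0 ≤ rieszConst d * poissonMass d * ‖G i x‖ := fun i => by positivity
        refine (pi_norm_le_iff_of_nonneg (Finset.sum_nonneg fun i _ => hnn i)).2 fun i => ?_
        rw [norm_mul, Complex.norm_real, Real.norm_of_nonneg hκ.le]
        exact Finset.single_le_sum (f := fun i => rieszConst d * poissonMass d * ‖G i x‖)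
          (fun i _ => hnn i) (Finset.mem_univ i)
    _ = ∑ i, rieszConst d * poissonMass d * ∫ x, ‖G i x‖ := by
        rw [integral_finsetSum _ hGi]
        simp only [integral_const_mul]
    _ ≤ ∑ _i : Fin d, rieszConst d * poissonMass d * B :=
        Finset.sum_le_sum fun i _ => mul_le_mul_of_nonneg_left (hn i) hκ.le
    _ = d * (rieszConst d * poissonMass d) * B := by
        rw [Finset.sum_const, Finset.card_univ, Fintype.card_fin, nsmul_eq_mul]; ring

lemma HardyLE.memH1 {f : (Fin d → ℝ) → ℂ} {B : ℝ} (h : HardyLE f B) : MemH1 f := by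
  obtain ⟨g, hg, hr, -⟩ := h.exists_hasRiesz
  exact ⟨h.integrable, g, hg, hr⟩

lemma HardyLE.hardyNorm_le {f : (Fin d → ℝ) → ℂ} {B : ℝ} (h : HardyLE f B) :
    hardyNorm f ≤ ENNReal.ofReal (hardyConst d * B) := by
  obtain ⟨g, hg, hr, hn⟩ := h.exists_hasRiesz
  refine (add_le_add (ENNReal.ofReal_le_ofReal h.integral_norm_le)
    ((sInf_le (by exact ⟨g, hg, hr, rfl⟩)).trans (ENNReal.ofReal_le_ofReal hn))).trans_eq ?_
  rw [← ENNReal.ofReal_add h.nonneg ((integral_nonneg fun _ => norm_nonneg _).trans hn),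
    hardyConst]
  congr 1
  ring

/-- An absolutely convergent series in `L¹` converges absolutely almost everywhere. -/
lemma ae_summable_of_summable_integral_norm {ι : Type*} [Countable ι]
    {F : ι → (Fin d → ℝ) → ℂ} (hF : ∀ n, Integrable (F n))
    (hs : Summable fun n => ∫ x, ‖F n x‖) : ∀ᵐ x, Summable fun n => F n x := by
  have hm : ∀ n, AEMeasurable fun x => ‖F n x‖ₑ := fun n => (hF n).aestronglyMeasurable.enorm
  have hb : ∫⁻ x, ∑' n, ‖F n x‖ₑ ≠ ⊤ := by
    have : ∀ n, ∫⁻ x, ‖F n x‖ₑ = ENNReal.ofReal (∫ x, ‖F n x‖) := fun n => by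
      rw [ofReal_integral_norm_eq_lintegral_enorm (hF n)]
    rw [lintegral_tsum hm]
    simp only [this]
    exact hs.tsum_ofReal_ne_top
  filter_upwards [ae_lt_top' (AEMeasurable.tsum hm) hb] with x hx
  refine Summable.of_norm ?_
  simpa using ENNReal.summable_toReal hx.ne

lemma latticeSynth_add_ae (b : Matrix (Fin d) (Fin d) ℝ) {f f' : (Fin d → ℝ) → ℂ}
    (hf : Integrable f) (hf' : Integrable f') {s : (Fin d → ℤ) → ℂ}
    (hs : Summable fun k => ‖s k‖) :
    (fun x => latticeSynth b f s x + latticeSynth b f' s x) =ᵐ[volume]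
      latticeSynth b (fun x => f x + f' x) s := by
  filter_upwards [ae_summable_of_summable_integral_norm (integrable_latticeTerm b hf s)
    (summable_integral_norm_latticeTerm b f hs),
    ae_summable_of_summable_integral_norm (integrable_latticeTerm b hf' s)
    (summable_integral_norm_latticeTerm b f' hs)] with x hx hx'
  simp only [latticeSynth, mul_add]
  exact (hx.tsum_add hx').symm

lemma summable_norm_of_h1Norm_ne_top {b : Matrix (Fin d) (Fin d) ℝ}
    {ν : (Fin d → ℝ) → ℝ} {s : (Fin d → ℤ) → ℂ} (h : h1Norm b ν s ≠ ⊤) :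
    Summable (fun k => ‖s k‖) ∧ ∑' k, ‖s k‖ ≤ (h1Norm b ν s).toReal := by
  have h1 : ∑' k, (‖s k‖₊ : ℝ≥0∞) ≠ ⊤ := (ENNReal.add_ne_top.1 h).1
  refine ⟨by simpa using ENNReal.summable_toReal h1, ?_⟩
  have := ENNReal.toReal_mono h (le_self_add : _ ≤ h1Norm b ν s)
  rw [ENNReal.tsum_toReal_eq fun k => ENNReal.coe_ne_top] at this
  simpa using this

lemma summable_norm_dConv_of_h1Norm_ne_top {b : Matrix (Fin d) (Fin d) ℝ}
    {ν : (Fin d → ℝ) → ℝ} {s : (Fin d → ℤ) → ℂ} (h : h1Norm b ν s ≠ ⊤) (i : Fin d) :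
    Summable (fun k => ‖dConv s (zKernel b ν) k i‖) ∧
      ∑' k, ‖dConv s (zKernel b ν) k i‖ ≤ (h1Norm b ν s).toReal := by
  have h1 : ∑' k, (‖dConv s (zKernel b ν) k‖₊ : ℝ≥0∞) ≠ ⊤ := (ENNReal.add_ne_top.1 h).2
  have hs : Summable fun k => ‖dConv s (zKernel b ν) k‖ := by
    simpa using ENNReal.summable_toReal h1
  have hle : ∀ k, ‖dConv s (zKernel b ν) k i‖ ≤ ‖dConv s (zKernel b ν) k‖ :=
    fun k => norm_le_pi_norm _ i
  have hsi : Summable fun k => ‖dConv s (zKernel b ν) k i‖ :=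
    Summable.of_nonneg_of_le (fun k => norm_nonneg _) hle hs
  refine ⟨hsi, (hsi.tsum_le_tsum hle hs).trans ?_⟩
  have := ENNReal.toReal_mono h (le_add_self : _ ≤ h1Norm b ν s)
  rw [ENNReal.tsum_toReal_eq fun k => ENNReal.coe_ne_top] at this
  simpa using this

/-- Synthesis at unit scale maps `h¹` boundedly into `H¹`. -/
lemma exists_hardyLE_latticeSynth {b : Matrix (Fin d) (Fin d) ℝ} (hb : b.det ≠ 0)
    {ν : (Fin d → ℝ) → ℝ} (hν : IsCutoff d ν) {ψ : (Fin d → ℝ) → ℂ} (hψ : Integrable ψ)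
    {B : ℝ} (hB : 0 ≤ B) (h : ∀ i, ∀ y : Fin d → ℝ, eucNorm y ≤ 1 →
      HasConjLE i (fun x => ψ x - ψ (x - y)) B) :
    ∃ A, 0 ≤ A ∧ ∀ s, h1Norm b ν s ≠ ⊤ →
      HardyLE (latticeSynth b ψ s) (A * (h1Norm b ν s).toReal) := by
  obtain ⟨φ, hφc, ⟨C, hC⟩, hφ, hφ', hφ1, hsupp⟩ := exists_bandLimited (bandLimit_mem_nhds b hν)
  choose g hg hp using fun i => exists_conj_sub_conv (i := i) hψ (hasConjLE_diff hψ hB (h i))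
    hφ hφ' hφ1
  have hψφ := integrable_conv_left hφ hψ
  have hnn : ∀ f : (Fin d → ℝ) → ℂ, 0 ≤ ∫ x, ‖f x‖ := fun f => integral_nonneg fun _ =>
    norm_nonneg _
  refine ⟨(∫ x, ‖ψ x‖) + (∑ i, ∫ x, ‖g i x‖) + (∫ x, ‖ψ x‖) * ∫ x, ‖φ x‖,
    add_nonneg (add_nonneg (hnn _) (Finset.sum_nonneg fun i _ => hnn _))
      (mul_nonneg (hnn _) (hnn _)), fun s hs => ?_⟩
  obtain ⟨hs1, hs1'⟩ := summable_norm_of_h1Norm_ne_top hs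
  set N := (h1Norm b ν s).toReal
  have hN : 0 ≤ N := ENNReal.toReal_nonneg
  have hA := mul_nonneg (mul_nonneg (hnn ψ) (hnn φ)) hN
  have hA' := mul_nonneg (Finset.sum_nonneg fun i (_ : i ∈ Finset.univ) => hnn (g i)) hN
  refine ⟨integrable_latticeSynth b hψ hs1, ?_, fun i => ?_⟩
  · refine (integral_norm_latticeSynth_le b hψ hs1).trans ?_
    have := mul_le_mul_of_nonneg_right hs1' (hnn ψ)
    linarith
  · obtain ⟨he, he'⟩ := summable_norm_dConv_of_h1Norm_ne_top hs i
    have hφd := integrable_latticeSynth b hφ he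
    have h1 := (hp i).latticeSynth b (hψ.sub hψφ) (hg i) hs1
    have h2 := ((isPair_latticeSynth_dConv hb hν hφ hsupp hs1 i he).conv_left hψ
      (integrable_latticeSynth b hφ hs1) hφd).congr_ae
      (ae_of_all _ fun x => (latticeSynth_conv b hψ hφc hC hs1 x).symm) ae_eq_rfl
    have hi1 := integrable_latticeSynth b (hg i) hs1
    have hi2 := integrable_conv_left hψ hφd
    refine ⟨_, hi1.add hi2, (h1.add h2 (integrable_latticeSynth b (hψ.sub hψφ) hs1)
      (integrable_latticeSynth b hψφ hs1) hi1 hi2).congr_ae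
      ((latticeSynth_add_ae b (hψ.sub hψφ) hψφ hs1).trans ?_) ae_eq_rfl, ?_⟩
    · simp only [Pi.sub_apply, sub_add_cancel]
      exact ae_eq_rfl
    · have e1 : ∫ x, ‖latticeSynth b (g i) s x‖ ≤ N * ∫ x, ‖g i x‖ :=
        (integral_norm_latticeSynth_le b (hg i) hs1).trans
          (mul_le_mul_of_nonneg_right hs1' (hnn _))
      have e2 := (integral_norm_conv_left_le hψ hφd).trans (mul_le_mul_of_nonneg_left
        ((integral_norm_latticeSynth_le b hφ he).trans
          (mul_le_mul_of_nonneg_right he' (hnn φ))) (hnn ψ))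
      have e3 := (integral_mono (hi1.add hi2).norm (hi1.norm.add hi2.norm)
        fun x => norm_add_le _ _).trans_eq (integral_add hi1.norm hi2.norm)
      have e4 : ∫ x, ‖g i x‖ ≤ ∑ i, ∫ x, ‖g i x‖ :=
        Finset.single_le_sum (f := fun i => ∫ x, ‖g i x‖) (fun i _ => hnn (g i))
          (Finset.mem_univ i)
      have e5 := mul_le_mul_of_nonneg_left e4 hN
      have e6 := mul_nonneg (hnn ψ) hN
      refine e3.trans ?_
      linarith

lemma h1Norm_ne_top_of_l1h1Norm {b : Matrix (Fin d) (Fin d) ℝ} {ν : (Fin d → ℝ) → ℝ}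
    {c : ℕ → (Fin d → ℤ) → ℂ} (h : l1h1Norm b ν c ≠ ⊤) (j : ℕ) : h1Norm b ν (c j) ≠ ⊤ :=
  ENNReal.ne_top_of_tsum_ne_top h j

lemma tsum_mul_rescH (α : ℕ → ℝ) (b : Matrix (Fin d) (Fin d) ℝ) (ψ : (Fin d → ℝ) → ℂ)
    (s : (Fin d → ℤ) → ℂ) (j : ℕ) (x : Fin d → ℝ) :
    ∑' k, s k * rescH α b ψ j k x =
      ((|α j| ^ d : ℝ) : ℂ) * latticeSynth b ψ s (α j • x) := by
  simp only [rescH, latticeSynth, ← tsum_mul_left, mul_left_comm]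

lemma integral_norm_mul_rescH {α : ℕ → ℝ} (b : Matrix (Fin d) (Fin d) ℝ)
    (ψ : (Fin d → ℝ) → ℂ) (s : (Fin d → ℤ) → ℂ) {j : ℕ} (hj : α j ≠ 0) (k : Fin d → ℤ) :
    ∫ x, ‖s k * rescH α b ψ j k x‖ = ‖s k‖ * ∫ x, ‖ψ x‖ := by
  rw [← integral_norm_latticeTerm b ψ s k,
    ← integral_norm_comp_smul (fun x => s k * ψ (x - b *ᵥ intVec k)) hj, ← integral_const_mul]
  simp only [rescH, norm_mul, Complex.norm_real, Real.norm_eq_abs, abs_pow, abs_abs, mul_left_comm]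

lemma h1SynthesisTo_of_hardyLE {α : ℕ → ℝ} (hα : ∀ j, α j ≠ 0)
    {b : Matrix (Fin d) (Fin d) ℝ} {ψ : (Fin d → ℝ) → ℂ} {c : ℕ → (Fin d → ℤ) → ℂ}
    (hc : ∀ j, Summable fun k => ‖c j k‖) {B : ℕ → ℝ} (hB : Summable B)
    (h : ∀ j, HardyLE (fun x => ∑' k, c j k * rescH α b ψ j k x) (B j)) :
    H1SynthesisTo α b ψ c fun x => ∑' j, ∑' k, c j k * rescH α b ψ j k x := by
  refine ⟨fun j => ?_, fun j => (h j).memH1, ?_, ?_⟩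
  · simp only [integral_norm_mul_rescH b ψ (c j) (hα j)]
    exact (hc j).mul_right _
  · refine Summable.of_nonneg_of_le (fun j => ENNReal.toReal_nonneg) (fun j => ?_)
      (hB.mul_left (hardyConst d))
    exact ENNReal.toReal_le_of_le_ofReal (mul_nonneg hardyConst_nonneg (h j).nonneg)
      (h j).hardyNorm_le
  · have hs : Summable fun j => ∫ x, ‖∑' k, c j k * rescH α b ψ j k x‖ :=
      Summable.of_nonneg_of_le (fun n => integral_nonneg fun _ => norm_nonneg _)
        (fun n => (h n).integral_norm_le) hB
    have htail : ∀ J, HardyLE (fun x => (∑' j, ∑' k, c j k * rescH α b ψ j k x) -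
        ∑ j ∈ Finset.range J, ∑' k, c j k * rescH α b ψ j k x) (∑' j, B (j + J)) := fun J => by
      refine (HardyLE.tsum (fun j => h (j + J)) ((summable_nat_add_iff J).2 hB)).congr_ae ?_
      filter_upwards [ae_summable_of_summable_integral_norm (fun j => (h j).integrable) hs]
        with x hx
      rw [← hx.sum_add_tsum_nat_add J, add_sub_cancel_left]
    refine tendsto_of_tendsto_of_tendsto_of_le_of_le tendsto_const_nhds ?_
      (fun J => zero_le) fun J => (htail J).hardyNorm_le
    have := ENNReal.tendsto_ofReal ((tendsto_sum_nat_add B).const_mul (hardyConst d))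
    simpa using this

end HardyBounds

/-- Theorem: Synthesis into `H¹`.
Isotropic expanding dilations `a_j = α_j I`.  If `ψ ∈ L¹` with
`sup_{|y| ≤ 1} ‖ψ - ψ(·-y)‖_{H¹} < ∞`, then `S : ℓ¹(h¹) → H¹` is bounded: there is a
constant `C = C(ψ,b)` so that every `c ∈ ℓ¹(h¹)` synthesizes, with the convergence
described in `H1SynthesisTo`, to a function `Sc ∈ H¹` with `‖Sc‖_{H¹} ≤ C ‖c‖_{ℓ¹(h¹)}`. -/
theorem statement7
    (d : ℕ) (b : Matrix (Fin d) (Fin d) ℝ) (hb : b.det ≠ 0)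
    (α : ℕ → ℝ) (hα : ∀ j, α j ≠ 0) (hαtop : Tendsto (fun j => |α j|) atTop atTop)
    (ν : (Fin d → ℝ) → ℝ) (hν : IsCutoff d ν)
    (ψ : (Fin d → ℝ) → ℂ) (hψ : Integrable ψ volume)
    (hsup : ∃ C : ℝ, ∀ y : Fin d → ℝ, eucNorm y ≤ 1 →
      ∃ g : (Fin d → ℝ) → Fin d → ℂ, Integrable g volume ∧
        HasRiesz (fun x => ψ x - ψ (x - y)) g ∧
        (∫ x : Fin d → ℝ, ‖ψ x - ψ (x - y)‖) + (∫ x : Fin d → ℝ, ‖g x‖) ≤ C) :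
    ∃ C : ℝ≥0∞, C ≠ ⊤ ∧
      ∀ c : ℕ → (Fin d → ℤ) → ℂ, l1h1Norm b ν c ≠ ⊤ →
        H1SynthesisTo α b ψ c
          (fun x => ∑' j : ℕ, ∑' k : Fin d → ℤ, c j k * rescH α b ψ j k x) ∧
        hardyNorm (fun x => ∑' j : ℕ, ∑' k : Fin d → ℤ, c j k * rescH α b ψ j k x) ≤
          C * l1h1Norm b ν c := by


  obtain ⟨C, hC⟩ := hsup
  set κ := (poissonMass d)⁻¹ * (rieszConst d)⁻¹
  have hκ : 0 ≤ κ :=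
    mul_nonneg (inv_nonneg.2 poissonMass_pos.le) (inv_nonneg.2 rieszConst_pos.le)
  have hconj : ∀ i, ∀ y : Fin d → ℝ, eucNorm y ≤ 1 →
      HasConjLE i (fun x => ψ x - ψ (x - y)) (κ * max C 0) := fun i y hy => by
    obtain ⟨g, hg, hr, hn⟩ := hC y hy
    refine (exists_hasConjLE_of_hasRiesz (hψ.sub (hψ.comp_sub_right y)) hg hr i).mono
      (mul_le_mul_of_nonneg_left (le_max_of_le_left ?_) hκ)
    have : 0 ≤ ∫ x : Fin d → ℝ, ‖ψ x - ψ (x - y)‖ := integral_nonneg fun _ => norm_nonneg _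
    linarith
  obtain ⟨A, hA, hA'⟩ := exists_hardyLE_latticeSynth hb hν hψ
    (mul_nonneg hκ (le_max_right C 0)) hconj
  refine ⟨ENNReal.ofReal (hardyConst d * A), ENNReal.ofReal_ne_top, fun c hc => ?_⟩
  have hcj := h1Norm_ne_top_of_l1h1Norm hc
  have hH : ∀ j, HardyLE (fun x => ∑' k, c j k * rescH α b ψ j k x)
      (A * (h1Norm b ν (c j)).toReal) := fun j => by
    simp only [tsum_mul_rescH]
    exact (hA' _ (hcj j)).dilate (hα j)
  have hB : Summable fun j => A * (h1Norm b ν (c j)).toReal :=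
    (ENNReal.summable_toReal hc).mul_left A
  refine ⟨h1SynthesisTo_of_hardyLE hα (fun j => (summable_norm_of_h1Norm_ne_top (hcj j)).1)
    hB hH, (HardyLE.tsum hH hB).hardyNorm_le.trans_eq ?_⟩
  rw [tsum_mul_left, ← ENNReal.tsum_toReal_eq hcj, ← mul_assoc,
    ENNReal.ofReal_mul (mul_nonneg hardyConst_nonneg hA), ← l1h1Norm, ENNReal.ofReal_toReal hc]

end AffinePaper
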